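/- Symmetry theorem for the Griffiths polynomials of q-Racah type: for all nonnegative integers i, j, x, y with i+j ≤ N and x+y ≤ N, one has G_{i,j}(x,y;c₁,c₂,c₃,c₄;N)·ω_i(c₂c₃c₄/c₁)·ω_x(c₄c₂c₁/c₃)·c₀^{N/2} = G_{j,i}(y,x;c₁,c₀,c₄,c₃;N)·ω_j(c₃c₀c₄/c₁)·ω_y(c₁c₀c₃/c₄)·c₂^{N/2}. (For the parameter list (c₁,c₀,c₄,c₃) the induced fifth parameter (q^{2N+3}c₁c₀c₄c₃)^{−1} equals c₂.) -/

import Mathlib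

noncomputable section
namespace qR

/-- q-Pochhammer symbol `(a;q)_k = ∏_{l<k} (1 - a qˡ)`. -/
def poch (q a : ℂ) (k : ℕ) : ℂ := ∏ l ∈ Finset.range k, (1 - a * q ^ l)

/-- q-binomial coefficient, zero outside `0 ≤ n ≤ N`. -/
def binom (q : ℂ) (N n : ℤ) : ℂ :=
  if 0 ≤ n ∧ n ≤ N then poch q q N.toNat / (poch q q n.toNat * poch q q (N - n).toNat) else 0

/-- Normalisation `Ω(n;c1,c2,c3;N)`; `s` and `t2` are the chosen square roots of `q` and `c2`,
so that `(q c2)^(n - N/2) = (s t2)^(2n - N)`. -/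
def Om (q s c1 c2 c3 t2 : ℂ) (N n : ℤ) : ℂ :=
  binom q N n * (1 - c2 * c3 * q ^ (2 * n + 1)) * poch q (q * c2) n.toNat
      * poch q (c1 * c2 * c3 * q ^ (N + 2)) n.toNat * poch q (q * c1) (N - n).toNat
    / ((s * t2) ^ (2 * n - N) * poch q (c2 * c3 * q ^ (n + 1)) (N + 1).toNat
        * poch q (q * c3) n.toNat)

/-- Normalised q-Racah polynomial `p_n(x;c1,c2,c3;N)`, with the convention that it
vanishes unless `0 ≤ n ≤ N` and `0 ≤ x ≤ N`. -/
def p (q s c1 c2 c3 t2 : ℂ) (N n x : ℤ) : ℂ :=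
  if 0 ≤ n ∧ n ≤ N ∧ 0 ≤ x ∧ x ≤ N then
    Om q s c1 c2 c3 t2 N n *
      ∑ k ∈ Finset.range (n.toNat + 1),
        poch q (q ^ (-n)) k * poch q (c2 * c3 * q ^ (n + 1)) k * poch q (q ^ (-x)) k
            * poch q (c1 * c2 * q ^ (x + 1)) k * q ^ k
          / (poch q (q * c2) k * poch q (c1 * c2 * c3 * q ^ (N + 2)) k
              * poch q (q ^ (-N)) k * poch q q k)
  else 0

/-- `ω_n(c) = (-1)^n c^{n/2} q^{n(n+1)/2}`, where `r` is the chosen square root of `c`. -/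
def om (q r : ℂ) (n : ℤ) : ℂ := (-1 : ℂ) ^ n * r ^ n * q ^ (n * (n + 1) / 2)

/-- `ξ_n(c1,c2) = ((qc1;q)_n/(qc2;q)_n) (c2/c1)^{n/2}`, where `t1, t2` are the chosen
square roots of `c1, c2`. -/
def xi (q c1 c2 t1 t2 : ℂ) (n : ℤ) : ℂ :=
  poch q (q * c1) n.toNat / poch q (q * c2) n.toNat * (t2 / t1) ^ n

/-- `λ(x;c) = -(1-q^{-x})(1-c q^{x+1})`. -/
def lam (q c : ℂ) (x : ℤ) : ℂ := -(1 - q ^ (-x)) * (1 - c * q ^ (x + 1))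

def PhiP (q c1 c2 c3 : ℂ) (N n : ℤ) : ℂ :=
  -c2 * q ^ (n - N) * (1 - q ^ n) * (1 - c1 * q ^ (N - n + 1)) * (1 - c2 * c3 * q ^ (n + N + 1))
      * (1 - c3 * q ^ n)
    / ((1 - c2 * c3 * q ^ (2 * n)) * (1 - c2 * c3 * q ^ (2 * n + 1)))

def PhiM (q c1 c2 c3 : ℂ) (N n : ℤ) : ℂ :=
  (1 - q ^ (n - N)) * (1 - c1 * c2 * c3 * q ^ (n + N + 2)) * (1 - c2 * q ^ (n + 1))
      * (1 - c2 * c3 * q ^ (n + 1))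
    / ((1 - c2 * c3 * q ^ (2 * n + 1)) * (1 - c2 * c3 * q ^ (2 * n + 2)))

/-- `Φ^ε(n;c1,c2,c3;N)`, where `ε = 1, -1, 0` selects `Φ⁺, Φ⁻, Φ⁰`. -/
def Phi (q c1 c2 c3 : ℂ) (N ε n : ℤ) : ℂ :=
  if ε = 1 then PhiP q c1 c2 c3 N n
  else if ε = -1 then PhiM q c1 c2 c3 N n
  else -PhiP q c1 c2 c3 N n - PhiM q c1 c2 c3 N n

/-- `λ₊(x;c1,c2,c3;N)`. -/
def lamP (q c1 c2 c3 : ℂ) (N x : ℤ) : ℂ :=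
  -(q ^ (-N - 1) / c3 - q ^ (-x)) * (1 - c1 * c2 * c3 * q ^ (N + x + 2))

/-- `λ₋(x;c1,c2,c3;N)`. -/
def lamM (q c1 c2 c3 : ℂ) (N x : ℤ) : ℂ :=
  -(q ^ (-N) - q ^ (-x)) * (1 - c1 * c2 * q ^ (N + x + 1))

def PhiPp (q sq c1 c2 c3 : ℂ) (N n : ℤ) : ℂ :=
  -sq * c2 * q ^ (2 * n - N - 1) * (1 - q ^ n) * (1 - c1 * q ^ (N - n + 1))
      * (1 - c1 * q ^ (N + 2 - n)) * (1 - c3 * q ^ n)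
    / ((1 - c2 * c3 * q ^ (2 * n)) * (1 - c2 * c3 * q ^ (2 * n + 1)))

def PhiPm (q sq c1 c2 c3 : ℂ) (N n : ℤ) : ℂ :=
  -((1 - c1 * c2 * c3 * q ^ (n + N + 2)) * (1 - c1 * c2 * c3 * q ^ (n + N + 3))
      * (1 - c2 * q ^ (n + 1)) * (1 - c2 * c3 * q ^ (n + 1)))
    / (c3 * q ^ (N + 1) * sq * (1 - c2 * c3 * q ^ (2 * n + 1)) * (1 - c2 * c3 * q ^ (2 * n + 2)))

def PhiP0 (q sq c1 c2 c3 : ℂ) (N n : ℤ) : ℂ :=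
  -PhiPp q sq c1 c2 c3 N n - PhiPm q sq c1 c2 c3 N n
    - (1 - c1 * c2 * q ^ (N + 2)) * (1 - c1 * c2 * c3 * q ^ (N + 2)) / (c3 * q ^ (N + 1) * sq)

def PhiMp (q sq c1 c2 c3 : ℂ) (N n : ℤ) : ℂ :=
  -sq * (1 - q ^ n) * (1 - c3 * q ^ n) * (1 - c2 * c3 * q ^ (n + N))
      * (1 - c2 * c3 * q ^ (n + N + 1))
    / (q ^ N * (1 - c2 * c3 * q ^ (2 * n)) * (1 - c2 * c3 * q ^ (2 * n + 1)))

def PhiMm (q sq c1 c2 c3 : ℂ) (N n : ℤ) : ℂ :=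
  -c3 * sq * q ^ N * (1 - q ^ (n - N)) * (1 - q ^ (n - N + 1)) * (1 - c2 * q ^ (n + 1))
      * (1 - c2 * c3 * q ^ (n + 1))
    / ((1 - c2 * c3 * q ^ (2 * n + 1)) * (1 - c2 * c3 * q ^ (2 * n + 2)))

def PhiM0 (q sq c1 c2 c3 : ℂ) (N n : ℤ) : ℂ :=
  -PhiMp q sq c1 c2 c3 N n - PhiMm q sq c1 c2 c3 N n - sq * (1 - c3 * q ^ N) * (q ^ (-N) - 1)

/-- Contiguity coefficient `Φ_σ^ε(n;c1,c2,c3;N)`, where `σ = 1` is the `+` and `σ = -1`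
the `-` family, `ε ∈ {1,0,-1}` selects the superscript, and `sq` is the chosen square
root of `q c2`. -/
def PhiC (q sq c1 c2 c3 : ℂ) (σ ε N n : ℤ) : ℂ :=
  if σ = 1 then
    if ε = 1 then PhiPp q sq c1 c2 c3 N n
    else if ε = -1 then PhiPm q sq c1 c2 c3 N n
    else PhiP0 q sq c1 c2 c3 N n
  else
    if ε = 1 then PhiMp q sq c1 c2 c3 N n
    else if ε = -1 then PhiMm q sq c1 c2 c3 N n
    else PhiM0 q sq c1 c2 c3 N n

def Fp (q c1 c2 : ℂ) (x : ℤ) : ℂ :=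
  c1 * c2 ^ 2 * q ^ (x + 1) * (1 - c1 * q ^ x) * (1 - q ^ x)
    / ((1 - c1 * c2 * q ^ (2 * x)) * (1 - c1 * c2 * q ^ (2 * x + 1)))

def Fm (q c1 c2 : ℂ) (x : ℤ) : ℂ :=
  c1 * c2 * q ^ (x + 1) * (1 - c2 * q ^ (x + 1)) * (1 - c1 * c2 * q ^ (x + 1))
    / ((1 - c1 * c2 * q ^ (2 * x + 1)) * (1 - c1 * c2 * q ^ (2 * x + 2)))

/-- The coefficients `A^{ε,ε'}_{i,j}(c1,c2,c3,c4;N)` for `(ε,ε') ≠ (0,0)`;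
`t2` is the chosen square root of `c2` and the fifth parameter
`c0 = (q^{2N+3} c1 c2 c3 c4)⁻¹` is computed internally. -/
def Aaux (q s c1 c2 c3 c4 t2 : ℂ) (N ε ε' i j : ℤ) : ℂ :=
  if ε' = 1 ∨ ε' = -1 then
    -c3 * q ^ (N + 1) *
        (if ε' = 1 then Fp q c4 ((q ^ (2 * N + 3) * c1 * c2 * c3 * c4)⁻¹) j
         else Fm q c4 ((q ^ (2 * N + 3) * c1 * c2 * c3 * c4)⁻¹) j) *
        PhiC q (s * t2) c1 c2 c3 ε' ε (N - j) i
  else if ε = 1 ∨ ε = -1 then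
    c3 * q ^ (N + 1) *
        (Fp q c4 ((q ^ (2 * N + 3) * c1 * c2 * c3 * c4)⁻¹) j
          + Fm q c4 ((q ^ (2 * N + 3) * c1 * c2 * c3 * c4)⁻¹) j) *
        Phi q c1 c2 c3 (N - j) ε i
  else 0

/-- The coefficients `A^{ε,ε'}_{i,j}(c1,c2,c3,c4;N)`. -/
def A (q s c1 c2 c3 c4 t2 : ℂ) (N ε ε' i j : ℤ) : ℂ :=
  if ε = 0 ∧ ε' = 0 then
    -((1 - c3 * q ^ (N + 1 - j)) * (s * t2) / (1 - c1 * c2 * q ^ (N + 2 - j)))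
          * ∑ e ∈ ({-1, 0, 1} : Finset ℤ), Aaux q s c1 c2 c3 c4 t2 N e 1 i j
      - (1 - c1 * c2 * q ^ (N + 1 - j)) / ((1 - c3 * q ^ (N - j)) * (s * t2))
          * ∑ e ∈ ({-1, 0, 1} : Finset ℤ), Aaux q s c1 c2 c3 c4 t2 N e (-1) i j
      - ∑ e ∈ ({-1, 1} : Finset ℤ), Aaux q s c1 c2 c3 c4 t2 N e 0 i j
  else Aaux q s c1 c2 c3 c4 t2 N ε ε' i j

/-- `Λ(x;c1,c2,c3,c4;N)`; `s, t1, t2, t3, t4` are the chosen square roots of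
`q, c1, c2, c3, c4`. -/
def Lam (q s c1 c2 c3 c4 t1 t2 t3 t4 : ℂ) (N x : ℤ) : ℂ :=
  (-1 : ℂ) ^ x * binom q N x * (1 - c1 * c2 * q ^ (2 * x + 1)) * poch q (q * c2) x.toNat
      * (s * t2) ^ N * (t1 * t3 / (t2 * t4)) ^ x * q ^ (x * (x - 1) / 2)
    / (poch q (q * c1) x.toNat * poch q (q ^ (x + 1) * c1 * c2) (N + 1).toNat)

/-- Tratnik polynomial of q-Racah type `T_{i,j}(x,y;c1,c2,c3,c4;N)`; the fifth parameter
`c0 = (q^{2N+3} c1 c2 c3 c4)⁻¹` and its square root `t0 = (s^{2N+3} t1 t2 t3 t4)⁻¹`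
are computed internally. -/
def T (q s c1 c2 c3 c4 t1 t2 t3 t4 : ℂ) (N i j x y : ℤ) : ℂ :=
  if 0 ≤ i ∧ 0 ≤ j ∧ i + j ≤ N then
    p q s c1 c2 c3 t2 (N - j) i x *
      p q s c3 ((q ^ (2 * N + 3) * c1 * c2 * c3 * c4)⁻¹) c4
        ((s ^ (2 * N + 3) * t1 * t2 * t3 * t4)⁻¹) (N - x) j y
  else 0

/-- Griffiths polynomial of q-Racah type `G_{i,j}(x,y;c1,c2,c3,c4;N)`; the fifth parameter
`c0 = (q^{2N+3} c1 c2 c3 c4)⁻¹` and its square root `t0 = (s^{2N+3} t1 t2 t3 t4)⁻¹`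
are computed internally. -/
def G (q s c1 c2 c3 c4 t1 t2 t3 t4 : ℂ) (N i j x y : ℤ) : ℂ :=
  if 0 ≤ i ∧ 0 ≤ j ∧ i + j ≤ N then
    ∑ a ∈ Finset.range ((min (N - j) (N - y)).toNat + 1),
      om q (t1 * t2 * t3 / t4) (a : ℤ) * p q s c1 c2 c3 t2 (N - j) i (a : ℤ) *
        p q s c3 ((q ^ (2 * N + 3) * c1 * c2 * c3 * c4)⁻¹) c4
          ((s ^ (2 * N + 3) * t1 * t2 * t3 * t4)⁻¹) (N - (a : ℤ)) j y *
        p q s c4 c2 c1 t2 (N - y) (a : ℤ) x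
  else 0

end qR

namespace qRH
open qR (poch)
set_option linter.all false
set_option linter.unusedSimpArgs false
set_option linter.unusedVariables false

lemma poch_zero (q a : ℂ) : poch q a 0 = 1 := by simp [poch]

lemma poch_succ (q a : ℂ) (k : ℕ) : poch q a (k + 1) = poch q a k * (1 - a * q ^ k) := by
  simp [poch, Finset.prod_range_succ]

lemma poch_shift (q a : ℂ) (k : ℕ) : (1 - a) * poch q (q * a) k = poch q a (k + 1) := by
  simp only [poch, Finset.prod_range_succ']
  simp only [pow_zero, mul_one]
  rw [mul_comm]
  congr 1
  apply Finset.prod_congr rfl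
  intro l _
  ring

lemma poch_shift' (q a : ℂ) (k : ℕ) (h : 1 - a ≠ 0) :
    poch q (q * a) k = poch q a (k + 1) / (1 - a) := by
  rw [← poch_shift]; field_simp

/-- the elementary factor -/
def u (q c : ℂ) (k : ℕ) : ℂ := 1 - c * q ^ k

def pp (q c : ℂ) (k : ℕ) : ℂ := poch q (q * c) k

lemma pp_zero (q c : ℂ) : pp q c 0 = 1 := by simp [pp, poch]
lemma pp_succ (q c : ℂ) (k : ℕ) : pp q c (k + 1) = pp q c k * u q c (k + 1) := by
  rw [pp, pp, u, poch_succ]; ring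
lemma pp_shift (q c : ℂ) (k : ℕ) (h : u q c 1 ≠ 0) : pp q (q * c) k = pp q c (k + 1) / u q c 1 := by
  rw [eq_div_iff h, pp, pp, ← poch_shift, u]; ring
lemma u_shift (q c : ℂ) (k : ℕ) : u q (q * c) k = u q c (k + 1) := by
  simp only [u]; ring

/-- non-vanishing of `1 - c q^k` for `1 ≤ k ≤ L`. -/
def NZ (q c : ℂ) (L : ℕ) : Prop := ∀ k : ℕ, 1 ≤ k → k ≤ L → u q c k ≠ 0

lemma NZ.pp {q c : ℂ} {L : ℕ} (h : NZ q c L) {k : ℕ} (hk : k ≤ L) : pp q c k ≠ 0 := by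
  induction k with
  | zero => simp [pp_zero]
  | succ k ih =>
    rw [pp_succ]
    exact mul_ne_zero (ih (by omega)) (h _ (by omega) hk)

lemma NZ.mono {q c : ℂ} {L L' : ℕ} (h : NZ q c L) (hk : L' ≤ L) : NZ q c L' :=
  fun k h1 h2 => h k h1 (by omega)

lemma NZ.shift {q c : ℂ} {L : ℕ} (h : NZ q c (L + 1)) : NZ q (q * c) L := by
  intro k h1 h2
  rw [u_shift]
  exact h (k + 1) (by omega) (by omega)

def B1 (q : ℂ) (k r s : ℕ) : ℂ := pp q 1 (r + s) / (pp q 1 r * pp q 1 s * pp q 1 k)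
def B2 (q c2 : ℂ) (k r : ℕ) : ℂ := pp q c2 (k + r) / pp q c2 k
def B3 (q c3 : ℂ) (k r : ℕ) : ℂ := 1 / pp q c3 (k + r)
def BE (q e : ℂ) (k r s : ℕ) : ℂ := pp q e (2 * k + 2 * r + s + 1) / pp q e (2 * k + r + s + 1)
def BB (q b : ℂ) (k r s : ℕ) : ℂ :=
  u q b (2 * k + 2 * r + 1) * pp q b (2 * k + r) / pp q b (2 * k + 2 * r + s + 1)

/-- coefficient in the split basis -/
def T0 (q b e c1 c2 c3 : ℂ) (k r s : ℕ) : ℂ :=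
  q ^ ((s + 1) * k) * B1 q k r s * B2 q c2 k r * B3 q c3 k r * pp q c1 s * BE q e k r s * BB q b k r s

def T (q c1 c2 c3 : ℂ) (M n k : ℕ) : ℂ :=
  if k ≤ n ∧ n ≤ M then T0 q (c2 * c3) (c1 * c2 * c3) c1 c2 c3 k (n - k) (M - n) else 0

def phi (q g : ℂ) (x k : ℕ) : ℂ := poch q ((q ^ x)⁻¹) k * poch q (g * q ^ (x + 1)) k

def P (q c1 c2 c3 : ℂ) (M n x : ℕ) : ℂ :=
  if x ≤ M then ∑ k ∈ Finset.range (n + 1), T q c1 c2 c3 M n k * phi q (c1 * c2) x k else 0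

def dn (n : ℕ) (f : ℕ → ℂ) : ℂ := if n = 0 then 0 else f (n - 1)

lemma dn_zero (f : ℕ → ℂ) : dn 0 f = 0 := by simp [dn]
lemma dn_succ (n : ℕ) (f : ℕ → ℂ) : dn (n + 1) f = f n := by simp [dn]

lemma T_eq (q c1 c2 c3 : ℂ) (k r s n M : ℕ) (hn : n = k + r) (hM : M = k + r + s) :
    T q c1 c2 c3 M n k = T0 q (c2 * c3) (c1 * c2 * c3) c1 c2 c3 k r s := by
  subst hn hM
  rw [T, if_pos (by omega)]
  congr 1 <;> omega

lemma T_zero (q c1 c2 c3 : ℂ) (M n k : ℕ) (h : n < k ∨ M < n) : T q c1 c2 c3 M n k = 0 := by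
  rw [T, if_neg (by omega)]

lemma P_eq (q c1 c2 c3 : ℂ) (M n x K : ℕ) (hx : x ≤ M) (hK : n < K) :
    P q c1 c2 c3 M n x = ∑ k ∈ Finset.range K, T q c1 c2 c3 M n k * phi q (c1 * c2) x k := by
  rw [P, if_pos hx]
  apply Finset.sum_subset
  · intro k hk; simp at hk ⊢; omega
  · intro k _ hk
    rw [T_zero _ _ _ _ _ _ _ (by simp at hk; omega)]; simp

lemma P_zero (q c1 c2 c3 : ℂ) (M n x : ℕ) (h : M < n ∨ M < x) : P q c1 c2 c3 M n x = 0 := by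
  rw [P]
  split_ifs with hx
  · apply Finset.sum_eq_zero
    intro k _
    rw [T_zero _ _ _ _ _ _ _ (by omega)]; simp
  · rfl

lemma phi_zero_of_lt (q g : ℂ) (hq : q ≠ 0) (x k : ℕ) (h : x < k) : phi q g x k = 0 := by
  have : poch q ((q ^ x)⁻¹) k = 0 := by
    rw [poch, Finset.prod_eq_zero_iff]
    refine ⟨x, by simpa using h, ?_⟩
    field_simp; ring
  rw [phi, this, zero_mul]

lemma phi_zero (q g : ℂ) (x : ℕ) : phi q g x 0 = 1 := by simp [phi, poch_zero]

lemma abel (t f g a b : ℕ → ℂ) (K : ℕ) (h0 : g 0 = a 0 * f 0)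
    (h : ∀ k, g (k + 1) = a (k + 1) * f (k + 1) + b (k + 1) * f k) (hf : f K = 0) :
    ∑ k ∈ Finset.range (K + 1), t k * g k
      = ∑ k ∈ Finset.range K, (a k * t k + b (k + 1) * t (k + 1)) * f k := by
  have key : ∀ K, ∑ k ∈ Finset.range (K + 1), t k * g k
      = ∑ k ∈ Finset.range K, (a k * t k + b (k + 1) * t (k + 1)) * f k + t K * a K * f K := by
    intro K
    induction K with
    | zero => simp [h0]; ring
    | succ K ih =>
      rw [Finset.sum_range_succ, ih, h, Finset.sum_range_succ]
      ring
  rw [key, hf]; ring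

/-- shift in both parameters (lines AB) -/
lemma phi_AB (q g : ℂ) (hq : q ≠ 0) (x k : ℕ) :
    phi q g (x + 1) (k + 1) = (q ^ (k + 1))⁻¹ * phi q (q * q * g) x (k + 1)
      + (-((q ^ (k + 1))⁻¹ * (1 - q ^ (k + 1)) * (1 - g * q ^ (k + 2)))) * phi q (q * q * g) x k := by
  have e1 : poch q ((q ^ (x + 1))⁻¹) (k + 1) = (1 - (q ^ (x + 1))⁻¹) * poch q ((q ^ x)⁻¹) k := by
    rw [← poch_shift]; congr 2
    field_simp
    ring
  have e2 : poch q (g * q ^ (x + 1 + 1)) (k + 1)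
      = (1 - g * q ^ (x + 2)) * poch q (q * q * g * q ^ (x + 1)) k := by
    rw [← poch_shift]; congr 2
    ring
  simp only [phi, e1, e2]
  rw [poch_succ q ((q ^ x)⁻¹), poch_succ q (q * q * g * q ^ (x + 1))]
  generalize poch q ((q ^ x)⁻¹) k = u
  generalize poch q (q * q * g * q ^ (x + 1)) k = v
  field_simp
  ring

lemma phi_BD (q g z : ℂ) (hq : q ≠ 0) (x k : ℕ) (hg : 1 - g * q ^ (2 * x + 2) ≠ 0) :
    q ^ x / (1 - g * q ^ (2 * x + 2)) * ((1 - z / q ^ x) * phi q g x (k + 1)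
        - (1 - g * z * q ^ (x + 2)) * phi q g (x + 1) (k + 1))
      = (-z) * phi q (q * g) x (k + 1)
        + ((1 - q ^ (k + 1)) * (q⁻¹ - g * z * q ^ (k + 1))) * phi q (q * g) x k := by
  have e1 : poch q ((q ^ (x + 1))⁻¹) (k + 1) = (1 - (q ^ (x + 1))⁻¹) * poch q ((q ^ x)⁻¹) k := by
    rw [← poch_shift]; congr 2
    field_simp
    ring
  have e2 : poch q (g * q ^ (x + 1)) (k + 1)
      = (1 - g * q ^ (x + 1)) * poch q (q * g * q ^ (x + 1)) k := by
    rw [← poch_shift]; congr 2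
    ring
  have e3 : poch q (g * q ^ (x + 1 + 1)) (k + 1)
      = (1 - g * q ^ (x + k + 2)) * poch q (q * g * q ^ (x + 1)) k := by
    rw [poch_succ]
    rw [show g * q ^ (x + 1 + 1) = q * g * q ^ (x + 1) by ring]
    ring
  simp only [phi, e1, e2, e3]
  rw [poch_succ q ((q ^ x)⁻¹), poch_succ q (q * g * q ^ (x + 1))]
  generalize poch q ((q ^ x)⁻¹) k = u
  generalize poch q (q * g * q ^ (x + 1)) k = v
  rw [div_mul_eq_mul_div, div_eq_iff hg]
  field_simp
  ring

lemma phi_BD0 (q g z : ℂ) (hq : q ≠ 0) (x : ℕ) (hg : 1 - g * q ^ (2 * x + 2) ≠ 0) :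
    q ^ x / (1 - g * q ^ (2 * x + 2)) * ((1 - z / q ^ x) * phi q g x 0
        - (1 - g * z * q ^ (x + 2)) * phi q g (x + 1) 0)
      = (-z) * phi q (q * g) x 0 := by
  simp only [phi_zero]
  rw [div_mul_eq_mul_div, div_eq_iff hg]
  field_simp
  ring


/-- genericity needed for one q-Racah family -/
structure Gen (q c1 c2 c3 b e : ℂ) (K L : ℕ) : Prop where
  hq : q ≠ 0
  h0 : NZ q 1 K
  h1 : NZ q c1 L
  h2 : NZ q c2 L
  h3 : NZ q c3 L
  hb : NZ q b L
  he : NZ q e L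

lemma u10 (q : ℂ) : u q 1 0 = 0 := by simp [u]

lemma a11 (x : ℕ) : x + 1 + 1 = x + 2 := rfl
lemma a21 (x : ℕ) : x + 2 + 1 = x + 3 := rfl


lemma RB0 {q c1 c2 c3 b e : ℂ} {k r s K L : ℕ} (hK : k + r + s + 1 ≤ K)
    (hL : 2 * k + 2 * r + s + 5 ≤ L) (g : Gen q c1 c2 c3 b e K L) :
    B1 q k r s = (u q 1 (s + 1)) / (u q 1 (r + s + 1)) * B1 q k r (s + 1) := by
  have m0 := g.h0.pp (k := s) (by omega)
  have m1 := g.h0.pp (k := r) (by omega)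
  have m2 := g.h0.pp (k := k) (by omega)
  have m3 := g.h0 (s + 1) (by omega) (by omega)
  have m4 := g.h0 (r + s + 1) (by omega) (by omega)
  simp only [B1,
    show r + (s + 1) = r + s + 1 from by ring]
  simp only [pp_succ]
  field_simp

lemma RB1 {q c1 c2 c3 b e : ℂ} {k r s K L : ℕ} (hK : k + r + s + 1 ≤ K)
    (hL : 2 * k + 2 * r + s + 5 ≤ L) (g : Gen q c1 c2 c3 b e K L) :
    B2 q (q * c2) k r = (u q c2 (k + r + 1)) / (u q c2 (k + 1)) * B2 q c2 k r := by
  have m0 := g.h2.pp (k := k) (by omega)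
  have m1 := g.h2 1 (by omega) (by omega)
  have m2 := g.h2 (k + 1) (by omega) (by omega)
  simp only [B2]
  simp only [pp_shift q c2 _ m1]
  simp only [pp_succ]
  field_simp

lemma RB2 {q c1 c2 c3 b e : ℂ} {k r s K L : ℕ} (hK : k + r + s + 1 ≤ K)
    (hL : 2 * k + 2 * r + s + 5 ≤ L) (g : Gen q c1 c2 c3 b e K L) :
    BB q (q * b) k r s = (u q b (2 * k + 2 * r + 2) * u q b (2 * k + r + 1)) / (u q b (2 * k + 2 * r + 1)) * BB q b k r (s + 1) := by
  have m0 := g.hb.pp (k := 2 * k + 2 * r + s) (by omega)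
  have m1 := g.hb 1 (by omega) (by omega)
  have m2 := g.hb (2 * k + 2 * r + 1) (by omega) (by omega)
  have m3 := g.hb (2 * k + 2 * r + s + 1) (by omega) (by omega)
  have m4 := g.hb (2 * k + 2 * r + s + 2) (by omega) (by omega)
  simp only [BB,
    show 2 * k + 2 * r + (s + 1) + 1 = 2 * k + 2 * r + s + 2 from by ring]
  simp only [pp_shift q b _ m1, u_shift]
  simp only [pp_succ]
  field_simp

lemma RB3 {q c1 c2 c3 b e : ℂ} {k r s K L : ℕ} (hK : k + r + s + 1 ≤ K)
    (hL : 2 * k + 2 * r + s + 5 ≤ L) (g : Gen q c1 c2 c3 b e K L) :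
    q ^ ((s + 1) * k) = 1 / q ^ k * q ^ ((s + 1 + 1) * k) := by
  have := g.hq
  field_simp
  ring

lemma RB4 {q c1 c2 c3 b e : ℂ} {k r s K L : ℕ} (hK : k + r + s + 1 ≤ K)
    (hL : 2 * k + 2 * r + s + 5 ≤ L) (g : Gen q c1 c2 c3 b e K L) :
    B1 q k r s = (u q 1 (r + 1)) / (u q 1 (r + s + 1)) * B1 q k (r + 1) s := by
  have m0 := g.h0.pp (k := s) (by omega)
  have m1 := g.h0.pp (k := r) (by omega)
  have m2 := g.h0.pp (k := k) (by omega)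
  have m3 := g.h0 (r + 1) (by omega) (by omega)
  have m4 := g.h0 (r + s + 1) (by omega) (by omega)
  simp only [B1,
    show (r + 1) + s = r + s + 1 from by ring]
  simp only [pp_succ]
  field_simp

lemma RB5 {q c1 c2 c3 b e : ℂ} {k r s K L : ℕ} (hK : k + r + s + 1 ≤ K)
    (hL : 2 * k + 2 * r + s + 5 ≤ L) (g : Gen q c1 c2 c3 b e K L) :
    B2 q (q * c2) k r = (1) / (u q c2 (k + 1)) * B2 q c2 k (r + 1) := by
  have m0 := g.h2.pp (k := k) (by omega)
  have m1 := g.h2 1 (by omega) (by omega)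
  have m2 := g.h2 (k + 1) (by omega) (by omega)
  simp only [B2,
    show k + (r + 1) = k + r + 1 from by ring]
  simp only [pp_shift q c2 _ m1]
  simp only [pp_succ]
  field_simp

lemma RB6 {q c1 c2 c3 b e : ℂ} {k r s K L : ℕ} (hK : k + r + s + 1 ≤ K)
    (hL : 2 * k + 2 * r + s + 5 ≤ L) (g : Gen q c1 c2 c3 b e K L) :
    B3 q c3 k r = (u q c3 (k + r + 1)) / (1) * B3 q c3 k (r + 1) := by
  have m0 := g.h3.pp (k := k + r) (by omega)
  have m1 := g.h3 (k + r + 1) (by omega) (by omega)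
  simp only [B3,
    show k + (r + 1) = k + r + 1 from by ring]
  simp only [pp_succ]
  field_simp

lemma RB7 {q c1 c2 c3 b e : ℂ} {k r s K L : ℕ} (hK : k + r + s + 1 ≤ K)
    (hL : 2 * k + 2 * r + s + 5 ≤ L) (g : Gen q c1 c2 c3 b e K L) :
    BB q (q * b) k r s = (u q b (2 * k + 2 * r + 2) * u q b (2 * k + 2 * r + s + 3)) / (u q b (2 * k + 2 * r + 3)) * BB q b k (r + 1) s := by
  have m0 := g.hb.pp (k := 2 * k + 2 * r + s) (by omega)
  have m1 := g.hb 1 (by omega) (by omega)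
  have m2 := g.hb (2 * k + 2 * r + 3) (by omega) (by omega)
  have m3 := g.hb (2 * k + 2 * r + s + 1) (by omega) (by omega)
  have m4 := g.hb (2 * k + 2 * r + s + 2) (by omega) (by omega)
  have m5 := g.hb (2 * k + 2 * r + s + 3) (by omega) (by omega)
  simp only [BB,
    show 2 * k + 2 * (r + 1) + 1 = 2 * k + 2 * r + 3 from by ring,
    show 2 * k + 2 * (r + 1) + s + 1 = 2 * k + 2 * r + s + 3 from by ring,
    show 2 * k + (r + 1) = 2 * k + r + 1 from by ring]
  simp only [pp_shift q b _ m1, u_shift]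
  simp only [pp_succ]
  field_simp

lemma RB8 {q c1 c2 c3 b e : ℂ} {k r s K L : ℕ} (hK : k + r + s + 1 ≤ K)
    (hL : 2 * k + 2 * r + s + 5 ≤ L) (g : Gen q c1 c2 c3 b e K L) :
    B3 q (q * c3) k r = (u q c3 1) / (u q c3 (k + r + 1)) * B3 q c3 k r := by
  have m0 := g.h3.pp (k := k + r) (by omega)
  have m1 := g.h3 1 (by omega) (by omega)
  have m2 := g.h3 (k + r + 1) (by omega) (by omega)
  simp only [B3]
  simp only [pp_shift q c3 _ m1]
  simp only [pp_succ]
  field_simp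

lemma RB9 {q c1 c2 c3 b e : ℂ} {k r s K L : ℕ} (hK : k + r + s + 1 ≤ K)
    (hL : 2 * k + 2 * r + s + 5 ≤ L) (g : Gen q c1 c2 c3 b e K L) :
    pp q c1 s = (1) / (u q c1 (s + 1)) * pp q c1 (s + 1) := by
  have m0 := g.h1 (s + 1) (by omega) (by omega)
  simp only [pp_succ]
  field_simp

lemma RB10 {q c1 c2 c3 b e : ℂ} {k r s K L : ℕ} (hK : k + r + s + 1 ≤ K)
    (hL : 2 * k + 2 * r + s + 5 ≤ L) (g : Gen q c1 c2 c3 b e K L) :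
    BE q (q * e) k r s = (1) / (1) * BE q e k r (s + 1) := by
  have m0 := g.he.pp (k := 2 * k + r + s) (by omega)
  have m1 := g.he 1 (by omega) (by omega)
  have m2 := g.he (2 * k + r + s + 1) (by omega) (by omega)
  have m3 := g.he (2 * k + r + s + 2) (by omega) (by omega)
  simp only [BE,
    show 2 * k + 2 * r + (s + 1) + 1 = 2 * k + 2 * r + s + 2 from by ring,
    show 2 * k + r + (s + 1) + 1 = 2 * k + r + s + 2 from by ring]
  simp only [pp_shift q e _ m1]
  simp only [pp_succ]
  field_simp

lemma RB11 {q c1 c2 c3 b e : ℂ} {k r s K L : ℕ} (hK : k + r + s + 1 ≤ K)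
    (hL : 2 * k + 2 * r + s + 5 ≤ L) (g : Gen q c1 c2 c3 b e K L) :
    B2 q c2 k r = (1) / (u q c2 (k + r + 1)) * B2 q c2 k (r + 1) := by
  have m0 := g.h2.pp (k := k) (by omega)
  have m1 := g.h2 (k + r + 1) (by omega) (by omega)
  simp only [B2,
    show k + (r + 1) = k + r + 1 from by ring]
  simp only [pp_succ]
  field_simp

lemma RB12 {q c1 c2 c3 b e : ℂ} {k r s K L : ℕ} (hK : k + r + s + 1 ≤ K)
    (hL : 2 * k + 2 * r + s + 5 ≤ L) (g : Gen q c1 c2 c3 b e K L) :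
    B3 q (q * c3) k r = (u q c3 1) / (1) * B3 q c3 k (r + 1) := by
  have m0 := g.h3.pp (k := k + r) (by omega)
  have m1 := g.h3 1 (by omega) (by omega)
  have m2 := g.h3 (k + r + 1) (by omega) (by omega)
  simp only [B3,
    show k + (r + 1) = k + r + 1 from by ring]
  simp only [pp_shift q c3 _ m1]
  simp only [pp_succ]
  field_simp

lemma RB13 {q c1 c2 c3 b e : ℂ} {k r s K L : ℕ} (hK : k + r + s + 1 ≤ K)
    (hL : 2 * k + 2 * r + s + 5 ≤ L) (g : Gen q c1 c2 c3 b e K L) :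
    BE q (q * e) k r s = (1) / (u q e (2 * k + 2 * r + s + 3)) * BE q e k (r + 1) s := by
  have m0 := g.he.pp (k := 2 * k + r + s) (by omega)
  have m1 := g.he 1 (by omega) (by omega)
  have m2 := g.he (2 * k + r + s + 1) (by omega) (by omega)
  have m3 := g.he (2 * k + r + s + 2) (by omega) (by omega)
  have m4 := g.he (2 * k + 2 * r + s + 3) (by omega) (by omega)
  simp only [BE,
    show 2 * k + 2 * (r + 1) + s + 1 = 2 * k + 2 * r + s + 3 from by ring,
    show 2 * k + (r + 1) + s + 1 = 2 * k + r + s + 2 from by ring]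
  simp only [pp_shift q e _ m1]
  simp only [pp_succ]
  field_simp

lemma RB14 {q c1 c2 c3 b e : ℂ} {k r s K L : ℕ} (hK : k + r + s + 1 ≤ K)
    (hL : 2 * k + 2 * r + s + 5 ≤ L) (g : Gen q c1 c2 c3 b e K L) :
    BE q (q * e) k r s = (u q e (2 * k + 2 * r + s + 2)) / (u q e (2 * k + r + s + 2)) * BE q e k r s := by
  have m0 := g.he.pp (k := 2 * k + r + s) (by omega)
  have m1 := g.he 1 (by omega) (by omega)
  have m2 := g.he (2 * k + r + s + 1) (by omega) (by omega)
  have m3 := g.he (2 * k + r + s + 2) (by omega) (by omega)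
  simp only [BE]
  simp only [pp_shift q e _ m1]
  simp only [pp_succ]
  field_simp

lemma RB15 {q c1 c2 c3 b e : ℂ} {k r s K L : ℕ} (hK : k + r + s + 1 ≤ K)
    (hL : 2 * k + 2 * r + s + 5 ≤ L) (g : Gen q c1 c2 c3 b e K L) :
    BB q (q * b) k r s = (u q b (2 * k + 2 * r + 2) * u q b (2 * k + r + 1)) / (u q b (2 * k + 2 * r + s + 2) * u q b (2 * k + 2 * r + 1)) * BB q b k r s := by
  have m0 := g.hb.pp (k := 2 * k + 2 * r + s) (by omega)
  have m1 := g.hb 1 (by omega) (by omega)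
  have m2 := g.hb (2 * k + 2 * r + 1) (by omega) (by omega)
  have m3 := g.hb (2 * k + 2 * r + s + 1) (by omega) (by omega)
  have m4 := g.hb (2 * k + 2 * r + s + 2) (by omega) (by omega)
  simp only [BB]
  simp only [pp_shift q b _ m1, u_shift]
  simp only [pp_succ]
  field_simp

lemma RB16 {q c1 c2 c3 b e : ℂ} {k r s K L : ℕ} (hK : k + r + s + 1 ≤ K)
    (hL : 2 * k + 2 * r + s + 5 ≤ L) (g : Gen q c1 c2 c3 b e K L) :
    B1 q k r (s + 1) = (u q 1 (r + 1)) / (u q 1 (s + 1)) * B1 q k (r + 1) s := by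
  have m0 := g.h0.pp (k := s) (by omega)
  have m1 := g.h0.pp (k := r) (by omega)
  have m2 := g.h0.pp (k := k) (by omega)
  have m3 := g.h0 (s + 1) (by omega) (by omega)
  have m4 := g.h0 (r + 1) (by omega) (by omega)
  simp only [B1,
    show (r + 1) + s = r + s + 1 from by ring,
    show r + (s + 1) = r + s + 1 from by ring]
  simp only [pp_succ]
  field_simp

lemma RB17 {q c1 c2 c3 b e : ℂ} {k r s K L : ℕ} (hK : k + r + s + 1 ≤ K)
    (hL : 2 * k + 2 * r + s + 5 ≤ L) (g : Gen q c1 c2 c3 b e K L) :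
    pp q c1 (s + 1) = (u q c1 (s + 1)) / (1) * pp q c1 s := by
  simp only [pp_succ]
  field_simp

lemma RB18 {q c1 c2 c3 b e : ℂ} {k r s K L : ℕ} (hK : k + r + s + 1 ≤ K)
    (hL : 2 * k + 2 * r + s + 5 ≤ L) (g : Gen q c1 c2 c3 b e K L) :
    BE q (q * e) k r (s + 1) = (1) / (u q e (2 * k + r + s + 3)) * BE q e k (r + 1) s := by
  have m0 := g.he.pp (k := 2 * k + r + s) (by omega)
  have m1 := g.he 1 (by omega) (by omega)
  have m2 := g.he (2 * k + r + s + 1) (by omega) (by omega)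
  have m3 := g.he (2 * k + r + s + 2) (by omega) (by omega)
  have m4 := g.he (2 * k + r + s + 3) (by omega) (by omega)
  simp only [BE,
    show 2 * k + 2 * (r + 1) + s + 1 = 2 * k + 2 * r + s + 3 from by ring,
    show 2 * k + (r + 1) + s + 1 = 2 * k + r + s + 2 from by ring,
    show 2 * k + 2 * r + (s + 1) + 1 = 2 * k + 2 * r + s + 2 from by ring,
    show 2 * k + r + (s + 1) + 1 = 2 * k + r + s + 2 from by ring]
  simp only [pp_shift q e _ m1]
  simp only [pp_succ]
  field_simp

lemma RB19 {q c1 c2 c3 b e : ℂ} {k r s K L : ℕ} (hK : k + r + s + 1 ≤ K)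
    (hL : 2 * k + 2 * r + s + 5 ≤ L) (g : Gen q c1 c2 c3 b e K L) :
    BB q (q * b) k r (s + 1) = (u q b (2 * k + 2 * r + 2)) / (u q b (2 * k + 2 * r + 3)) * BB q b k (r + 1) s := by
  have m0 := g.hb.pp (k := 2 * k + 2 * r + s) (by omega)
  have m1 := g.hb 1 (by omega) (by omega)
  have m2 := g.hb (2 * k + 2 * r + 3) (by omega) (by omega)
  have m3 := g.hb (2 * k + 2 * r + s + 1) (by omega) (by omega)
  have m4 := g.hb (2 * k + 2 * r + s + 2) (by omega) (by omega)
  have m5 := g.hb (2 * k + 2 * r + s + 3) (by omega) (by omega)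
  simp only [BB,
    show 2 * k + 2 * (r + 1) + 1 = 2 * k + 2 * r + 3 from by ring,
    show 2 * k + 2 * (r + 1) + s + 1 = 2 * k + 2 * r + s + 3 from by ring,
    show 2 * k + (r + 1) = 2 * k + r + 1 from by ring,
    show 2 * k + 2 * r + (s + 1) + 1 = 2 * k + 2 * r + s + 2 from by ring]
  simp only [pp_shift q b _ m1, u_shift]
  simp only [pp_succ]
  field_simp

lemma R_ABp1 (q c1 c2 c3 b e : ℂ) (k r s K L : ℕ) (hK : k + r + s + 1 ≤ K)
    (hL : 2 * k + 2 * r + s + 5 ≤ L) (g : Gen q c1 c2 c3 b e K L) :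
    T0 q (q * b) (q * (q * e)) (q * c1) (q * c2) c3 k r s
      = (u q 1 (s + 1) * u q c2 (k + r + 1) * u q e (2 * k + 2 * r + s + 3) * u q b (2 * k + 2 * r + 2) * u q b (2 * k + r + 1)) /
        (u q 1 (r + s + 1) * u q c2 (k + 1) * u q c1 1 * u q e (2 * k + r + s + 3) * u q b (2 * k + 2 * r + 1) * q ^ k) *
        T0 q b e c1 c2 c3 k r (s + 1) := by
  have e0 := RB0 hK hL g
  have e1 := RB1 hK hL g
  have e3 : pp q (q * c1) s = (1) / (u q c1 1) * pp q c1 (s + 1) := by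
    have m0 := g.h1 1 (by omega) (by omega)
    simp only [pp_shift q c1 _ m0]
    simp only [pp_succ]
    field_simp
  have e4 : BE q (q * (q * e)) k r s = (u q e (2 * k + 2 * r + s + 3)) / (u q e (2 * k + r + s + 3)) * BE q e k r (s + 1) := by
    have m0 := g.he.pp (k := 2 * k + r + s) (by omega)
    have m1 := g.he 1 (by omega) (by omega)
    have m2 := g.he 2 (by omega) (by omega)
    have m3 := g.he (2 * k + r + s + 1) (by omega) (by omega)
    have m4 := g.he (2 * k + r + s + 2) (by omega) (by omega)
    have m5 := g.he (2 * k + r + s + 3) (by omega) (by omega)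
    have mm : u q (q * e) 1 ≠ 0 := by rw [u_shift]; exact m2
    simp only [BE,
      show 2 * k + 2 * r + (s + 1) + 1 = 2 * k + 2 * r + s + 2 from by ring,
      show 2 * k + r + (s + 1) + 1 = 2 * k + r + s + 2 from by ring]
    simp only [pp_shift q (q * e) _ mm, pp_shift q e _ m1]
    simp only [pp_succ]
    field_simp
  have e5 := RB2 hK hL g
  have eq := RB3 hK hL g
  rw [T0, T0, e0, e1, e3, e4, e5, eq]
  ring

lemma R_ABp2 (q c1 c2 c3 b e : ℂ) (k r s K L : ℕ) (hK : k + r + s + 1 ≤ K)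
    (hL : 2 * k + 2 * r + s + 5 ≤ L) (g : Gen q c1 c2 c3 b e K L) :
    T0 q (q * b) (q * (q * e)) (q * c1) (q * c2) c3 k r s
      = (u q 1 (r + 1) * u q c3 (k + r + 1) * u q c1 (s + 1) * u q b (2 * k + 2 * r + 2) * u q b (2 * k + 2 * r + s + 3)) /
        (u q 1 (r + s + 1) * u q c2 (k + 1) * u q c1 1 * u q e (2 * k + r + s + 3) * u q b (2 * k + 2 * r + 3)) *
        T0 q b e c1 c2 c3 k (r + 1) s := by
  have e0 := RB4 hK hL g
  have e1 := RB5 hK hL g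
  have e2 := RB6 hK hL g
  have e3 : pp q (q * c1) s = (u q c1 (s + 1)) / (u q c1 1) * pp q c1 s := by
    have m0 := g.h1 1 (by omega) (by omega)
    simp only [pp_shift q c1 _ m0]
    simp only [pp_succ]
    field_simp
  have e4 : BE q (q * (q * e)) k r s = (1) / (u q e (2 * k + r + s + 3)) * BE q e k (r + 1) s := by
    have m0 := g.he.pp (k := 2 * k + r + s) (by omega)
    have m1 := g.he 1 (by omega) (by omega)
    have m2 := g.he 2 (by omega) (by omega)
    have m3 := g.he (2 * k + r + s + 1) (by omega) (by omega)
    have m4 := g.he (2 * k + r + s + 2) (by omega) (by omega)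
    have m5 := g.he (2 * k + r + s + 3) (by omega) (by omega)
    have mm : u q (q * e) 1 ≠ 0 := by rw [u_shift]; exact m2
    simp only [BE,
      show 2 * k + 2 * (r + 1) + s + 1 = 2 * k + 2 * r + s + 3 from by ring,
      show 2 * k + (r + 1) + s + 1 = 2 * k + r + s + 2 from by ring]
    simp only [pp_shift q (q * e) _ mm, pp_shift q e _ m1]
    simp only [pp_succ]
    field_simp
  have e5 := RB7 hK hL g
  rw [T0, T0, e0, e1, e2, e3, e4, e5]
  ring

lemma R_CDp1 (q c1 c2 c3 b e : ℂ) (k r s K L : ℕ) (hK : k + r + s + 1 ≤ K)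
    (hL : 2 * k + 2 * r + s + 5 ≤ L) (g : Gen q c1 c2 c3 b e K L) :
    T0 q (q * b) (q * e) c1 c2 (q * c3) k r s
      = (u q 1 (s + 1) * u q c3 1 * u q b (2 * k + 2 * r + 2) * u q b (2 * k + r + 1)) /
        (u q 1 (r + s + 1) * u q c3 (k + r + 1) * u q c1 (s + 1) * u q b (2 * k + 2 * r + 1) * q ^ k) *
        T0 q b e c1 c2 c3 k r (s + 1) := by
  have e0 := RB0 hK hL g
  have e2 := RB8 hK hL g
  have e3 := RB9 hK hL g
  have e4 := RB10 hK hL g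
  have e5 := RB2 hK hL g
  have eq := RB3 hK hL g
  rw [T0, T0, e0, e2, e3, e4, e5, eq]
  ring

lemma R_CDp2 (q c1 c2 c3 b e : ℂ) (k r s K L : ℕ) (hK : k + r + s + 1 ≤ K)
    (hL : 2 * k + 2 * r + s + 5 ≤ L) (g : Gen q c1 c2 c3 b e K L) :
    T0 q (q * b) (q * e) c1 c2 (q * c3) k r s
      = (u q 1 (r + 1) * u q c3 1 * u q b (2 * k + 2 * r + 2) * u q b (2 * k + 2 * r + s + 3)) /
        (u q 1 (r + s + 1) * u q c2 (k + r + 1) * u q e (2 * k + 2 * r + s + 3) * u q b (2 * k + 2 * r + 3)) *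
        T0 q b e c1 c2 c3 k (r + 1) s := by
  have e0 := RB4 hK hL g
  have e1 := RB11 hK hL g
  have e2 := RB12 hK hL g
  have e4 := RB13 hK hL g
  have e5 := RB7 hK hL g
  rw [T0, T0, e0, e1, e2, e4, e5]
  ring

lemma R_CDm1 (q c1 c2 c3 b e : ℂ) (k r s K L : ℕ) (hK : k + r + s + 1 ≤ K)
    (hL : 2 * k + 2 * r + s + 5 ≤ L) (g : Gen q c1 c2 c3 b e K L) :
    T0 q (q * b) (q * e) c1 c2 (q * c3) k r s
      = (u q c3 1 * u q e (2 * k + 2 * r + s + 2) * u q b (2 * k + 2 * r + 2) * u q b (2 * k + r + 1)) /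
        (u q c3 (k + r + 1) * u q e (2 * k + r + s + 2) * u q b (2 * k + 2 * r + s + 2) * u q b (2 * k + 2 * r + 1)) *
        T0 q b e c1 c2 c3 k r s := by
  have e2 := RB8 hK hL g
  have e4 := RB14 hK hL g
  have e5 := RB15 hK hL g
  rw [T0, T0, e2, e4, e5]
  ring

lemma R_CDm2 (q c1 c2 c3 b e : ℂ) (k r s K L : ℕ) (hK : k + r + s + 1 ≤ K)
    (hL : 2 * k + 2 * r + s + 5 ≤ L) (g : Gen q c1 c2 c3 b e K L) :
    T0 q (q * b) (q * e) c1 c2 (q * c3) k r (s + 1)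
      = (u q 1 (r + 1) * u q c3 1 * u q c1 (s + 1) * u q b (2 * k + 2 * r + 2) * q ^ k) /
        (u q 1 (s + 1) * u q c2 (k + r + 1) * u q e (2 * k + r + s + 3) * u q b (2 * k + 2 * r + 3)) *
        T0 q b e c1 c2 c3 k (r + 1) s := by
  have e0 := RB16 hK hL g
  have e1 := RB11 hK hL g
  have e2 := RB12 hK hL g
  have e3 := RB17 hK hL g
  have e4 := RB18 hK hL g
  have e5 := RB19 hK hL g
  have eq : q ^ ((s + 1 + 1) * k) = q ^ k * q ^ ((s + 1) * k) := by ring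
  rw [T0, T0, e0, e1, e2, e3, e4, e5, eq]
  ring

lemma R_BDp1 (q c1 c2 c3 b e : ℂ) (k r s K L : ℕ) (hK : k + r + s + 1 ≤ K)
    (hL : 2 * k + 2 * r + s + 5 ≤ L) (g : Gen q c1 c2 c3 b e K L) :
    T0 q (q * b) (q * e) c1 (q * c2) c3 k r s
      = (u q 1 (s + 1) * u q c2 (k + r + 1) * u q b (2 * k + 2 * r + 2) * u q b (2 * k + r + 1)) /
        (u q 1 (r + s + 1) * u q c2 (k + 1) * u q c1 (s + 1) * u q b (2 * k + 2 * r + 1) * q ^ k) *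
        T0 q b e c1 c2 c3 k r (s + 1) := by
  have e0 := RB0 hK hL g
  have e1 := RB1 hK hL g
  have e3 := RB9 hK hL g
  have e4 := RB10 hK hL g
  have e5 := RB2 hK hL g
  have eq := RB3 hK hL g
  rw [T0, T0, e0, e1, e3, e4, e5, eq]
  ring

lemma R_BDp2 (q c1 c2 c3 b e : ℂ) (k r s K L : ℕ) (hK : k + r + s + 1 ≤ K)
    (hL : 2 * k + 2 * r + s + 5 ≤ L) (g : Gen q c1 c2 c3 b e K L) :
    T0 q (q * b) (q * e) c1 (q * c2) c3 k r s
      = (u q 1 (r + 1) * u q c3 (k + r + 1) * u q b (2 * k + 2 * r + 2) * u q b (2 * k + 2 * r + s + 3)) /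
        (u q 1 (r + s + 1) * u q c2 (k + 1) * u q e (2 * k + 2 * r + s + 3) * u q b (2 * k + 2 * r + 3)) *
        T0 q b e c1 c2 c3 k (r + 1) s := by
  have e0 := RB4 hK hL g
  have e1 := RB5 hK hL g
  have e2 := RB6 hK hL g
  have e4 := RB13 hK hL g
  have e5 := RB7 hK hL g
  rw [T0, T0, e0, e1, e2, e4, e5]
  ring

lemma R_BDm1 (q c1 c2 c3 b e : ℂ) (k r s K L : ℕ) (hK : k + r + s + 1 ≤ K)
    (hL : 2 * k + 2 * r + s + 5 ≤ L) (g : Gen q c1 c2 c3 b e K L) :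
    T0 q (q * b) (q * e) c1 (q * c2) c3 k r s
      = (u q c2 (k + r + 1) * u q e (2 * k + 2 * r + s + 2) * u q b (2 * k + 2 * r + 2) * u q b (2 * k + r + 1)) /
        (u q c2 (k + 1) * u q e (2 * k + r + s + 2) * u q b (2 * k + 2 * r + s + 2) * u q b (2 * k + 2 * r + 1)) *
        T0 q b e c1 c2 c3 k r s := by
  have e1 := RB1 hK hL g
  have e4 := RB14 hK hL g
  have e5 := RB15 hK hL g
  rw [T0, T0, e1, e4, e5]
  ring

lemma R_BDm2 (q c1 c2 c3 b e : ℂ) (k r s K L : ℕ) (hK : k + r + s + 1 ≤ K)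
    (hL : 2 * k + 2 * r + s + 5 ≤ L) (g : Gen q c1 c2 c3 b e K L) :
    T0 q (q * b) (q * e) c1 (q * c2) c3 k r (s + 1)
      = (u q 1 (r + 1) * u q c3 (k + r + 1) * u q c1 (s + 1) * u q b (2 * k + 2 * r + 2) * q ^ k) /
        (u q 1 (s + 1) * u q c2 (k + 1) * u q e (2 * k + r + s + 3) * u q b (2 * k + 2 * r + 3)) *
        T0 q b e c1 c2 c3 k (r + 1) s := by
  have e0 := RB16 hK hL g
  have e1 := RB5 hK hL g
  have e2 := RB6 hK hL g
  have e3 := RB17 hK hL g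
  have e4 := RB18 hK hL g
  have e5 := RB19 hK hL g
  have eq : q ^ ((s + 1 + 1) * k) = q ^ k * q ^ ((s + 1) * k) := by ring
  rw [T0, T0, e0, e1, e2, e3, e4, e5, eq]
  ring

lemma R_K (q c1 c2 c3 b e : ℂ) (k r s K L : ℕ) (hK : k + r + s + 1 ≤ K)
    (hL : 2 * k + 2 * r + s + 5 ≤ L) (g : Gen q c1 c2 c3 b e K L) :
    T0 q b e c1 c2 c3 (k + 1) r s
      = (u q 1 (r + 1) * u q b (2 * k + r + 2) * q ^ (s + 1)) /
        (u q 1 (k + 1) * u q 1 (r + s + 1) * u q c2 (k + 1) * u q e (2 * k + r + s + 3)) *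
        T0 q b e c1 c2 c3 k (r + 1) s := by
  have e0 : B1 q (k + 1) r s = (u q 1 (r + 1)) / (u q 1 (k + 1) * u q 1 (r + s + 1)) * B1 q k (r + 1) s := by
    have m0 := g.h0.pp (k := s) (by omega)
    have m1 := g.h0.pp (k := r) (by omega)
    have m2 := g.h0.pp (k := k) (by omega)
    have m3 := g.h0 (r + 1) (by omega) (by omega)
    have m4 := g.h0 (r + s + 1) (by omega) (by omega)
    have m5 := g.h0 (k + 1) (by omega) (by omega)
    simp only [B1,
      show (r + 1) + s = r + s + 1 from by ring]
    simp only [pp_succ]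
    field_simp
  have e1 : B2 q c2 (k + 1) r = (1) / (u q c2 (k + 1)) * B2 q c2 k (r + 1) := by
    have m0 := g.h2.pp (k := k) (by omega)
    have m1 := g.h2 (k + 1) (by omega) (by omega)
    simp only [B2,
      show k + (r + 1) = k + r + 1 from by ring,
      show (k + 1) + r = k + r + 1 from by ring]
    simp only [pp_succ]
    field_simp
  have e2 : B3 q c3 (k + 1) r = (1) / (1) * B3 q c3 k (r + 1) := by
    have m0 := g.h3.pp (k := k + r) (by omega)
    have m1 := g.h3 (k + r + 1) (by omega) (by omega)
    simp only [B3,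
      show k + (r + 1) = k + r + 1 from by ring,
      show (k + 1) + r = k + r + 1 from by ring]
    simp only [pp_succ]
    field_simp
  have e4 : BE q e (k + 1) r s = (1) / (u q e (2 * k + r + s + 3)) * BE q e k (r + 1) s := by
    have m0 := g.he.pp (k := 2 * k + r + s) (by omega)
    have m1 := g.he (2 * k + r + s + 1) (by omega) (by omega)
    have m2 := g.he (2 * k + r + s + 2) (by omega) (by omega)
    have m3 := g.he (2 * k + r + s + 3) (by omega) (by omega)
    simp only [BE,
      show 2 * k + 2 * (r + 1) + s + 1 = 2 * k + 2 * r + s + 3 from by ring,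
      show 2 * k + (r + 1) + s + 1 = 2 * k + r + s + 2 from by ring,
      show 2 * (k + 1) + 2 * r + s + 1 = 2 * k + 2 * r + s + 3 from by ring,
      show 2 * (k + 1) + r + s + 1 = 2 * k + r + s + 3 from by ring]
    simp only [pp_succ]
    field_simp
  have e5 : BB q b (k + 1) r s = (u q b (2 * k + r + 2)) / (1) * BB q b k (r + 1) s := by
    have m0 := g.hb.pp (k := 2 * k + 2 * r + s) (by omega)
    have m1 := g.hb (2 * k + 2 * r + s + 1) (by omega) (by omega)
    have m2 := g.hb (2 * k + 2 * r + s + 2) (by omega) (by omega)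
    have m3 := g.hb (2 * k + 2 * r + s + 3) (by omega) (by omega)
    simp only [BB,
      show 2 * k + 2 * (r + 1) + 1 = 2 * k + 2 * r + 3 from by ring,
      show 2 * k + 2 * (r + 1) + s + 1 = 2 * k + 2 * r + s + 3 from by ring,
      show 2 * k + (r + 1) = 2 * k + r + 1 from by ring,
      show 2 * (k + 1) + 2 * r + 1 = 2 * k + 2 * r + 3 from by ring,
      show 2 * (k + 1) + 2 * r + s + 1 = 2 * k + 2 * r + s + 3 from by ring,
      show 2 * (k + 1) + r = 2 * k + r + 2 from by ring]
    simp only [pp_succ]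
    field_simp
  have eq : q ^ ((s + 1) * (k + 1)) = q ^ (s + 1) * q ^ ((s + 1) * k) := by ring
  rw [T0, T0, e0, e1, e2, e4, e5, eq]
  ring



lemma T_eqAB (q c1 c2 c3 : ℂ) (k r s n M : ℕ) (hn : n = k + r) (hM : M = k + r + s) :
    T q (q * c1) (q * c2) c3 M n k
      = T0 q (q * (c2 * c3)) (q * (q * (c1 * c2 * c3))) (q * c1) (q * c2) c3 k r s := by
  rw [T_eq q _ _ _ k r s n M hn hM]
  congr 1 <;> ring

lemma T_eqCD (q c1 c2 c3 : ℂ) (k r s n M : ℕ) (hn : n = k + r) (hM : M = k + r + s) :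
    T q c1 c2 (q * c3) M n k
      = T0 q (q * (c2 * c3)) (q * (c1 * c2 * c3)) c1 c2 (q * c3) k r s := by
  rw [T_eq q _ _ _ k r s n M hn hM]
  congr 1 <;> ring

lemma T_eqBD (q c1 c2 c3 : ℂ) (k r s n M : ℕ) (hn : n = k + r) (hM : M = k + r + s) :
    T q c1 (q * c2) c3 M n k
      = T0 q (q * (c2 * c3)) (q * (c1 * c2 * c3)) c1 (q * c2) c3 k r s := by
  rw [T_eq q _ _ _ k r s n M hn hM]
  congr 1 <;> ring

lemma dn_self (k r : ℕ) (hr : r = 0) (F : ℕ → ℂ) (h : ∀ n, n < k → F n = 0) : dn (k + r) F = 0 := by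
  subst hr
  rcases k with _ | k
  · exact dn_zero _
  · rw [add_zero, dn_succ]; exact h k (by omega)

lemma dn_add (k r : ℕ) (F : ℕ → ℂ) : dn (k + (r + 1)) F = F (k + r) := dn_succ _ _

abbrev Gn (q c1 c2 c3 : ℂ) (K L : ℕ) : Prop := Gen q c1 c2 c3 (c2 * c3) (c1 * c2 * c3) K L

lemma T_K (q c1 c2 c3 : ℂ) (k r s K L M : ℕ) (hM : M = k + r + s) (hK : M ≤ K)
    (hL : 2 * M + 4 ≤ L) (g : Gn q c1 c2 c3 K L) :
    T q c1 c2 c3 M (k + r) (k + 1) = (u q 1 r * u q (c2 * c3) (2 * k + r + 1) * q ^ (s + 1)) /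
        (u q 1 (k + 1) * u q 1 (r + s) * u q c2 (k + 1) * u q (c1 * c2 * c3) (2 * k + r + s + 2)) *
        T0 q (c2 * c3) (c1 * c2 * c3) c1 c2 c3 k r s := by
  rcases r with _ | r
  · rw [T_zero _ _ _ _ _ _ _ (by omega), u10]; ring
  · rw [T_eq q c1 c2 c3 (k + 1) r s _ _ (by omega) (by omega),
      R_K q c1 c2 c3 (c2 * c3) (c1 * c2 * c3) k r s K L (by omega) (by omega) g]
    rw [show 2 * k + (r + 1) + 1 = 2 * k + r + 2 by omega, show r + 1 + s = r + s + 1 by omega,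
      show 2 * k + (r + 1) + s + 2 = 2 * k + r + s + 3 by omega]

lemma TAB (q c1 c2 c3 : ℂ) (M n k K L : ℕ) (hk : k ≤ M) (hn : n ≤ M + 1) (hK : M + 1 ≤ K) (hL : 2 * M + 6 ≤ L)
    (g : Gn q c1 c2 c3 K L) :
    (q ^ k)⁻¹ * T q c1 c2 c3 (M + 1) n k
      + (-((q ^ (k + 1))⁻¹ * u q 1 (k + 1) * u q (c1 * c2) (k + 2))) * T q c1 c2 c3 (M + 1) n (k + 1)
    = (u q c1 1) * (T q (q * c1) (q * c2) c3 M n k / u q (c2 * c3) (2 * n + 2))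
      + (- (u q c1 1 * (c2 * q))) * (dn n (fun n => T q (q * c1) (q * c2) c3 M n k) / u q (c2 * c3) (2 * n)) := by
  by_cases hkn : n < k
  · have hd : dn n (fun n => T q (q * c1) (q * c2) c3 M n k) = 0 := by
      rcases n with _ | n
      · exact dn_zero _
      · rw [dn_succ, T_zero _ _ _ _ _ _ _ (by omega)]
    rw [hd, T_zero _ _ _ _ _ _ _ (Or.inl hkn), T_zero _ _ _ _ _ _ _ (show n < k + 1 ∨ _ from Or.inl (by omega)), T_zero _ _ _ _ _ _ _ (Or.inl hkn)]
    ring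
  obtain ⟨r, rfl⟩ : ∃ r, n = k + r := ⟨n - k, by omega⟩
  obtain ⟨s, hs⟩ : ∃ s, M + 1 = k + r + s := ⟨M + 1 - k - r, by omega⟩
  have m7 := g.hb (2 * k + 2 * r + 2) (by omega) (by omega)
  have e1 : T q (q * c1) (q * c2) c3 M (k + r) k / u q (c2 * c3) (2 * (k + r) + 2)
      = (u q 1 (s) * u q c2 (k + r + 1) * u q (c1 * c2 * c3) (2 * k + 2 * r + s + 2) * u q (c2 * c3) (2 * k + r + 1)) /
        (u q 1 (r + s) * u q c2 (k + 1) * u q c1 (1) * u q (c1 * c2 * c3) (2 * k + r + s + 2) * u q (c2 * c3) (2 * k + 2 * r + 1) * q ^ k)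
        * T0 q (c2 * c3) (c1 * c2 * c3) c1 c2 c3 k r s := by
    rcases s with _ | s
    · rw [T_zero _ _ _ _ _ _ _ (by omega), u10]; ring
    · rw [T_eqAB q c1 c2 c3 k r s _ _ (by omega) (by omega),
        R_ABp1 q c1 c2 c3 (c2 * c3) (c1 * c2 * c3) k r s K L (by omega) (by omega) g]
      rw [show 2 * (k + r) + 2 = 2 * k + 2 * r + 2 by ring]
      field_simp
      try ring_nf
  have e2 : dn (k + r) (fun n => T q (q * c1) (q * c2) c3 M n k) / u q (c2 * c3) (2 * (k + r))
      = (u q 1 (r) * u q c3 (k + r) * u q c1 (s + 1) * u q (c2 * c3) (2 * k + 2 * r + s + 1)) /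
        (u q 1 (r + s) * u q c2 (k + 1) * u q c1 (1) * u q (c1 * c2 * c3) (2 * k + r + s + 2) * u q (c2 * c3) (2 * k + 2 * r + 1))
        * T0 q (c2 * c3) (c1 * c2 * c3) c1 c2 c3 k r s := by
    rcases r with _ | r
    · rw [dn_self k 0 rfl _ (fun n hn => T_zero _ _ _ _ _ _ _ (by omega)), u10]; ring
    · rw [dn_add]
      have m7 := g.hb (2 * k + 2 * r + 2) (by omega) (by omega)
      rw [T_eqAB q c1 c2 c3 k r s _ _ (by omega) (by omega),
        R_ABp2 q c1 c2 c3 (c2 * c3) (c1 * c2 * c3) k r s K L (by omega) (by omega) g]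
      rw [show 2 * (k + (r + 1)) = 2 * k + 2 * r + 2 by ring]
      skip
      field_simp
      try ring_nf
  have q0 := g.hq
  have m0a := g.h0 (r + s) (by omega) (by omega)
  have m1a := g.h0 (k + 1) (by omega) (by omega)
  have m2a := g.h2 (k + 1) (by omega) (by omega)
  have m3a := g.h1 (1) (by omega) (by omega)
  have m4a := g.he (2 * k + r + s + 2) (by omega) (by omega)
  have m5a := g.hb (2 * k + 2 * r + 1) (by omega) (by omega)
  rw [T_K q c1 c2 c3 k r s K L _ hs (by omega) (by omega) g,
    T_eq q c1 c2 c3 k r s _ _ rfl hs]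
  generalize T0 q (c2 * c3) (c1 * c2 * c3) c1 c2 c3 k r s = t at e1 e2 ⊢
  generalize T q (q * c1) (q * c2) c3 M (k + r) k / u q (c2 * c3) (2 * (k + r) + 2) = w1 at e1 ⊢
  generalize dn (k + r) (fun n => T q (q * c1) (q * c2) c3 M n k) / u q (c2 * c3) (2 * (k + r)) = w2 at e2 ⊢
  have x1 : u q c1 1 = (u q c1 1) * 1 := by
    simp
  have x2 : - (u q c1 1 * (c2 * q)) = (- (u q c1 1 * (c2 * q))) * 1 := by
    simp
  
  rw [e1, e2]
  clear e1 e2 g x1 x2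
  generalize he : c1 * c2 * c3 = e at *
  generalize hb : c2 * c3 = b at *
  field_simp
  simp only [u, ← hb, ← he]
  ring

lemma TCDp (q c1 c2 c3 : ℂ) (M n k K L : ℕ) (hk : k ≤ M) (hn : n ≤ M + 1) (hK : M + 1 ≤ K) (hL : 2 * M + 6 ≤ L)
    (g : Gn q c1 c2 c3 K L) :
    T q c1 c2 c3 (M + 1) n k
    = ((q ^ n - c1 * q ^ (M + 1)) * u q c3 (n + 1) / u q c3 1) * (T q c1 c2 (q * c3) M n k / u q (c2 * c3) (2 * n + 2))
      + (u q c2 n * u q (c1 * c2 * c3) (M + n + 2) / u q c3 1) * (dn n (fun n => T q c1 c2 (q * c3) M n k) / u q (c2 * c3) (2 * n)) := by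
  by_cases hkn : n < k
  · have hd : dn n (fun n => T q c1 c2 (q * c3) M n k) = 0 := by
      rcases n with _ | n
      · exact dn_zero _
      · rw [dn_succ, T_zero _ _ _ _ _ _ _ (by omega)]
    rw [hd, T_zero _ _ _ _ _ _ _ (Or.inl hkn), T_zero _ _ _ _ _ _ _ (Or.inl hkn)]
    ring
  obtain ⟨r, rfl⟩ : ∃ r, n = k + r := ⟨n - k, by omega⟩
  obtain ⟨s, hs⟩ : ∃ s, M + 1 = k + r + s := ⟨M + 1 - k - r, by omega⟩
  have m7 := g.hb (2 * k + 2 * r + 2) (by omega) (by omega)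
  have e1 : u q c1 s * T q c1 c2 (q * c3) M (k + r) k / u q (c2 * c3) (2 * (k + r) + 2)
      = (u q 1 (s) * u q c3 (1) * u q (c2 * c3) (2 * k + r + 1)) /
        (u q 1 (r + s) * u q c3 (k + r + 1) * u q (c2 * c3) (2 * k + 2 * r + 1) * q ^ k)
        * T0 q (c2 * c3) (c1 * c2 * c3) c1 c2 c3 k r s := by
    rcases s with _ | s
    · rw [T_zero _ _ _ _ _ _ _ (by omega), u10]; ring
    · rw [T_eqCD q c1 c2 c3 k r s _ _ (by omega) (by omega),
        R_CDp1 q c1 c2 c3 (c2 * c3) (c1 * c2 * c3) k r s K L (by omega) (by omega) g]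
      have f1 := g.h1 (s + 1) (by omega) (by omega)
      rw [show 2 * (k + r) + 2 = 2 * k + 2 * r + 2 by ring]
      field_simp
      try ring_nf
  have e2 : (u q c2 (k + r) * u q (c1 * c2 * c3) (2 * k + 2 * r + s + 1)) * dn (k + r) (fun n => T q c1 c2 (q * c3) M n k) / u q (c2 * c3) (2 * (k + r))
      = (u q 1 (r) * u q c3 (1) * u q (c2 * c3) (2 * k + 2 * r + s + 1)) /
        (u q 1 (r + s) * u q (c2 * c3) (2 * k + 2 * r + 1))
        * T0 q (c2 * c3) (c1 * c2 * c3) c1 c2 c3 k r s := by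
    rcases r with _ | r
    · rw [dn_self k 0 rfl _ (fun n hn => T_zero _ _ _ _ _ _ _ (by omega)), u10]; ring
    · rw [dn_add]
      have m7 := g.hb (2 * k + 2 * r + 2) (by omega) (by omega)
      rw [T_eqCD q c1 c2 c3 k r s _ _ (by omega) (by omega),
        R_CDp2 q c1 c2 c3 (c2 * c3) (c1 * c2 * c3) k r s K L (by omega) (by omega) g]
      rw [show 2 * (k + (r + 1)) = 2 * k + 2 * r + 2 by ring]
      have f1 := g.h2 (k + r + 1) (by omega) (by omega)
      have f2 := g.he (2 * k + 2 * r + s + 3) (by omega) (by omega)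
      rw [← add_assoc k r 1, show 2 * k + 2 * (r + 1) + s + 1 = 2 * k + 2 * r + s + 3 by ring]
      skip
      field_simp
      try ring_nf
  have q0 := g.hq
  have m0a := g.h0 (r + s) (by omega) (by omega)
  have m1a := g.h3 (1) (by omega) (by omega)
  have m2a := g.h3 (k + r + 1) (by omega) (by omega)
  have m3a := g.hb (2 * k + 2 * r + 1) (by omega) (by omega)
  rw [
    T_eq q c1 c2 c3 k r s _ _ rfl hs]
  generalize T0 q (c2 * c3) (c1 * c2 * c3) c1 c2 c3 k r s = t at e1 e2 ⊢
  rw [mul_div_assoc (u q c1 s)] at e1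
  rw [mul_div_assoc ((u q c2 (k + r) * u q (c1 * c2 * c3) (2 * k + 2 * r + s + 1)))] at e2
  generalize T q c1 c2 (q * c3) M (k + r) k / u q (c2 * c3) (2 * (k + r) + 2) = w1 at e1 ⊢
  generalize dn (k + r) (fun n => T q c1 c2 (q * c3) M n k) / u q (c2 * c3) (2 * (k + r)) = w2 at e2 ⊢
  have x1 : (q ^ (k + r) - c1 * q ^ (M + 1)) * u q c3 (k + r + 1) / u q c3 1 = (q ^ (k + r) * u q c3 (k + r + 1) / u q c3 1) * (u q c1 s *  1) := by
    rw [hs]; simp only [u]; ring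
  have x2 : u q c2 (k + r) * u q (c1 * c2 * c3) (M + (k + r) + 2) / u q c3 1 = (1 / u q c3 1) * ((u q c2 (k + r) * u q (c1 * c2 * c3) (2 * k + 2 * r + s + 1)) *  1) := by
    rw [show M + (k + r) + 2 = 2 * k + 2 * r + s + 1 by omega]; ring
  rw [mul_one] at x1 x2
  rw [x1, x2, mul_assoc (q ^ (k + r) * u q c3 (k + r + 1) / u q c3 1), mul_assoc (1 / u q c3 1), e1, e2]
  clear e1 e2 g x1 x2
  generalize he : c1 * c2 * c3 = e at *
  generalize hb : c2 * c3 = b at *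
  field_simp
  simp only [u, ← hb, ← he]
  ring

lemma TCDm (q c1 c2 c3 : ℂ) (M n k K L : ℕ) (hk : k ≤ M) (hn : n ≤ M) (hK : M + 1 ≤ K) (hL : 2 * M + 6 ≤ L)
    (g : Gn q c1 c2 c3 K L) :
    T q c1 c2 c3 M n k
    = (u q (c2 * c3) (n + M + 2) * u q c3 (n + 1) / u q c3 1) * (T q c1 c2 (q * c3) M n k / u q (c2 * c3) (2 * n + 2))
      + (c2 * c3 * q * (q ^ n - q ^ (M + 1)) * u q c2 n / u q c3 1) * (dn n (fun n => T q c1 c2 (q * c3) M n k) / u q (c2 * c3) (2 * n)) := by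
  by_cases hkn : n < k
  · have hd : dn n (fun n => T q c1 c2 (q * c3) M n k) = 0 := by
      rcases n with _ | n
      · exact dn_zero _
      · rw [dn_succ, T_zero _ _ _ _ _ _ _ (by omega)]
    rw [hd, T_zero _ _ _ _ _ _ _ (Or.inl hkn), T_zero _ _ _ _ _ _ _ (Or.inl hkn)]
    ring
  obtain ⟨r, rfl⟩ : ∃ r, n = k + r := ⟨n - k, by omega⟩
  obtain ⟨s, hs⟩ : ∃ s, M = k + r + s := ⟨M - k - r, by omega⟩
  have m7 := g.hb (2 * k + 2 * r + 2) (by omega) (by omega)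
  have e1 : u q (c2 * c3) (2 * k + 2 * r + s + 2) * T q c1 c2 (q * c3) M (k + r) k / u q (c2 * c3) (2 * (k + r) + 2)
      = (u q c3 (1) * u q (c1 * c2 * c3) (2 * k + 2 * r + s + 2) * u q (c2 * c3) (2 * k + r + 1)) /
        (u q c3 (k + r + 1) * u q (c1 * c2 * c3) (2 * k + r + s + 2) * u q (c2 * c3) (2 * k + 2 * r + 1))
        * T0 q (c2 * c3) (c1 * c2 * c3) c1 c2 c3 k r s := by
    rw [T_eqCD q c1 c2 c3 k r s _ _ (by omega) (by omega),
      R_CDm1 q c1 c2 c3 (c2 * c3) (c1 * c2 * c3) k r s K L (by omega) (by omega) g]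
    have f1 := g.hb (2 * k + 2 * r + s + 2) (by omega) (by omega)
    rw [show 2 * (k + r) + 2 = 2 * k + 2 * r + 2 by ring]
    field_simp
    try ring_nf
  have e2 : (u q 1 (s + 1) * u q c2 (k + r)) * dn (k + r) (fun n => T q c1 c2 (q * c3) M n k) / u q (c2 * c3) (2 * (k + r))
      = (u q 1 (r) * u q c3 (1) * u q c1 (s + 1) * q ^ k) /
        (u q (c1 * c2 * c3) (2 * k + r + s + 2) * u q (c2 * c3) (2 * k + 2 * r + 1))
        * T0 q (c2 * c3) (c1 * c2 * c3) c1 c2 c3 k r s := by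
    rcases r with _ | r
    · rw [dn_self k 0 rfl _ (fun n hn => T_zero _ _ _ _ _ _ _ (by omega)), u10]; ring
    · rw [dn_add]
      have m7 := g.hb (2 * k + 2 * r + 2) (by omega) (by omega)
      rw [T_eqCD q c1 c2 c3 k r (s + 1) _ _ (by omega) (by omega),
        R_CDm2 q c1 c2 c3 (c2 * c3) (c1 * c2 * c3) k r s K L (by omega) (by omega) g]
      rw [show 2 * (k + (r + 1)) = 2 * k + 2 * r + 2 by ring]
      have f1 := g.h2 (k + r + 1) (by omega) (by omega)
      have f2 := g.h0 (s + 1) (by omega) (by omega)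
      rw [← add_assoc k r 1]
      skip
      field_simp
      try ring_nf
  have q0 := g.hq
  have m0a := g.h3 (1) (by omega) (by omega)
  have m1a := g.h3 (k + r + 1) (by omega) (by omega)
  have m2a := g.he (2 * k + r + s + 2) (by omega) (by omega)
  have m3a := g.hb (2 * k + 2 * r + 1) (by omega) (by omega)
  rw [
    T_eq q c1 c2 c3 k r s _ _ rfl hs]
  generalize T0 q (c2 * c3) (c1 * c2 * c3) c1 c2 c3 k r s = t at e1 e2 ⊢
  rw [mul_div_assoc (u q (c2 * c3) (2 * k + 2 * r + s + 2))] at e1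
  rw [mul_div_assoc ((u q 1 (s + 1) * u q c2 (k + r)))] at e2
  generalize T q c1 c2 (q * c3) M (k + r) k / u q (c2 * c3) (2 * (k + r) + 2) = w1 at e1 ⊢
  generalize dn (k + r) (fun n => T q c1 c2 (q * c3) M n k) / u q (c2 * c3) (2 * (k + r)) = w2 at e2 ⊢
  have x1 : u q (c2 * c3) (k + r + M + 2) * u q c3 (k + r + 1) / u q c3 1 = (u q c3 (k + r + 1) / u q c3 1) * (u q (c2 * c3) (2 * k + 2 * r + s + 2) *  1) := by
    rw [show k + r + M + 2 = 2 * k + 2 * r + s + 2 by omega]; ring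
  have x2 : c2 * c3 * q * (q ^ (k + r) - q ^ (M + 1)) * u q c2 (k + r) / u q c3 1 = (c2 * c3 * q * q ^ (k + r) / u q c3 1) * ((u q 1 (s + 1) * u q c2 (k + r)) *  1) := by
    rw [hs]; simp only [u]; ring
  rw [mul_one] at x1 x2
  rw [x1, x2, mul_assoc (u q c3 (k + r + 1) / u q c3 1), mul_assoc (c2 * c3 * q * q ^ (k + r) / u q c3 1), e1, e2]
  clear e1 e2 g x1 x2
  generalize he : c1 * c2 * c3 = e at *
  generalize hb : c2 * c3 = b at *
  field_simp
  simp only [u, ← hb, ← he]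
  ring

lemma TBDp (q c1 c2 c3 : ℂ) (M n k K L : ℕ) (hk : k ≤ M) (hn : n ≤ M + 1) (hK : M + 1 ≤ K) (hL : 2 * M + 6 ≤ L)
    (g : Gn q c1 c2 c3 K L) :
    (-(c3 * q ^ (M + 1))) * T q c1 c2 c3 (M + 1) n k
      + (u q 1 (k + 1) * (q⁻¹ * u q (c1 * c2 * c3) (M + k + 3))) * T q c1 c2 c3 (M + 1) n (k + 1)
    = (-(c3 * q ^ (M + 1) * (q ^ n - c1 * q ^ (M + 1)))) * (T q c1 (q * c2) c3 M n k / u q (c2 * c3) (2 * n + 2))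
      + (q ^ (M + 1) / q ^ n * u q (c1 * c2 * c3) (M + n + 2)) * (dn n (fun n => T q c1 (q * c2) c3 M n k) / u q (c2 * c3) (2 * n)) := by
  by_cases hkn : n < k
  · have hd : dn n (fun n => T q c1 (q * c2) c3 M n k) = 0 := by
      rcases n with _ | n
      · exact dn_zero _
      · rw [dn_succ, T_zero _ _ _ _ _ _ _ (by omega)]
    rw [hd, T_zero _ _ _ _ _ _ _ (Or.inl hkn), T_zero _ _ _ _ _ _ _ (show n < k + 1 ∨ _ from Or.inl (by omega)), T_zero _ _ _ _ _ _ _ (Or.inl hkn)]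
    ring
  obtain ⟨r, rfl⟩ : ∃ r, n = k + r := ⟨n - k, by omega⟩
  obtain ⟨s, hs⟩ : ∃ s, M + 1 = k + r + s := ⟨M + 1 - k - r, by omega⟩
  have m7 := g.hb (2 * k + 2 * r + 2) (by omega) (by omega)
  have e1 : u q c1 s * T q c1 (q * c2) c3 M (k + r) k / u q (c2 * c3) (2 * (k + r) + 2)
      = (u q 1 (s) * u q c2 (k + r + 1) * u q (c2 * c3) (2 * k + r + 1)) /
        (u q 1 (r + s) * u q c2 (k + 1) * u q (c2 * c3) (2 * k + 2 * r + 1) * q ^ k)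
        * T0 q (c2 * c3) (c1 * c2 * c3) c1 c2 c3 k r s := by
    rcases s with _ | s
    · rw [T_zero _ _ _ _ _ _ _ (by omega), u10]; ring
    · rw [T_eqBD q c1 c2 c3 k r s _ _ (by omega) (by omega),
        R_BDp1 q c1 c2 c3 (c2 * c3) (c1 * c2 * c3) k r s K L (by omega) (by omega) g]
      have f1 := g.h1 (s + 1) (by omega) (by omega)
      rw [show 2 * (k + r) + 2 = 2 * k + 2 * r + 2 by ring]
      field_simp
      try ring_nf
  have e2 : u q (c1 * c2 * c3) (2 * k + 2 * r + s + 1) * dn (k + r) (fun n => T q c1 (q * c2) c3 M n k) / u q (c2 * c3) (2 * (k + r))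
      = (u q 1 (r) * u q c3 (k + r) * u q (c2 * c3) (2 * k + 2 * r + s + 1)) /
        (u q 1 (r + s) * u q c2 (k + 1) * u q (c2 * c3) (2 * k + 2 * r + 1))
        * T0 q (c2 * c3) (c1 * c2 * c3) c1 c2 c3 k r s := by
    rcases r with _ | r
    · rw [dn_self k 0 rfl _ (fun n hn => T_zero _ _ _ _ _ _ _ (by omega)), u10]; ring
    · rw [dn_add]
      have m7 := g.hb (2 * k + 2 * r + 2) (by omega) (by omega)
      rw [T_eqBD q c1 c2 c3 k r s _ _ (by omega) (by omega),
        R_BDp2 q c1 c2 c3 (c2 * c3) (c1 * c2 * c3) k r s K L (by omega) (by omega) g]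
      rw [show 2 * (k + (r + 1)) = 2 * k + 2 * r + 2 by ring]
      have f2 := g.he (2 * k + 2 * r + s + 3) (by omega) (by omega)
      rw [show 2 * k + 2 * (r + 1) + s + 1 = 2 * k + 2 * r + s + 3 by ring]
      skip
      field_simp
      try ring_nf
  have q0 := g.hq
  have m0a := g.h0 (r + s) (by omega) (by omega)
  have m1a := g.h0 (k + 1) (by omega) (by omega)
  have m2a := g.h2 (k + 1) (by omega) (by omega)
  have m3a := g.hb (2 * k + 2 * r + 1) (by omega) (by omega)
  have m4a := g.he (2 * k + r + s + 2) (by omega) (by omega)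
  rw [T_K q c1 c2 c3 k r s K L _ hs (by omega) (by omega) g,
    T_eq q c1 c2 c3 k r s _ _ rfl hs]
  generalize T0 q (c2 * c3) (c1 * c2 * c3) c1 c2 c3 k r s = t at e1 e2 ⊢
  rw [mul_div_assoc (u q c1 s)] at e1
  rw [mul_div_assoc (u q (c1 * c2 * c3) (2 * k + 2 * r + s + 1))] at e2
  generalize T q c1 (q * c2) c3 M (k + r) k / u q (c2 * c3) (2 * (k + r) + 2) = w1 at e1 ⊢
  generalize dn (k + r) (fun n => T q c1 (q * c2) c3 M n k) / u q (c2 * c3) (2 * (k + r)) = w2 at e2 ⊢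
  have x1 : -(c3 * q ^ (M + 1) * (q ^ (k + r) - c1 * q ^ (M + 1))) = (-(c3 * q ^ (k + r + s) * q ^ (k + r))) * (u q c1 s *  1) := by
    rw [hs]; simp only [u]; ring
  have x2 : q ^ (M + 1) / q ^ (k + r) * u q (c1 * c2 * c3) (M + (k + r) + 2) = (q ^ s) * (u q (c1 * c2 * c3) (2 * k + 2 * r + s + 1) *  1) := by
    rw [show M + (k + r) + 2 = 2 * k + 2 * r + s + 1 by omega, hs]; simp only [pow_add]; field_simp
  rw [mul_one] at x1 x2
  rw [x1, x2, mul_assoc (-(c3 * q ^ (k + r + s) * q ^ (k + r))), mul_assoc (q ^ s), e1, e2]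
  rw [show M + k + 3 = 2 * k + r + s + 2 by omega, hs]
  clear e1 e2 g x1 x2
  generalize he : c1 * c2 * c3 = e at *
  generalize hb : c2 * c3 = b at *
  field_simp
  simp only [u, ← hb, ← he]
  ring

lemma TBDm (q c1 c2 c3 : ℂ) (M n k K L : ℕ) (hk : k ≤ M) (hn : n ≤ M) (hK : M + 1 ≤ K) (hL : 2 * M + 6 ≤ L)
    (g : Gn q c1 c2 c3 K L)
    (n1 : c1 ≠ 0) (n2 : c2 ≠ 0) (n3 : c3 ≠ 0) :
    (-(c1 * c2 * q ^ (M + 2))⁻¹) * T q c1 c2 c3 M n k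
      + (u q 1 (k + 1) * (q⁻¹ * (1 - q ^ k / q ^ M))) * T q c1 c2 c3 M n (k + 1)
    = (c3 / c1 * (q ^ n - (c2 * c3 * q ^ (M + 2))⁻¹)) * (T q c1 (q * c2) c3 M n k / u q (c2 * c3) (2 * n + 2))
      + ((c1 * q ^ (M + 1))⁻¹ * (1 - q ^ (M + 1) / q ^ n)) * (dn n (fun n => T q c1 (q * c2) c3 M n k) / u q (c2 * c3) (2 * n)) := by
  by_cases hkn : n < k
  · have hd : dn n (fun n => T q c1 (q * c2) c3 M n k) = 0 := by
      rcases n with _ | n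
      · exact dn_zero _
      · rw [dn_succ, T_zero _ _ _ _ _ _ _ (by omega)]
    rw [hd, T_zero _ _ _ _ _ _ _ (Or.inl hkn), T_zero _ _ _ _ _ _ _ (show n < k + 1 ∨ _ from Or.inl (by omega)), T_zero _ _ _ _ _ _ _ (Or.inl hkn)]
    ring
  obtain ⟨r, rfl⟩ : ∃ r, n = k + r := ⟨n - k, by omega⟩
  obtain ⟨s, hs⟩ : ∃ s, M = k + r + s := ⟨M - k - r, by omega⟩
  have m7 := g.hb (2 * k + 2 * r + 2) (by omega) (by omega)
  have e1 : u q (c2 * c3) (2 * k + 2 * r + s + 2) * T q c1 (q * c2) c3 M (k + r) k / u q (c2 * c3) (2 * (k + r) + 2)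
      = (u q c2 (k + r + 1) * u q (c1 * c2 * c3) (2 * k + 2 * r + s + 2) * u q (c2 * c3) (2 * k + r + 1)) /
        (u q c2 (k + 1) * u q (c1 * c2 * c3) (2 * k + r + s + 2) * u q (c2 * c3) (2 * k + 2 * r + 1))
        * T0 q (c2 * c3) (c1 * c2 * c3) c1 c2 c3 k r s := by
    rw [T_eqBD q c1 c2 c3 k r s _ _ (by omega) (by omega),
      R_BDm1 q c1 c2 c3 (c2 * c3) (c1 * c2 * c3) k r s K L (by omega) (by omega) g]
    have f1 := g.hb (2 * k + 2 * r + s + 2) (by omega) (by omega)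
    rw [show 2 * (k + r) + 2 = 2 * k + 2 * r + 2 by ring]
    field_simp
    try ring_nf
  have e2 : u q 1 (s + 1) * dn (k + r) (fun n => T q c1 (q * c2) c3 M n k) / u q (c2 * c3) (2 * (k + r))
      = (u q 1 (r) * u q c3 (k + r) * u q c1 (s + 1) * q ^ k) /
        (u q c2 (k + 1) * u q (c1 * c2 * c3) (2 * k + r + s + 2) * u q (c2 * c3) (2 * k + 2 * r + 1))
        * T0 q (c2 * c3) (c1 * c2 * c3) c1 c2 c3 k r s := by
    rcases r with _ | r
    · rw [dn_self k 0 rfl _ (fun n hn => T_zero _ _ _ _ _ _ _ (by omega)), u10]; ring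
    · rw [dn_add]
      have m7 := g.hb (2 * k + 2 * r + 2) (by omega) (by omega)
      rw [T_eqBD q c1 c2 c3 k r (s + 1) _ _ (by omega) (by omega),
        R_BDm2 q c1 c2 c3 (c2 * c3) (c1 * c2 * c3) k r s K L (by omega) (by omega) g]
      rw [show 2 * (k + (r + 1)) = 2 * k + 2 * r + 2 by ring]
      have f2 := g.h0 (s + 1) (by omega) (by omega)
      skip
      field_simp
      try ring_nf
  have n0 := g.h0
  have q0 := g.hq
  have m0a := g.h0 (k + 1) (by omega) (by omega)
  have m1a := g.h2 (k + 1) (by omega) (by omega)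
  have m2a := g.he (2 * k + r + s + 2) (by omega) (by omega)
  have m3a := g.hb (2 * k + 2 * r + 1) (by omega) (by omega)
  rw [T_K q c1 c2 c3 k r s K L _ hs (by omega) (by omega) g,
    T_eq q c1 c2 c3 k r s _ _ rfl hs]
  generalize T0 q (c2 * c3) (c1 * c2 * c3) c1 c2 c3 k r s = t at e1 e2 ⊢
  rw [mul_div_assoc (u q (c2 * c3) (2 * k + 2 * r + s + 2))] at e1
  rw [mul_div_assoc (u q 1 (s + 1))] at e2
  generalize T q c1 (q * c2) c3 M (k + r) k / u q (c2 * c3) (2 * (k + r) + 2) = w1 at e1 ⊢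
  generalize dn (k + r) (fun n => T q c1 (q * c2) c3 M n k) / u q (c2 * c3) (2 * (k + r)) = w2 at e2 ⊢
  have x1 : c3 / c1 * (q ^ (k + r) - (c2 * c3 * q ^ (M + 2))⁻¹) = (-(c1 * c2 * q ^ (k + r + s + 2))⁻¹) * (u q (c2 * c3) (2 * k + 2 * r + s + 2) *  1) := by
    rw [hs]; simp only [u]; field_simp; ring
  have x2 : (c1 * q ^ (M + 1))⁻¹ * (1 - q ^ (M + 1) / q ^ (k + r)) = ((c1 * q ^ (k + r + s + 1))⁻¹) * (u q 1 (s + 1) *  1) := by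
    rw [hs]; simp only [u]; field_simp; ring
  rw [mul_one] at x1 x2
  rw [x1, x2, mul_assoc (-(c1 * c2 * q ^ (k + r + s + 2))⁻¹), mul_assoc ((c1 * q ^ (k + r + s + 1))⁻¹), e1, e2]
  clear e1 e2 g x1 x2
  have tk : (1 - q ^ k / q ^ M) * (u q 1 r * u q (c2 * c3) (2 * k + r + 1) * q ^ (s + 1) /
        (u q 1 (k + 1) * u q 1 (r + s) * u q c2 (k + 1) * u q (c1 * c2 * c3) (2 * k + r + s + 2)))
      = -(1 / q ^ (r + s)) * (u q 1 r * u q (c2 * c3) (2 * k + r + 1) * q ^ (s + 1) /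
        (u q 1 (k + 1) * u q c2 (k + 1) * u q (c1 * c2 * c3) (2 * k + r + s + 2))) := by
    rcases r with _ | r
    · rw [u10]; ring
    · have := n0 (r + 1 + s) (by omega) (by omega)
      have e : 1 - q ^ k / q ^ M = -(1 / q ^ (r + 1 + s)) * u q 1 (r + 1 + s) := by
        rw [hs]; simp only [u, pow_add]; field_simp; ring
      rw [e]
      field_simp
  rw [mul_assoc (u q 1 (k + 1)), mul_assoc q⁻¹, ← mul_assoc (1 - q ^ k / q ^ M), tk, hs]
  generalize he : c1 * c2 * c3 = e at *
  generalize hb : c2 * c3 = b at *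
  field_simp
  simp only [u, ← hb, ← he]
  ring


lemma P_eq' (q c1 c2 c3 : ℂ) (M n x K : ℕ) (hx : x ≤ M) (hK : M < K) :
    P q c1 c2 c3 M n x = ∑ k ∈ Finset.range K, T q c1 c2 c3 M n k * phi q (c1 * c2) x k := by
  by_cases hn : n < K
  · exact P_eq q c1 c2 c3 M n x K hx hn
  · rw [P_zero _ _ _ _ _ _ _ (by omega)]
    symm
    apply Finset.sum_eq_zero
    intro k _
    rw [T_zero _ _ _ _ _ _ _ (by omega)]; simp

lemma dn_congr (n : ℕ) (f g : ℕ → ℂ) (h : ∀ m, m + 1 = n → f m = g m) : dn n f = dn n g := by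
  rcases n with _ | n
  · simp [dn_zero]
  · rw [dn_succ, dn_succ, h n rfl]

lemma dn_eq_zero (n : ℕ) (f : ℕ → ℂ) (h : ∀ m, m + 1 = n → f m = 0) : dn n f = 0 := by
  rcases n with _ | n
  · simp [dn_zero]
  · rw [dn_succ, h n rfl]

lemma sum_dn (X Y U V : ℂ) (T' : ℕ → ℕ → ℂ) (G f : ℕ → ℂ) (K n : ℕ)
    (h : ∀ k, k < K → G k = X * (T' n k / U) + Y * (dn n (fun n => T' n k) / V)) :
    ∑ k ∈ Finset.range K, G k * f k = X * ((∑ k ∈ Finset.range K, T' n k * f k) / U)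
      + Y * (dn n (fun n => ∑ k ∈ Finset.range K, T' n k * f k) / V) := by
  have h2 : dn n (fun n => ∑ k ∈ Finset.range K, T' n k * f k)
      = ∑ k ∈ Finset.range K, dn n (fun n => T' n k) * f k := by
    rcases n with _ | n
    · simp [dn_zero]
    · simp only [dn_succ]
  rw [h2, Finset.sum_div, Finset.sum_div, Finset.mul_sum, Finset.mul_sum, ← Finset.sum_add_distrib]
  apply Finset.sum_congr rfl
  intro k hk
  rw [h k (by simpa using hk)]
  ring

lemma PAB (q c1 c2 c3 : ℂ) (M n x K L : ℕ) (hK : M + 1 ≤ K) (hL : 2 * M + 6 ≤ L)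
    (g : Gn q c1 c2 c3 K L) :
    P q c1 c2 c3 (M + 1) n (x + 1)
    = (u q c1 1) * (P q (q * c1) (q * c2) c3 M n x / u q (c2 * c3) (2 * n + 2))
      + (-(u q c1 1 * (c2 * q))) *
        (dn n (fun n => P q (q * c1) (q * c2) c3 M n x) / u q (c2 * c3) (2 * n)) := by
  have hz : (M + 1 < n ∨ M < x) → P q c1 c2 c3 (M + 1) n (x + 1)
    = (u q c1 1) * (P q (q * c1) (q * c2) c3 M n x / u q (c2 * c3) (2 * n + 2))
      + (-(u q c1 1 * (c2 * q))) *
        (dn n (fun n => P q (q * c1) (q * c2) c3 M n x) / u q (c2 * c3) (2 * n)) := by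
    intro h
    rw [P_zero _ _ _ _ _ _ _ (by omega), P_zero _ _ _ _ _ _ _ (by omega),
      dn_eq_zero _ _ (fun m hm => P_zero _ _ _ _ _ _ _ (by omega))]
    ring
  by_cases hn : M + 1 < n
  · exact hz (Or.inl hn)
  by_cases hx : M < x
  · exact hz (Or.inr hx)
  rw [P_eq' q c1 c2 c3 (M + 1) n (x + 1) (M + 1 + 1) (by omega) (by omega)]
  rw [abel _ (fun k => phi q (q * q * (c1 * c2)) x k) _ (fun k => (q ^ k)⁻¹)
    (fun k => -((q ^ k)⁻¹ * u q 1 k * u q (c1 * c2) (k + 1))) (M + 1) (by simp [phi_zero])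
    (fun k => by rw [phi_AB q _ g.hq]; simp only [u]; ring) (phi_zero_of_lt _ _ g.hq _ _ (by omega))]
  rw [sum_dn _ _ _ _ _ _ _ _ n (fun k hk => TAB q c1 c2 c3 M n k K L (by omega) (by omega) hK hL g)]
  rw [show q * q * (c1 * c2) = q * c1 * (q * c2) by ring]
  rw [P_eq' q (q * c1) (q * c2) c3 M n x (M + 1) (by omega) (by omega)]
  congr 3
  apply dn_congr
  intro m hm
  rw [P_eq' q (q * c1) (q * c2) c3 M m x (M + 1) (by omega) (by omega)]

lemma PCDp (q c1 c2 c3 : ℂ) (M n x K L : ℕ) (hx : x ≤ M) (hK : M + 1 ≤ K) (hL : 2 * M + 6 ≤ L)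
    (g : Gn q c1 c2 c3 K L) :
    P q c1 c2 c3 (M + 1) n x
    = ((q ^ n - c1 * q ^ (M + 1)) * u q c3 (n + 1) / u q c3 1)
        * (P q c1 c2 (q * c3) M n x / u q (c2 * c3) (2 * n + 2))
      + (u q c2 n * u q (c1 * c2 * c3) (M + n + 2) / u q c3 1) *
        (dn n (fun n => P q c1 c2 (q * c3) M n x) / u q (c2 * c3) (2 * n)) := by
  by_cases hn : M + 1 < n
  · rw [P_zero _ _ _ _ _ _ _ (by omega), P_zero _ _ _ _ _ _ _ (by omega),
      dn_eq_zero _ _ (fun m hm => P_zero _ _ _ _ _ _ _ (by omega))]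
    ring
  rw [P_eq' q c1 c2 c3 (M + 1) n x (M + 1 + 1) (by omega) (by omega), Finset.sum_range_succ,
    phi_zero_of_lt _ _ g.hq _ _ (show x < M + 1 by omega), mul_zero, add_zero]
  rw [sum_dn _ _ _ _ _ _ _ _ n (fun k hk => TCDp q c1 c2 c3 M n k K L (by omega) (by omega) hK hL g)]
  rw [P_eq' q c1 c2 (q * c3) M n x (M + 1) (by omega) (by omega)]
  congr 3
  apply dn_congr
  intro m hm
  rw [P_eq' q c1 c2 (q * c3) M m x (M + 1) (by omega) (by omega)]

lemma PCDm (q c1 c2 c3 : ℂ) (M n x K L : ℕ) (hK : M + 1 ≤ K) (hL : 2 * M + 6 ≤ L)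
    (g : Gn q c1 c2 c3 K L) :
    P q c1 c2 c3 M n x
    = (u q (c2 * c3) (n + M + 2) * u q c3 (n + 1) / u q c3 1)
        * (P q c1 c2 (q * c3) M n x / u q (c2 * c3) (2 * n + 2))
      + (c2 * c3 * q * (q ^ n - q ^ (M + 1)) * u q c2 n / u q c3 1) *
        (dn n (fun n => P q c1 c2 (q * c3) M n x) / u q (c2 * c3) (2 * n)) := by
  by_cases hx : M < x
  · rw [P_zero _ _ _ _ _ _ _ (by omega), P_zero _ _ _ _ _ _ _ (by omega),
      dn_eq_zero _ _ (fun m hm => P_zero _ _ _ _ _ _ _ (by omega))]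
    ring
  by_cases hn : M < n
  · rw [P_zero _ _ _ _ _ _ _ (by omega), P_zero _ _ _ _ _ _ _ (by omega)]
    by_cases hn' : n = M + 1
    · subst hn'; ring
    · rw [dn_eq_zero _ _ (fun m hm => P_zero _ _ _ _ _ _ _ (by omega))]
      ring
  rw [P_eq' q c1 c2 c3 M n x (M + 1) (by omega) (by omega)]
  rw [sum_dn _ _ _ _ _ _ _ _ n (fun k hk => TCDm q c1 c2 c3 M n k K L (by omega) (by omega) hK hL g)]
  rw [P_eq' q c1 c2 (q * c3) M n x (M + 1) (by omega) (by omega)]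
  congr 3
  apply dn_congr
  intro m hm
  rw [P_eq' q c1 c2 (q * c3) M m x (M + 1) (by omega) (by omega)]

lemma sum_lin (t f g : ℕ → ℂ) (a b c : ℂ) (s : Finset ℕ) :
    c * (a * ∑ k ∈ s, t k * f k - b * ∑ k ∈ s, t k * g k)
      = ∑ k ∈ s, t k * (c * (a * f k - b * g k)) := by
  rw [Finset.mul_sum, Finset.mul_sum, ← Finset.sum_sub_distrib, Finset.mul_sum]
  apply Finset.sum_congr rfl
  intro k _
  ring

lemma PBDp (q c1 c2 c3 : ℂ) (M n x K L : ℕ) (hx : x ≤ M) (hK : M + 1 ≤ K) (hL : 2 * M + 6 ≤ L)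
    (g : Gn q c1 c2 c3 K L) (hg : u q (c1 * c2) (2 * x + 2) ≠ 0) :
    q ^ x / u q (c1 * c2) (2 * x + 2) * ((1 - c3 * q ^ (M + 1) / q ^ x) * P q c1 c2 c3 (M + 1) n x
      - u q (c1 * c2 * c3) (M + x + 3) * P q c1 c2 c3 (M + 1) n (x + 1))
    = (-(c3 * q ^ (M + 1) * (q ^ n - c1 * q ^ (M + 1))))
        * (P q c1 (q * c2) c3 M n x / u q (c2 * c3) (2 * n + 2))
      + (q ^ (M + 1) / q ^ n * u q (c1 * c2 * c3) (M + n + 2)) *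
        (dn n (fun n => P q c1 (q * c2) c3 M n x) / u q (c2 * c3) (2 * n)) := by
  by_cases hn : M + 1 < n
  · rw [P_zero _ _ _ _ _ _ _ (by omega), P_zero _ _ _ _ _ _ _ (by omega), P_zero _ _ _ _ _ _ _ (by omega),
      dn_eq_zero _ _ (fun m hm => P_zero _ _ _ _ _ _ _ (by omega))]
    ring
  rw [P_eq' q c1 c2 c3 (M + 1) n x (M + 1 + 1) (by omega) (by omega),
    P_eq' q c1 c2 c3 (M + 1) n (x + 1) (M + 1 + 1) (by omega) (by omega), sum_lin]
  rw [abel _ (fun k => phi q (q * (c1 * c2)) x k) _ (fun k => -(c3 * q ^ (M + 1)))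
    (fun k => u q 1 k * (q⁻¹ * u q (c1 * c2 * c3) (M + k + 2))) (M + 1)
    (by
      have := phi_BD0 q (c1 * c2) (c3 * q ^ (M + 1)) g.hq x hg
      rw [← this]; simp only [u]; ring)
    (fun k => by
      have := phi_BD q (c1 * c2) (c3 * q ^ (M + 1)) g.hq x k hg
      have hq := g.hq
      have e : u q 1 (k + 1) * (q⁻¹ * u q (c1 * c2 * c3) (M + (k + 1) + 2))
        = (1 - q ^ (k + 1)) * (q⁻¹ - c1 * c2 * (c3 * q ^ (M + 1)) * q ^ (k + 1)) := by
        simp only [u]; field_simp; ring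
      simp only [e]
      rw [← this]; simp only [u]; ring)
    (phi_zero_of_lt _ _ g.hq _ _ (by omega))]
  rw [Finset.sum_congr rfl (g := fun k => (-(c3 * q ^ (M + 1)) * T q c1 c2 c3 (M + 1) n k +
        u q 1 (k + 1) * (q⁻¹ * u q (c1 * c2 * c3) (M + k + 3)) * T q c1 c2 c3 (M + 1) n (k + 1)) *
      phi q (q * (c1 * c2)) x k) (fun k _ => by
        rw [show M + (k + 1) + 2 = M + k + 3 by ring])]
  rw [sum_dn _ _ _ _ _ _ _ _ n (fun k hk => TBDp q c1 c2 c3 M n k K L (by omega) (by omega) hK hL g)]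
  rw [show q * (c1 * c2) = c1 * (q * c2) by ring]
  rw [P_eq' q c1 (q * c2) c3 M n x (M + 1) (by omega) (by omega)]
  congr 3
  apply dn_congr
  intro m hm
  rw [P_eq' q c1 (q * c2) c3 M m x (M + 1) (by omega) (by omega)]

lemma PBDm (q c1 c2 c3 : ℂ) (M n x K L : ℕ) (hx : x ≤ M) (hK : M + 1 ≤ K) (hL : 2 * M + 6 ≤ L)
    (g : Gn q c1 c2 c3 K L) (hg : u q (c1 * c2) (2 * x + 2) ≠ 0)
    (n1 : c1 ≠ 0) (n2 : c2 ≠ 0) (n3 : c3 ≠ 0) :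
    q ^ x / u q (c1 * c2) (2 * x + 2) * ((1 - (c1 * c2 * q ^ (M + 2))⁻¹ / q ^ x) * P q c1 c2 c3 M n x
      - (1 - q ^ x / q ^ M) * P q c1 c2 c3 M n (x + 1))
    = (c3 / c1 * (q ^ n - (c2 * c3 * q ^ (M + 2))⁻¹))
        * (P q c1 (q * c2) c3 M n x / u q (c2 * c3) (2 * n + 2))
      + ((c1 * q ^ (M + 1))⁻¹ * (1 - q ^ (M + 1) / q ^ n)) *
        (dn n (fun n => P q c1 (q * c2) c3 M n x) / u q (c2 * c3) (2 * n)) := by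
  have hq := g.hq
  by_cases hn : M < n
  · rw [P_zero _ _ _ _ _ _ _ (by omega), P_zero _ _ _ _ _ _ _ (by omega), P_zero _ _ _ _ _ _ _ (by omega)]
    by_cases hn' : n = M + 1
    · subst hn'; rw [div_self (pow_ne_zero _ hq)]; ring
    · rw [dn_eq_zero _ _ (fun m hm => P_zero _ _ _ _ _ _ _ (by omega))]
      ring
  have hxx : (1 - q ^ x / q ^ M) * P q c1 c2 c3 M n (x + 1)
      = (1 - q ^ x / q ^ M) * ∑ k ∈ Finset.range (M + 1 + 1), T q c1 c2 c3 M n k * phi q (c1 * c2) (x + 1) k := by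
    by_cases hx' : x = M
    · subst hx'; rw [div_self (pow_ne_zero _ hq)]; ring
    · rw [P_eq' q c1 c2 c3 M n (x + 1) (M + 1 + 1) (by omega) (by omega)]
  rw [P_eq' q c1 c2 c3 M n x (M + 1 + 1) (by omega) (by omega), hxx, sum_lin]
  have ez : c1 * c2 * (c1 * c2 * q ^ (M + 2))⁻¹ * q ^ (x + 2) = q ^ x / q ^ M := by
    rw [pow_add, pow_add]; field_simp
  rw [abel _ (fun k => phi q (q * (c1 * c2)) x k) _ (fun k => -(c1 * c2 * q ^ (M + 2))⁻¹)
    (fun k => u q 1 k * (q⁻¹ * (1 - q ^ k / q / q ^ M))) (M + 1)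
    (by
      have := phi_BD0 q (c1 * c2) (c1 * c2 * q ^ (M + 2))⁻¹ g.hq x hg
      rw [← this, ez]; simp only [u])
    (fun k => by
      have := phi_BD q (c1 * c2) (c1 * c2 * q ^ (M + 2))⁻¹ g.hq x k hg
      have e : u q 1 (k + 1) * (q⁻¹ * (1 - q ^ (k + 1) / q / q ^ M))
        = (1 - q ^ (k + 1)) * (q⁻¹ - c1 * c2 * (c1 * c2 * q ^ (M + 2))⁻¹ * q ^ (k + 1)) := by
        simp only [u, pow_add]; field_simp
      simp only [e]
      rw [← this, ez]; simp only [u])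
    (phi_zero_of_lt _ _ g.hq _ _ (by omega))]
  rw [Finset.sum_congr rfl (g := fun k => (-(c1 * c2 * q ^ (M + 2))⁻¹ * T q c1 c2 c3 M n k +
        u q 1 (k + 1) * (q⁻¹ * (1 - q ^ k / q ^ M)) * T q c1 c2 c3 M n (k + 1)) *
      phi q (q * (c1 * c2)) x k) (fun k _ => by
        rw [show q ^ (k + 1) / q = q ^ k by rw [pow_succ]; field_simp])]
  rw [sum_dn _ _ _ _ _ _ _ _ n (fun k hk => TBDm q c1 c2 c3 M n k K L (by omega) (by omega) hK hL g n1 n2 n3)]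
  rw [show q * (c1 * c2) = c1 * (q * c2) by ring]
  rw [P_eq' q c1 (q * c2) c3 M n x (M + 1) (by omega) (by omega)]
  congr 3
  apply dn_congr
  intro m hm
  rw [P_eq' q c1 (q * c2) c3 M m x (M + 1) (by omega) (by omega)]


def tq (q : ℂ) (n : ℕ) : ℂ := ∏ l ∈ Finset.range n, (-q ^ (l + 1))

lemma tq_zero (q : ℂ) : tq q 0 = 1 := by simp [tq]
lemma tq_succ (q : ℂ) (n : ℕ) : tq q (n + 1) = tq q n * (-q ^ (n + 1)) := by
  simp [tq, Finset.prod_range_succ]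

def SG (q c0 c1 c2 c3 c4 : ℂ) (N i j x y : ℕ) : ℂ :=
  ∑ a ∈ Finset.range (N + 1), tq q a * (c1 * c3 * q ^ N) ^ a *
    (P q c1 c2 c3 (N - j) i a * P q c3 c0 c4 (N - a) j y) * P q c4 c2 c1 (N - y) a x

structure G5 (q c0 c1 c2 c3 c4 : ℂ) (N : ℕ) : Prop where
  hq : q ≠ 0
  hK : NZ q 1 N
  n0 : c0 ≠ 0
  n1 : c1 ≠ 0
  n2 : c2 ≠ 0
  n3 : c3 ≠ 0
  n4 : c4 ≠ 0
  bal : c0 * c1 * c2 * c3 * c4 * q ^ (2 * N + 3) = 1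
  gen : ∀ e0 e1 e2 e3 e4 : ℕ, (e0 ≤ 1 ∧ e1 ≤ 1 ∧ e2 ≤ 1 ∧ e3 ≤ 1 ∧ e4 ≤ 1 ∧
      1 ≤ e0 + e1 + e2 + e3 + e4 ∧ e0 + e1 + e2 + e3 + e4 ≤ 4) →
      NZ q (c0 ^ e0 * c1 ^ e1 * c2 ^ e2 * c3 ^ e3 * c4 ^ e4) (2 * N + 5)

lemma G5.nz {q c0 c1 c2 c3 c4 : ℂ} {N : ℕ} (g : G5 q c0 c1 c2 c3 c4 N) (e0 e1 e2 e3 e4 : ℕ)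
    (h : e0 ≤ 1 ∧ e1 ≤ 1 ∧ e2 ≤ 1 ∧ e3 ≤ 1 ∧ e4 ≤ 1 ∧
      1 ≤ e0 + e1 + e2 + e3 + e4 ∧ e0 + e1 + e2 + e3 + e4 ≤ 4) (c : ℂ)
    (hc : c = c0 ^ e0 * c1 ^ e1 * c2 ^ e2 * c3 ^ e3 * c4 ^ e4) : NZ q c (2 * N + 5) := by
  rw [hc]; exact g.gen _ _ _ _ _ h

lemma G5.s02 {q c0 c1 c2 c3 c4 : ℂ} {N : ℕ} (g : G5 q c0 c1 c2 c3 c4 N) :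
    G5 q c2 c1 c0 c3 c4 N :=
  ⟨g.hq, g.hK, g.n2, g.n1, g.n0, g.n3, g.n4, by rw [← g.bal]; ring,
    fun e0 e1 e2 e3 e4 h => g.nz e2 e1 e0 e3 e4 (by omega) _ (by ring)⟩

lemma G5.s34 {q c0 c1 c2 c3 c4 : ℂ} {N : ℕ} (g : G5 q c0 c1 c2 c3 c4 N) :
    G5 q c0 c1 c2 c4 c3 N :=
  ⟨g.hq, g.hK, g.n0, g.n1, g.n2, g.n4, g.n3, by rw [← g.bal]; ring,
    fun e0 e1 e2 e3 e4 h => g.nz e0 e1 e2 e4 e3 (by omega) _ (by ring)⟩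

lemma G5.s13 {q c0 c1 c2 c3 c4 : ℂ} {N : ℕ} (g : G5 q c0 c1 c2 c3 c4 N) :
    G5 q c0 c3 c2 c1 c4 N :=
  ⟨g.hq, g.hK, g.n0, g.n3, g.n2, g.n1, g.n4, by rw [← g.bal]; ring,
    fun e0 e1 e2 e3 e4 h => g.nz e0 e3 e2 e1 e4 (by omega) _ (by ring)⟩

lemma G5.s23 {q c0 c1 c2 c3 c4 : ℂ} {N : ℕ} (g : G5 q c0 c1 c2 c3 c4 N) :
    G5 q c0 c1 c3 c2 c4 N :=
  ⟨g.hq, g.hK, g.n0, g.n1, g.n3, g.n2, g.n4, by rw [← g.bal]; ring,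
    fun e0 e1 e2 e3 e4 h => g.nz e0 e1 e3 e2 e4 (by omega) _ (by ring)⟩

lemma G5.gn {q c0 c1 c2 c3 c4 : ℂ} {N : ℕ} (g : G5 q c0 c1 c2 c3 c4 N) :
    Gn q c1 c2 c3 N (2 * N + 5) :=
  ⟨g.hq, g.hK, g.nz 0 1 0 0 0 (by decide) _ (by ring), g.nz 0 0 1 0 0 (by decide) _ (by ring),
    g.nz 0 0 0 1 0 (by decide) _ (by ring), g.nz 0 0 1 1 0 (by decide) _ (by ring),
    g.nz 0 1 1 1 0 (by decide) _ (by ring)⟩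

/-- shift along the line joining 0 and 3 -/
lemma G5.shift {q c0 c1 c2 c3 c4 : ℂ} {N : ℕ} (g : G5 q c0 c1 c2 c3 c4 (N + 1)) :
    G5 q (q * c0) c1 c2 (q * c3) c4 N := by
  refine ⟨g.hq, g.hK.mono (by omega), mul_ne_zero g.hq g.n0, g.n1, g.n2, mul_ne_zero g.hq g.n3, g.n4, ?_, ?_⟩
  · rw [← g.bal]; ring
  · intro e0 e1 e2 e3 e4 h k h1 h2
    have := g.gen e0 e1 e2 e3 e4 h (k + e0 + e3) (by omega) (by omega)
    have e : u q ((q * c0) ^ e0 * c1 ^ e1 * c2 ^ e2 * (q * c3) ^ e3 * c4 ^ e4) k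
        = u q (c0 ^ e0 * c1 ^ e1 * c2 ^ e2 * c3 ^ e3 * c4 ^ e4) (k + e0 + e3) := by
      simp only [u]; ring
    rw [e]; exact this

lemma dn_sum (n : ℕ) (s : Finset ℕ) (f : ℕ → ℕ → ℂ) :
    dn n (fun n => ∑ a ∈ s, f n a) = ∑ a ∈ s, dn n (fun n => f n a) := by
  rcases n with _ | n
  · simp [dn_zero]
  · simp only [dn_succ]

lemma dn_mul (n : ℕ) (c : ℂ) (f : ℕ → ℂ) : dn n (fun n => c * f n) = c * dn n f := by
  rcases n with _ | n
  · simp [dn_zero]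
  · simp only [dn_succ]

lemma sum4 (s : Finset ℕ) (G : ℕ → ℂ) (S : ℕ → ℕ → ℕ → ℂ) (i j : ℕ) (A00 A10 A01 A11 : ℂ)
    (h : ∀ a ∈ s, G a = A00 * S i j a + A10 * dn i (fun i => S i j a)
      + A01 * dn j (fun j => S i j a) + A11 * dn i (fun i => dn j (fun j => S i j a))) :
    ∑ a ∈ s, G a = A00 * ∑ a ∈ s, S i j a + A10 * dn i (fun i => ∑ a ∈ s, S i j a)
      + A01 * dn j (fun j => ∑ a ∈ s, S i j a)
      + A11 * dn i (fun i => dn j (fun j => ∑ a ∈ s, S i j a)) := by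
  simp only [dn_sum, Finset.mul_sum]
  rw [← Finset.sum_add_distrib, ← Finset.sum_add_distrib, ← Finset.sum_add_distrib]
  exact Finset.sum_congr rfl h

lemma SGy (q c0 c1 c2 c3 c4 : ℂ) (N i j x y J : ℕ) (g : G5 q c0 c1 c2 c3 c4 (N + 1))
    (hJ : J + j = N + 1) :
    SG q c0 c1 c2 c3 c4 (N + 1) i j x (y + 1) =
      ((q ^ i - c1 * q ^ J) * u q c3 (i + 1) / (u q (c0 * c4) (2 * j + 2) * u q (c2 * c3) (2 * i + 2)))
        * SG q (q * c0) c1 c2 (q * c3) c4 N i j x y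
      + (u q c2 i * u q (c1 * c2 * c3) (J + i + 1) / (u q (c0 * c4) (2 * j + 2) * u q (c2 * c3) (2 * i)))
        * dn i (fun i => SG q (q * c0) c1 c2 (q * c3) c4 N i j x y)
      + (-(c0 * q * u q (c2 * c3) (i + J + 2) * u q c3 (i + 1)) / (u q (c0 * c4) (2 * j) * u q (c2 * c3) (2 * i + 2)))
        * dn j (fun j => SG q (q * c0) c1 c2 (q * c3) c4 N i j x y)
      + (-(c0 * q * (c2 * c3 * q) * (q ^ i - q ^ (J + 1)) * u q c2 i) / (u q (c0 * c4) (2 * j) * u q (c2 * c3) (2 * i)))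
        * dn i (fun i => dn j (fun j => SG q (q * c0) c1 c2 (q * c3) c4 N i j x y)) := by
  have g1 : Gn q c1 c2 c3 (N + 1) (2 * (N + 1) + 5) := g.gn
  have g2 : Gn q c3 c0 c4 (N + 1) (2 * (N + 1) + 5) := g.s02.s13.s34.gn
  have m1 := g1.h3 1 (by omega) (by omega)
  simp only [SG]
  rw [Finset.sum_range_succ, show N + 1 - (N + 1) = 0 by omega,
    P_zero q c3 c0 c4 0 j (y + 1) (by omega)]
  simp only [mul_zero, zero_mul, add_zero]
  apply sum4 _ _ (fun i j a => tq q a * (c1 * (q * c3) * q ^ N) ^ a *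
    (P q c1 c2 (q * c3) (N - j) i a * P q (q * c3) (q * c0) c4 (N - a) j y) * P q c4 c2 c1 (N - y) a x)
  intro a ha
  have ha' : a ≤ N := by simp at ha; omega
  rw [show N + 1 - (y + 1) = N - y by omega, show N + 1 - a = (N - a) + 1 by omega,
    PAB q c3 c0 c4 (N - a) j y (N + 1) (2 * (N + 1) + 5) (by omega) (by omega) g2,
    show c1 * (q * c3) * q ^ N = c1 * c3 * q ^ (N + 1) by ring]
  generalize tq q a * (c1 * c3 * q ^ (N + 1)) ^ a = w
  generalize P q c4 c2 c1 (N - y) a x = z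
  have h1 : P q c1 c2 c3 (N + 1 - j) i a * P q (q * c3) (q * c0) c4 (N - a) j y
     = (((q ^ i - c1 * q ^ J) * u q c3 (i + 1) / u q c3 1)
        * (P q c1 c2 (q * c3) (N - j) i a / u q (c2 * c3) (2 * i + 2))
      + (u q c2 i * u q (c1 * c2 * c3) (J + i + 1) / u q c3 1) *
        (dn i (fun i => P q c1 c2 (q * c3) (N - j) i a) / u q (c2 * c3) (2 * i))) *
        P q (q * c3) (q * c0) c4 (N - a) j y := by
    by_cases hj : N - a < j
    · rw [P_zero q (q * c3) (q * c0) c4 (N - a) j y (by omega)]; ring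
    · have := PCDp q c1 c2 c3 (N - j) i a (N + 1) (2 * (N + 1) + 5) (by omega) (by omega) (by omega) g1
      rw [show N + 1 - j = N - j + 1 by omega, this, show N - j + 1 = J by omega,
        show N - j + i + 2 = J + i + 1 by omega]
  have h2 : ∀ j', j' + 1 = j → P q c1 c2 c3 (N + 1 - j) i a
     = (u q (c2 * c3) (i + J + 2) * u q c3 (i + 1) / u q c3 1)
        * (P q c1 c2 (q * c3) (N - j') i a / u q (c2 * c3) (2 * i + 2))
      + (c2 * c3 * q * (q ^ i - q ^ (J + 1)) * u q c2 i / u q c3 1) *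
        (dn i (fun i => P q c1 c2 (q * c3) (N - j') i a) / u q (c2 * c3) (2 * i)) := by
    intro j' hj
    have := PCDm q c1 c2 c3 (N - j') i a (N + 1) (2 * (N + 1) + 5) (by omega) (by omega) g1
    rw [show N + 1 - j = N - j' by omega, this, show N - j' = J by omega]
  have e3 : ∀ j, dn i (fun i => w * (P q c1 c2 (q * c3) (N - j) i a * P q (q * c3) (q * c0) c4 (N - a) j y) * z)
      = w * (dn i (fun i => P q c1 c2 (q * c3) (N - j) i a) * P q (q * c3) (q * c0) c4 (N - a) j y) * z := by
    intro j
    rcases i with _ | i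
    · simp [dn_zero]
    · simp [dn_succ]
  rw [mul_add (P q c1 c2 c3 (N + 1 - j) i a)]
  have h1' : P q c1 c2 c3 (N + 1 - j) i a * (u q c3 1 * (P q (q * c3) (q * c0) c4 (N - a) j y / u q (c0 * c4) (2 * j + 2)))
     = u q c3 1 / u q (c0 * c4) (2 * j + 2) * (P q c1 c2 c3 (N + 1 - j) i a * P q (q * c3) (q * c0) c4 (N - a) j y) := by ring
  rw [h1', h1]
  rw [e3]
  rcases j with _ | j
  · simp only [dn_zero]
    rw [dn_eq_zero i (fun i => 0) (fun _ _ => rfl)]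
    field_simp
    ring
  · rw [h2 j rfl]
    simp only [dn_succ]
    rw [e3]
    field_simp
    ring


lemma sum_shift (K : ℕ) (w F v : ℕ → ℂ) (α β : ℂ) (hF : F K = 0) :
    ∑ b ∈ Finset.range (K + 1), w b * (α * (F b / v (2 * b + 2)) + β * (dn b F / v (2 * b)))
      = ∑ b ∈ Finset.range K, F b / v (2 * b + 2) * (α * w b + β * w (b + 1)) := by
  have key : ∀ K, ∑ b ∈ Finset.range (K + 1), w b * (α * (F b / v (2 * b + 2)) + β * (dn b F / v (2 * b)))
      = ∑ b ∈ Finset.range K, F b / v (2 * b + 2) * (α * w b + β * w (b + 1))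
        + w K * α * (F K / v (2 * K + 2)) := by
    intro K
    induction K with
    | zero => simp [dn_zero]; ring
    | succ K ih =>
      rw [Finset.sum_range_succ, ih, dn_succ, Finset.sum_range_succ]
      generalize ∑ b ∈ Finset.range K, F b / v (2 * b + 2) * (α * w b + β * w (b + 1)) = Z
      rw [show 2 * (K + 1) = 2 * K + 2 by ring]
      ring
  rw [key, hF]; ring

lemma SHtI (q c0 c1 c2 c3 c4 : ℂ) (N i j b I m : ℕ) (g : G5 q c0 c1 c2 c3 c4 (N + 1))
    (hI : I + i = N + 1) (hm : m + b = N) (z : ℂ) (hz : m < i → z = 0) :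
    q ^ b / u q (c0 * c1) (2 * b + 2) * ((q ^ i - c4 * q ^ (m + 1)) * P q c1 c0 c4 (N + 1 - i) j b
      + c0 * c1 * c4 * q ^ (N + b + 3) * u q (c2 * c3) (i + m + 2) * P q c1 c0 c4 (N + 1 - i) j (b + 1)) * z
    = (-(q ^ i * c4 * q ^ I * (q ^ j - c1 * q ^ I)) * (P q c1 (q * c0) c4 (N - i) j b / u q (c0 * c4) (2 * j + 2))
      + (q ^ i * (q ^ I / q ^ j) * u q (c0 * c1 * c4) (I + j + 1)) *
        (dn j (fun j => P q c1 (q * c0) c4 (N - i) j b) / u q (c0 * c4) (2 * j))) * z := by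
  by_cases h : m < i
  · rw [hz h]; ring
  have hq := g.hq
  have hg : u q (c1 * c0) (2 * b + 2) ≠ 0 := g.nz 1 1 0 0 0 (by decide) _ (by ring) _ (by omega) (by omega)
  have := PBDp q c1 c0 c4 (N - i) j b (N + 1) (2 * (N + 1) + 5) (by omega) (by omega) (by omega) g.s02.s34.gn hg
  obtain ⟨I, rfl⟩ : ∃ k, I = k + 1 := ⟨I - 1, by omega⟩
  rw [show N + 1 - i = N - i + 1 by omega, mul_comm c0 c1]
  rw [show N - i = I by omega] at *
  obtain ⟨d, rfl⟩ : ∃ d, m = i + d := ⟨m - i, by omega⟩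
  have hN : N = i + d + b := by omega
  have hId : I = d + b := by omega
  subst hN hId
  have e1 : q ^ i - c4 * q ^ (i + d + 1) = q ^ i * (1 - c4 * q ^ (d + b + 1) / q ^ b) := by
    field_simp; ring
  have e2 : c1 * c0 * c4 * q ^ (i + d + b + b + 3) * u q (c2 * c3) (i + (i + d) + 2)
      = - q ^ i * u q (c1 * c0 * c4) (d + b + b + 3) := by
    have := g.bal
    simp only [u]
    linear_combination (-q ^ i) * this
  rw [e1, e2]
  rw [show d + b + j + 2 = d + b + 1 + j + 1 by ring] at this
  linear_combination q ^ i * z * this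

lemma SHtD (q c0 c1 c2 c3 c4 : ℂ) (N i j b I m : ℕ) (g : G5 q c0 c1 c2 c3 c4 (N + 1))
    (hI : I + i = N) (hm : m + b = N) (z : ℂ) (hz : m < i → z = 0) :
    q ^ b / u q (c0 * c1) (2 * b + 2) * (u q (c4 * c2 * c3) (m + (i + 1) + 2) * P q c1 c0 c4 (N - i) j b
      + c0 * c1 * c4 * q ^ (N + b + 3) * (c2 * c3 * q * (q ^ (i + 1) - q ^ (m + 1))) * P q c1 c0 c4 (N - i) j (b + 1)) * z
    = ((c4 / c1 * (q ^ j - (c0 * c4 * q ^ (I + 2))⁻¹)) * (P q c1 (q * c0) c4 (N - i) j b / u q (c0 * c4) (2 * j + 2))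
      + ((c1 * q ^ (I + 1))⁻¹ * (1 - q ^ (I + 1) / q ^ j)) *
        (dn j (fun j => P q c1 (q * c0) c4 (N - i) j b) / u q (c0 * c4) (2 * j))) * z := by
  by_cases h : m < i
  · rw [hz h]; ring
  have hq := g.hq
  have n1 := g.n1
  have n0 := g.n0
  have hg : u q (c1 * c0) (2 * b + 2) ≠ 0 := g.nz 1 1 0 0 0 (by decide) _ (by ring) _ (by omega) (by omega)
  have := PBDm q c1 c0 c4 (N - i) j b (N + 1) (2 * (N + 1) + 5) (by omega) (by omega) (by omega) g.s02.s34.gn hg g.n1 g.n0 g.n4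
  rw [mul_comm c0 c1]
  rw [show N - i = I by omega] at *
  obtain ⟨d, rfl⟩ : ∃ d, m = i + d := ⟨m - i, by omega⟩
  have hN : N = i + d + b := by omega
  have hId : I = d + b := by omega
  subst hN hId
  have e1 : u q (c4 * c2 * c3) (i + d + (i + 1) + 2) = 1 - (c1 * c0 * q ^ (d + b + 2))⁻¹ / q ^ b := by
    have := g.bal
    simp only [u]
    field_simp
    linear_combination (-1) * this
  have e2 : c1 * c0 * c4 * q ^ (i + d + b + b + 3) * (c2 * c3 * q * (q ^ (i + 1) - q ^ (i + d + 1)))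
      = - (1 - q ^ b / q ^ (d + b)) := by
    have := g.bal
    rw [show q ^ b / q ^ (d + b) = 1 / q ^ d by field_simp; ring]
    field_simp
    linear_combination (1 - q ^ d) * this
  rw [e1, e2]
  linear_combination z * this

lemma canc1 (U w A a c X Y : ℂ) (h : U ≠ 0) :
    U * (w * (A * (a / U * X + c / U * Y))) = w * (A * (a * X + c * Y)) := by
  field_simp

lemma canc2 (U e w A a c X Y : ℂ) (h : U ≠ 0) :
    -(U * e) * (w * (A * (a / U * X + c / U * Y))) = -e * (w * (A * (a * X + c * Y))) := by
  field_simp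

lemma SHy (q c0 c1 c2 c3 c4 : ℂ) (N i j x y I : ℕ) (g : G5 q c0 c1 c2 c3 c4 (N + 1))
    (hI : I + i = N + 1) (hx : x ≤ N) :
    SG q c2 c1 c0 c4 c3 (N + 1) j i (y + 1) x =
      (-(u q c3 (i + 1) * q ^ i * c4 * q ^ I * (q ^ j - c1 * q ^ I)) / (u q (c2 * c3) (2 * i + 2) * u q (c0 * c4) (2 * j + 2)))
        * SG q c2 c1 (q * c0) c4 (q * c3) N j i y x
      + (u q c2 i * (c4 / c1 * (q ^ j - (c0 * c4 * q ^ (I + 2))⁻¹)) / (u q (c2 * c3) (2 * i) * u q (c0 * c4) (2 * j + 2)))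
        * dn i (fun i => SG q c2 c1 (q * c0) c4 (q * c3) N j i y x)
      + (u q c3 (i + 1) * q ^ i * (q ^ I / q ^ j) * u q (c0 * c1 * c4) (I + j + 1) / (u q (c2 * c3) (2 * i + 2) * u q (c0 * c4) (2 * j)))
        * dn j (fun j => SG q c2 c1 (q * c0) c4 (q * c3) N j i y x)
      + (u q c2 i * ((c1 * q ^ (I + 1))⁻¹ * (1 - q ^ (I + 1) / q ^ j)) / (u q (c2 * c3) (2 * i) * u q (c0 * c4) (2 * j)))
        * dn i (fun i => dn j (fun j => SG q c2 c1 (q * c0) c4 (q * c3) N j i y x)) := by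
  have g2 : Gn q c3 c0 c1 (N + 1) (2 * (N + 1) + 5) := g.s02.s13.gn
  have g4 : Gn q c4 c2 c3 (N + 1) (2 * (N + 1) + 5) := g.s34.s13.s34.gn
  have m1 := g4.h3 1 (by omega) (by omega)
  simp only [SG]
  rw [show N + 1 - x = (N - x) + 1 by omega]
  simp only [PAB q c3 c0 c1 (N - x) _ y (N + 1) (2 * (N + 1) + 5) (by omega) (by omega) g2]
  rw [sum_shift (N + 1) (fun a => tq q a * (c1 * c4 * q ^ (N + 1)) ^ a *
    (P q c1 c0 c4 (N + 1 - i) j a * P q c4 c2 c3 (N + 1 - a) i x))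
    (fun n => P q (q * c3) (q * c0) c1 (N - x) n y) (fun k => u q (c0 * c1) k) _ _
    (P_zero _ _ _ _ _ _ _ (by omega))]
  apply sum4 _ _ (fun i j a => tq q a * (c1 * c4 * q ^ N) ^ a *
    (P q c1 (q * c0) c4 (N - i) j a * P q c4 c2 (q * c3) (N - a) i x) * P q (q * c3) (q * c0) c1 (N - x) a y)
  intro b hb
  have hb' : b ≤ N := by simp at hb; omega
  by_cases hbx : N - x < b
  · rw [P_zero q (q * c3) (q * c0) c1 (N - x) b y (by omega)]
    rw [dn_eq_zero i _ (fun _ _ => by ring), dn_eq_zero j _ (fun _ _ => by ring),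
      dn_eq_zero i _ (fun _ _ => dn_eq_zero j _ (fun _ _ => by ring))]
    ring
  obtain ⟨m, hm⟩ : ∃ m, m + b = N := ⟨N - b, by omega⟩
  rw [show N + 1 - b = m + 1 by omega, show N + 1 - (b + 1) = m by omega, show N - b = m by omega,
    PCDp q c4 c2 c3 m i x (N + 1) (2 * (N + 1) + 5) (by omega) (by omega) (by omega) g4,
    PCDm q c4 c2 c3 m i x (N + 1) (2 * (N + 1) + 5) (by omega) (by omega) g4, tq_succ]
  generalize P q (q * c3) (q * c0) c1 (N - x) b y = f
  have hI1 := SHtI q c0 c1 c2 c3 c4 N i j b I m g hI hm (P q c4 c2 (q * c3) m i x)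
    (fun h => P_zero _ _ _ _ _ _ _ (by omega))
  have hD1 := fun i' (h : i' + 1 = i) => SHtD q c0 c1 c2 c3 c4 N i' j b I m g (by omega) hm (P q c4 c2 (q * c3) m i' x)
    (fun h => P_zero _ _ _ _ _ _ _ (by omega))
  have ew : (c1 * c4 * q ^ (N + 1)) ^ b = (c1 * c4 * q ^ N) ^ b * q ^ b := by
    rw [← mul_pow]; ring
  rw [pow_succ (c1 * c4 * q ^ (N + 1)) b, ew, canc1 _ _ _ _ _ _ _ m1, canc2 _ _ _ _ _ _ _ _ m1]
  have e3 : ∀ i, dn j (fun j => tq q b * (c1 * c4 * q ^ N) ^ b * (P q c1 (q * c0) c4 (N - i) j b * P q c4 c2 (q * c3) m i x) * f)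
      = tq q b * (c1 * c4 * q ^ N) ^ b * (dn j (fun j => P q c1 (q * c0) c4 (N - i) j b) * P q c4 c2 (q * c3) m i x) * f := by
    intro i
    rcases j with _ | j
    · simp [dn_zero]
    · simp [dn_succ]
  simp only [e3]
  rcases i with _ | i
  · simp only [dn_zero]
    linear_combination tq q b * (c1 * c4 * q ^ N) ^ b * f * u q c3 (0 + 1) / u q (c2 * c3) (2 * 0 + 2) * hI1
  · simp only [dn_succ]
    have hD := hD1 i rfl
    rw [show N + 1 - (i + 1) = N - i by omega] at *
    linear_combination tq q b * (c1 * c4 * q ^ N) ^ b * f * u q c3 (i + 1 + 1) / u q (c2 * c3) (2 * (i + 1) + 2) * hI1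
      + tq q b * (c1 * c4 * q ^ N) ^ b * f * u q c2 (i + 1) / u q (c2 * c3) (2 * (i + 1)) * hD


def Cl (q c0 c1 c2 c3 c4 : ℂ) (N i j x y : ℕ) : Prop :=
  tq q i * tq q x * q ^ ((N + 1) * (j + y)) * c1 ^ j * c4 ^ y * SG q c0 c1 c2 c3 c4 N i j x y
    = tq q j * tq q y * q ^ ((N + 1) * (i + x)) * c1 ^ i * c3 ^ x * SG q c2 c1 c0 c4 c3 N j i y x

lemma SG_zero (q c0 c1 c2 c3 c4 : ℂ) (N i j x y : ℕ) (h : N < i + j) : SG q c0 c1 c2 c3 c4 N i j x y = 0 := by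
  apply Finset.sum_eq_zero
  intro a ha
  by_cases hj : N - a < j
  · rw [P_zero q c3 c0 c4 (N - a) j y (by omega)]; ring
  · rw [P_zero q c1 c2 c3 (N - j) i a (by omega)]; ring

lemma Cl_zero (q c0 c1 c2 c3 c4 : ℂ) (N i j x y : ℕ) (h : N < i + j) : Cl q c0 c1 c2 c3 c4 N i j x y := by
  rw [Cl, SG_zero _ _ _ _ _ _ _ _ _ _ _ h, SG_zero _ _ _ _ _ _ _ _ _ _ _ (by omega)]; ring

lemma Cl.mirror {q c0 c1 c2 c3 c4 : ℂ} {N i j x y : ℕ} (h : Cl q c0 c1 c2 c3 c4 N i j x y) :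
    Cl q c2 c1 c0 c4 c3 N j i y x := by
  rw [Cl] at *; rw [← h]

lemma stepY (q c0 c1 c2 c3 c4 : ℂ) (N i j x y : ℕ) (g : G5 q c0 c1 c2 c3 c4 (N + 1)) (hx : x ≤ N)
    (ih : ∀ i j, Cl q (q * c0) c1 c2 (q * c3) c4 N i j x y) :
    Cl q c0 c1 c2 c3 c4 (N + 1) i j x (y + 1) := by
  by_cases hij : N + 1 < i + j
  · exact Cl_zero _ _ _ _ _ _ _ _ _ _ _ hij
  obtain ⟨I, hI⟩ : ∃ I, I + i = N + 1 := ⟨N + 1 - i, by omega⟩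
  obtain ⟨J, hJ⟩ : ∃ I, I + j = N + 1 := ⟨N + 1 - j, by omega⟩
  have hq := g.hq
  have n0 := g.n0
  have n1 := g.n1
  have n4 := g.n4
  have bal := g.bal
  have qI : q ^ I = q ^ (N + 1) / q ^ i := by rw [← hI, pow_add]; field_simp
  have qJ : q ^ J = q ^ (N + 1) / q ^ j := by rw [← hJ, pow_add]; field_simp
  have n00 : q ^ (j + N + 2) * c4 * ((q ^ i - c1 * q ^ J) * u q c3 (i + 1))
      = - q ^ (1 + i) * (-(u q c3 (i + 1) * q ^ i * c4 * q ^ I * (q ^ j - c1 * q ^ I))) := by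
    rw [qI, qJ]; field_simp; ring
  have n10 : q ^ j * c4 * (u q c2 i * u q (c1 * c2 * c3) (J + i + 1))
      = c1 * (u q c2 i * (c4 / c1 * (q ^ j - (c0 * c4 * q ^ (I + 2))⁻¹))) := by
    generalize u q c2 i = z
    simp only [u, pow_add, qI, qJ]
    field_simp
    linear_combination (-q ^ i) * z * bal
  have n01 : q ^ (2 * N + 3) * c1 * c4 * (-(c0 * q * u q (c2 * c3) (i + J + 2) * u q c3 (i + 1)))
      = q ^ (1 + i) * (u q c3 (i + 1) * q ^ i * (q ^ I / q ^ j) * u q (c0 * c1 * c4) (I + j + 1)) := by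
    generalize u q c3 (i + 1) = z
    simp only [u, pow_add, qI, qJ]
    field_simp
    linear_combination (q ^ i) * q ^ N * z * bal
  have n11 : - q ^ (N + 1) * c4 * (-(c0 * q * (c2 * c3 * q) * (q ^ i - q ^ (J + 1)) * u q c2 i))
      = u q c2 i * ((c1 * q ^ (I + 1))⁻¹ * (1 - q ^ (I + 1) / q ^ j)) := by
    generalize u q c2 i = z
    simp only [pow_add, qI, qJ]
    field_simp
    linear_combination (q ^ i * q ^ j - q ^ (N + 2)) * z * bal
  simp only [Cl] at ih ⊢
  rw [SGy q c0 c1 c2 c3 c4 N i j x y J g hJ, SHy q c0 c1 c2 c3 c4 N i j x y I g hI hx]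
  clear qI qJ bal
  generalize (q ^ i - c1 * q ^ J) * u q c3 (i + 1) = a00 at *
  generalize (u q c2 i * u q (c1 * c2 * c3) (J + i + 1)) = a10 at *
  generalize (-(c0 * q * u q (c2 * c3) (i + J + 2) * u q c3 (i + 1))) = a01 at *
  generalize (-(c0 * q * (c2 * c3 * q) * (q ^ i - q ^ (J + 1)) * u q c2 i)) = a11 at *
  generalize (-(u q c3 (i + 1) * q ^ i * c4 * q ^ I * (q ^ j - c1 * q ^ I))) = b00 at *
  generalize (u q c2 i * (c4 / c1 * (q ^ j - (c0 * c4 * q ^ (I + 2))⁻¹))) = b10 at *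
  generalize (u q c3 (i + 1) * q ^ i * (q ^ I / q ^ j) * u q (c0 * c1 * c4) (I + j + 1)) = b01 at *
  generalize u q c2 i * ((c1 * q ^ (I + 1))⁻¹ * (1 - q ^ (I + 1) / q ^ j)) = b11 at *
  generalize u q (c0 * c4) (2 * j + 2) = d1
  generalize u q (c2 * c3) (2 * i + 2) = d2
  generalize u q (c0 * c4) (2 * j) = d3
  generalize u q (c2 * c3) (2 * i) = d4
  generalize SG q (q * c0) c1 c2 (q * c3) c4 N = S at *
  generalize SG q c2 c1 (q * c0) c4 (q * c3) N = H at *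
  have f00 := ih i j
  rcases i with _ | i <;> rcases j with _ | j <;> simp only [dn_zero, dn_succ, tq_succ] at f00 ⊢
  · linear_combination q ^ (0 + y + N + 2) * c4 * (a00 / (d1 * d2)) * f00
      + tq q 0 * tq q y * q ^ ((N + 1) * (0 + x)) * c1 ^ 0 * (q * c3) ^ x * q ^ y * H 0 0 y x / (d1 * d2) * n00
  · have f01 := ih 0 j
    linear_combination q ^ (j + 1 + y + N + 2) * c4 * (a00 / (d1 * d2)) * f00
      + tq q j * (-q ^ (j + 1)) * tq q y * q ^ ((N + 1) * (0 + x)) * c1 ^ 0 * (q * c3) ^ x * q ^ y * H (j + 1) 0 y x / (d1 * d2) * n00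
      + q ^ (j + y + 2 * N + 4) * c1 * c4 * (a01 / (d3 * d2)) * f01
      + tq q j * tq q y * q ^ ((N + 1) * (0 + x)) * c1 ^ 0 * (q * c3) ^ x * q ^ (j + 1 + y) * H j 0 y x / (d3 * d2) * n01
  · have f10 := ih i 0
    linear_combination q ^ (0 + y + N + 2) * c4 * (a00 / (d1 * d2)) * f00
      + tq q 0 * tq q y * q ^ ((N + 1) * (i + 1 + x)) * c1 ^ (i + 1) * (q * c3) ^ x * q ^ y * H 0 (i + 1) y x / (d1 * d2) * n00
      - q ^ (i + 1 + 0 + y + N + 2) * c4 * (a10 / (d1 * d4)) * f10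
      - tq q 0 * tq q y * q ^ ((N + 1) * (i + x)) * c1 ^ i * (q * c3) ^ x * q ^ (i + 1 + y + N + 2) * H 0 i y x / (d1 * d4) * n10
  · have f10 := ih i (j + 1)
    have f01 := ih (i + 1) j
    have f11 := ih i j
    simp only [tq_succ] at f10 f01
    linear_combination q ^ (j + 1 + y + N + 2) * c4 * (a00 / (d1 * d2)) * f00
      + tq q j * (-q ^ (j + 1)) * tq q y * q ^ ((N + 1) * (i + 1 + x)) * c1 ^ (i + 1) * (q * c3) ^ x * q ^ y * H (j + 1) (i + 1) y x / (d1 * d2) * n00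
      + q ^ (j + y + 2 * N + 4) * c1 * c4 * (a01 / (d3 * d2)) * f01
      + tq q j * tq q y * q ^ ((N + 1) * (i + 1 + x)) * c1 ^ (i + 1) * (q * c3) ^ x * q ^ (j + 1 + y) * H j (i + 1) y x / (d3 * d2) * n01
      - q ^ (i + 1 + (j + 1) + y + N + 2) * c4 * (a10 / (d1 * d4)) * f10
      - tq q j * (-q ^ (j + 1)) * tq q y * q ^ ((N + 1) * (i + x)) * c1 ^ i * (q * c3) ^ x * q ^ (i + 1 + y + N + 2) * H (j + 1) i y x / (d1 * d4) * n10
      - q ^ (i + 1) * q ^ (j + y + 2 * N + 4) * c1 * c4 * (a11 / (d3 * d4)) * f11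
      + tq q j * tq q y * q ^ ((N + 1) * (i + x)) * c1 ^ i * (q * c3) ^ x * q ^ (j + 1 + y + 1 + (i + 1) + N + 1) * c1 * H j i y x / (d3 * d4) * n11

lemma stepX (q c0 c1 c2 c3 c4 : ℂ) (N i j x y : ℕ) (g : G5 q c0 c1 c2 c3 c4 (N + 1)) (hx : y ≤ N)
    (ih : ∀ i j, Cl q c0 c1 (q * c2) c3 (q * c4) N i j x y) :
    Cl q c0 c1 c2 c3 c4 (N + 1) i j (x + 1) y :=
  (stepY q c2 c1 c0 c4 c3 N j i y x g.s02.s34 hx (fun i j => (ih j i).mirror)).mirror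


def hk (q c2 e : ℂ) (M k : ℕ) : ℂ :=
  q ^ k / (pp q c2 k * poch q (e * q ^ (M + 2)) k * poch q ((q ^ M)⁻¹) k * pp q 1 k)

lemma T0_ratio (q b e c1 c2 c3 : ℂ) (k r s K L : ℕ) (hK : k + 1 + r + s ≤ K)
    (hL : 2 * (k + 1 + r + s) + 3 ≤ L) (g : Gen q c1 c2 c3 b e K L) :
    T0 q b e c1 c2 c3 (k + 1) r s = T0 q b e c1 c2 c3 k (r + 1) s *
      (q * (1 - (q ^ (k + 1 + r))⁻¹ * q ^ k) * (1 - b * q ^ (k + 1 + r + 1) * q ^ k)) /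
      (u q c2 (k + 1) * (1 - e * q ^ (k + 1 + r + s + 2) * q ^ k) * (1 - (q ^ (k + 1 + r + s))⁻¹ * q ^ k)
        * u q 1 (k + 1)) := by
  have hq := g.hq
  have h1 := g.h2 (k + 1) (by omega) (by omega)
  have h2 := g.he (2 * k + r + s + 3) (by omega) (by omega)
  have h3 := g.h0 (r + s + 1) (by omega) (by omega)
  have h3' := g.h0 (r + 1) (by omega) (by omega)
  have h4 := g.h0 (k + 1) (by omega) (by omega)
  have e1 : 1 - (q ^ (k + 1 + r))⁻¹ * q ^ k = - u q 1 (r + 1) / q ^ (r + 1) := by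
    simp only [u]; field_simp; ring
  have e2 : 1 - (q ^ (k + 1 + r + s))⁻¹ * q ^ k = - u q 1 (r + s + 1) / q ^ (r + s + 1) := by
    simp only [u]; field_simp; ring
  have e3 : 1 - b * q ^ (k + 1 + r + 1) * q ^ k = u q b (2 * k + r + 2) := by
    simp only [u]; ring
  have e4 : 1 - e * q ^ (k + 1 + r + s + 2) * q ^ k = u q e (2 * k + r + s + 3) := by
    simp only [u]; ring
  rw [e1, e2, e3, e4]
  simp only [T0, B1, B2, B3, BE, BB]
  rw [show r + 1 + s = r + s + 1 by ring, show k + 1 + r = k + (r + 1) by ring,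
    show 2 * (k + 1) + 2 * r + s + 1 = 2 * k + 2 * (r + 1) + s + 1 by ring,
    show 2 * (k + 1) + r + s + 1 = (2 * k + (r + 1) + s + 1) + 1 by ring,
    show 2 * (k + 1) + 2 * r + 1 = 2 * k + 2 * (r + 1) + 1 by ring,
    show 2 * (k + 1) + r = (2 * k + (r + 1)) + 1 by ring,
    pp_succ q e (2 * k + (r + 1) + s + 1), pp_succ q b (2 * k + (r + 1)),
    pp_succ q 1 (r + s), pp_succ q 1 r, pp_succ q 1 k, pp_succ q c2 k,
    show 2 * k + (r + 1) + s + 1 + 1 = 2 * k + r + s + 3 by ring,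
    show 2 * k + (r + 1) + 1 = 2 * k + r + 2 by ring]
  have := g.h0.pp (show r + s ≤ K by omega)
  have := g.h0.pp (show r ≤ K by omega)
  have := g.h0.pp (show s ≤ K by omega)
  have := g.h0.pp (show k ≤ K by omega)
  have := g.h2.pp (show k ≤ L by omega)
  have := g.h3.pp (show k + (r + 1) ≤ L by omega)
  have := g.he.pp (show 2 * k + (r + 1) + s + 1 ≤ L by omega)
  have := g.hb.pp (show 2 * k + 2 * (r + 1) + s + 1 ≤ L by omega)
  field_simp
  ring

lemma T_k (q c1 c2 c3 : ℂ) (M n k K L : ℕ) (hK : M ≤ K) (hL : 2 * M + 3 ≤ L) (g : Gn q c1 c2 c3 K L)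
    (hn : n ≤ M) (hkn : k ≤ n) :
    T q c1 c2 c3 M n k = T q c1 c2 c3 M n 0 * (phi q (c2 * c3) n k * hk q c2 (c1 * c2 * c3) M k) := by
  induction k with
  | zero => simp [phi_zero, hk, poch_zero, pp_zero]
  | succ k ih =>
    obtain ⟨r, rfl⟩ : ∃ r, n = k + 1 + r := ⟨n - (k + 1), by omega⟩
    obtain ⟨s, rfl⟩ : ∃ s, M = k + 1 + r + s := ⟨M - (k + 1 + r), by omega⟩
    have ih := ih (by omega)
    rw [T_eq q c1 c2 c3 (k + 1) r s _ _ rfl rfl, T0_ratio q _ _ c1 c2 c3 k r s K L hK hL g,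
      ← T_eq q c1 c2 c3 k (r + 1) s (k + 1 + r) (k + 1 + r + s) (by ring) (by ring), ih]
    simp only [hk, phi, poch_succ, pp_succ, div_eq_mul_inv, mul_inv]
    ring

/-- duality -/
lemma dual (q c1 c2 c3 : ℂ) (M n x K L : ℕ) (hK : M ≤ K) (hL : 2 * M + 3 ≤ L) (g : Gn q c1 c2 c3 K L)
    (hb : NZ q (c1 * c2) L) (hn : n ≤ M) (hx : x ≤ M) :
    P q c1 c2 c3 M n x * T q c3 c2 c1 M x 0 = T q c1 c2 c3 M n 0 * P q c3 c2 c1 M x n := by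
  have g' : Gn q c3 c2 c1 K L := ⟨g.hq, g.h0, g.h3, g.h2, g.h1, by rw [mul_comm]; exact hb,
    by rw [show c3 * c2 * c1 = c1 * c2 * c3 by ring]; exact g.he⟩
  have hq := g.hq
  rw [P_eq q c1 c2 c3 M n x (M + 1) hx (by omega), P_eq q c3 c2 c1 M x n (M + 1) hn (by omega),
    Finset.sum_mul, Finset.mul_sum]
  apply Finset.sum_congr rfl
  intro k _
  rcases lt_or_ge n k with h | h
  · rw [T_zero _ _ _ _ _ _ _ (Or.inl h), phi_zero_of_lt _ _ hq _ _ h]; ring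
  rcases lt_or_ge x k with h' | h'
  · rw [T_zero _ _ _ _ M x k (Or.inl h'), phi_zero_of_lt _ _ hq _ _ h']; ring
  rw [T_k q c1 c2 c3 M n k K L hK hL g hn h, T_k q c3 c2 c1 M x k K L hK hL g' hx h',
    show c3 * c2 * c1 = c1 * c2 * c3 by ring, mul_comm c3 c2, mul_comm c2 c1]
  ring

def W (q c1 c2 c3 : ℂ) (n s : ℕ) : ℂ :=
  pp q 1 (n + s) / (pp q 1 n * pp q 1 s) * (pp q c2 n / pp q c3 n) * pp q c1 s *
    (pp q (c1 * c2 * c3) (2 * n + s + 1) / pp q (c1 * c2 * c3) (n + s + 1)) *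
    (u q (c2 * c3) (2 * n + 1) * pp q (c2 * c3) n / pp q (c2 * c3) (2 * n + s + 1))

lemma T_W (q c1 c2 c3 : ℂ) (M n s : ℕ) (h : M = n + s) : T q c1 c2 c3 M n 0 = W q c1 c2 c3 n s := by
  rw [T_eq q c1 c2 c3 0 n s n M (by simp) (by simp [h])]
  simp only [T0, B1, B2, B3, BE, BB, W, pp_zero, mul_zero, zero_add, pow_zero, mul_one, div_one]
  ring

lemma P_W (q c1 c2 c3 : ℂ) (M n s : ℕ) (h : M = n + s) : P q c1 c2 c3 M n 0 = W q c1 c2 c3 n s := by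
  rw [← T_W q c1 c2 c3 M n s h, P, if_pos (by omega)]
  by_cases hq : q = 0
  · rw [Finset.sum_range_succ', phi_zero, mul_one]
    convert zero_add _
    apply Finset.sum_eq_zero
    intro k _
    simp [phi, poch, Finset.prod_range_succ']
  rw [Finset.sum_range_succ', phi_zero, mul_one]
  convert zero_add _
  apply Finset.sum_eq_zero
  intro k _
  rw [phi_zero_of_lt _ _ hq _ _ (by omega), mul_zero]

lemma P_n0 (q c1 c2 c3 : ℂ) (M x : ℕ) (h : x ≤ M) : P q c1 c2 c3 M 0 x = W q c1 c2 c3 0 M := by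
  rw [← T_W q c1 c2 c3 M 0 M (by simp), P, if_pos h]
  simp [phi_zero]

lemma refl (q c d : ℂ) (hq : q ≠ 0) (N : ℕ) (h : c * d * q ^ (2 * N + 3) = 1) (m m' : ℕ)
    (hm : m + m' = 2 * N + 2) : pp q c m * pp q d m' = d ^ m' * tq q m' * pp q c (2 * N + 2) := by
  induction m' generalizing m with
  | zero => simp [tq_zero, pp_zero, show m = 2 * N + 2 by omega]
  | succ m' ih =>
    have := ih (m + 1) (by omega)
    rw [pp_succ] at this
    have e : u q d (m' + 1) = u q c (m + 1) * (-(d * q ^ (m' + 1))) := by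
      simp only [u]
      have : c * d * q ^ (m + 1) * q ^ (m' + 1) = 1 := by
        rw [← h, show 2 * N + 3 = m + 1 + (m' + 1) by omega]; ring
      linear_combination (-1) * this
    rw [pp_succ, tq_succ, e]
    linear_combination (-(d * q ^ (m' + 1))) * this


lemma W_0 (q c1 c2 c3 : ℂ) (s K L : ℕ) (hK : s ≤ K) (hL : s + 1 ≤ L) (g : Gn q c1 c2 c3 K L) :
    W q c1 c2 c3 0 s = pp q c1 s * (u q (c2 * c3) 1 / pp q (c2 * c3) (s + 1)) := by
  have h1 := g.h0.pp hK
  have h2 := g.he.pp hL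
  simp only [W, pp_zero, mul_zero, zero_add, mul_one, div_one, one_mul]
  field_simp

def KK (q c0 c1 c2 c3 c4 : ℂ) (N i j : ℕ) : ℂ :=
  W q c1 c2 c3 i (N - j - i) * (pp q 1 N / (pp q 1 j * pp q 1 (N - j))) * (pp q c0 j / pp q c4 j) *
    (u q (c0 * c4) (2 * j + 1) * pp q (c0 * c4) j) *
    (pp q (c1 * c2 * c3) (N - j + 1) / (pp q (c4 * c2 * c1) (N + 1) * u q (c0 * c3) 1)) /
    (pp q c1 N * (u q (c2 * c4) 1 / pp q (c2 * c4) (N + 1))) * (c3 ^ j * (c4 / c3) ^ (N + 1)) *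
    (pp q (c0 * c3) (2 * N + 2) / pp q (c0 * c4) (2 * N + 2))

lemma dscal (q c0 c1 c2 c3 c4 : ℂ) (N i j a r : ℕ) (g : G5 q c0 c1 c2 c3 c4 N) (hN : N = a + j + r) :
    c3 ^ a * W q c3 c0 c4 j r * W q c4 c2 c1 a (j + r) * W q c1 c2 c3 i (N - j - i)
      = KK q c0 c1 c2 c3 c4 N i j * c4 ^ a * W q c1 c2 c4 0 N * W q c4 c0 c3 0 (j + r) * W q c3 c2 c1 a r := by
  have hq := g.hq
  have n1 := g.n1
  have n2 := g.n2
  have n3 := g.n3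
  have n4 := g.n4
  have bal := g.bal
  have g124 : Gn q c1 c2 c4 N (2 * N + 5) := g.s34.gn
  have g403 : Gn q c4 c0 c3 N (2 * N + 5) := g.s34.s13.s02.s34.gn
  rw [W_0 q c1 c2 c4 N N (2 * N + 5) (by omega) (by omega) g124,
    W_0 q c4 c0 c3 (j + r) N (2 * N + 5) (by omega) (by omega) g403, KK]
  have L34 : NZ q (c3 * c0 * c4) (2 * N + 5) := g.nz 1 0 0 1 1 (by decide) _ (by ring)
  have L12 : NZ q (c2 * c1) (2 * N + 5) := g.nz 0 1 1 0 0 (by decide) _ (by ring)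
  have L124 : NZ q (c4 * c2 * c1) (2 * N + 5) := g.nz 0 1 1 0 1 (by decide) _ (by ring)
  have L03 : NZ q (c0 * c3) (2 * N + 5) := g.nz 1 0 0 1 0 (by decide) _ (by ring)
  have L04 : NZ q (c0 * c4) (2 * N + 5) := g.nz 1 0 0 0 1 (by decide) _ (by ring)
  have L123 : NZ q (c1 * c2 * c3) (2 * N + 5) := g.nz 0 1 1 1 0 (by decide) _ (by ring)
  have L24 : NZ q (c2 * c4) (2 * N + 5) := g.nz 0 0 1 0 1 (by decide) _ (by ring)
  have L1 : NZ q c1 (2 * N + 5) := g.nz 0 1 0 0 0 (by decide) _ (by ring)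
  have L2 : NZ q c2 (2 * N + 5) := g.nz 0 0 1 0 0 (by decide) _ (by ring)
  have L3 : NZ q c3 (2 * N + 5) := g.nz 0 0 0 1 0 (by decide) _ (by ring)
  have L4 : NZ q c4 (2 * N + 5) := g.nz 0 0 0 0 1 (by decide) _ (by ring)
  have r1 := refl q (c3 * c0 * c4) (c2 * c1) hq N (by rw [← bal]; ring) (2 * j + r + 1) (2 * a + r + 1) (by omega)
  have r2 := refl q (c3 * c0 * c4) (c2 * c1) hq N (by rw [← bal]; ring) (j + r + 1) (2 * a + (j + r) + 1) (by omega)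
  have r3 := refl q (c0 * c3) (c4 * c2 * c1) hq N (by rw [← bal]; ring) (j + r + 1) (2 * a + (j + r) + 1) (by omega)
  have r4 := refl q (c0 * c4) (c1 * c2 * c3) hq N (by rw [← bal]; ring) (2 * j + r + 1) (2 * a + r + 1) (by omega)
  have z1 := L12.pp (show 2 * a + r + 1 ≤ 2 * N + 5 by omega)
  have z2 := L12.pp (show 2 * a + (j + r) + 1 ≤ 2 * N + 5 by omega)
  have z3 := L03.pp (show j + r + 1 ≤ 2 * N + 5 by omega)
  have z4 := L04.pp (show 2 * j + r + 1 ≤ 2 * N + 5 by omega)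
  have z5 := L34.pp (show 2 * N + 2 ≤ 2 * N + 5 by omega)
  have z6 := L03.pp (show 2 * N + 2 ≤ 2 * N + 5 by omega)
  have z7 := L04.pp (show 2 * N + 2 ≤ 2 * N + 5 by omega)
  have z8 := L1.pp (show N ≤ 2 * N + 5 by omega)
  have z9 := L24.pp (show N + 1 ≤ 2 * N + 5 by omega)
  have z10 := L24 1 (by omega) (by omega)
  have z11 := L03 1 (by omega) (by omega)
  have z12 := L124.pp (show N + 1 ≤ 2 * N + 5 by omega)
  have z13 := L123.pp (show N - j + 1 ≤ 2 * N + 5 by omega)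
  have z14 := L4.pp (show j ≤ 2 * N + 5 by omega)
  have z15 := L4.pp (show j + r ≤ 2 * N + 5 by omega)
  have z16 := L3.pp (show r ≤ 2 * N + 5 by omega)
  have z17 := L1.pp (show a ≤ 2 * N + 5 by omega)
  have w1 := g.hK.pp (show N ≤ N by omega)
  have w2 := g.hK.pp (show N - j ≤ N by omega)
  have w3 := g.hK.pp (show j ≤ N by omega)
  have w4 := g.hK.pp (show a ≤ N by omega)
  have w5 := g.hK.pp (show r ≤ N by omega)
  have w6 := g.hK.pp (show j + r ≤ N by omega)
  have y1 := L34.pp (show j + r + 1 ≤ 2 * N + 5 by omega)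
  have y2 := L123.pp (show 2 * a + r + 1 ≤ 2 * N + 5 by omega)
  generalize W q c1 c2 c3 i (N - j - i) = Wi
  simp only [W]
  have s1 : pp q (c3 * c0 * c4) (2 * j + r + 1) =
      (c2 * c1) ^ (2 * a + r + 1) * tq q (2 * a + r + 1) * pp q (c3 * c0 * c4) (2 * N + 2) / pp q (c2 * c1) (2 * a + r + 1) := by
    rw [← r1]; field_simp
  have s2 : pp q (c3 * c0 * c4) (j + r + 1) = (c2 * c1) ^ (2 * a + (j + r) + 1) * tq q (2 * a + (j + r) + 1) * pp q (c3 * c0 * c4) (2 * N + 2) / pp q (c2 * c1) (2 * a + (j + r) + 1) := by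
    rw [← r2]; field_simp
  have s3 : pp q (c4 * c2 * c1) (2 * a + (j + r) + 1) = (c4 * c2 * c1) ^ (2 * a + (j + r) + 1) * tq q (2 * a + (j + r) + 1) * pp q (c0 * c3) (2 * N + 2) / pp q (c0 * c3) (j + r + 1) := by
    rw [← r3]; field_simp
  have s4 : pp q (c1 * c2 * c3) (2 * a + r + 1) = (c1 * c2 * c3) ^ (2 * a + r + 1) * tq q (2 * a + r + 1) * pp q (c0 * c4) (2 * N + 2) / pp q (c0 * c4) (2 * j + r + 1) := by
    rw [← r4]; field_simp
  rw [show c3 * c2 * c1 = c1 * c2 * c3 by ring]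
  have t1 : tq q (2 * a + (j + r) + 1) ≠ 0 := by
    rw [tq, Finset.prod_ne_zero_iff]; intro l _; exact neg_ne_zero.mpr (pow_ne_zero _ hq)
  have t2 : tq q (2 * a + r + 1) ≠ 0 := by
    rw [tq, Finset.prod_ne_zero_iff]; intro l _; exact neg_ne_zero.mpr (pow_ne_zero _ hq)
  rw [s1, s2, s3, s4, show N - j = a + r by omega, show a + (j + r) = N by omega]
  rw [show N - j = a + r by omega] at w2 z13
  clear r1 r2 r3 r4 s1 s2 s3 s4 L34 L12 L124 L03 L04 L123 L24 L1 L2 L3 L4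
  clear g124 g403 bal
  generalize pp q (c2 * c1) (2 * a + r + 1) = Z1 at *
  generalize pp q (c2 * c1) (2 * a + (j + r) + 1) = Z2 at *
  generalize pp q (c0 * c3) (j + r + 1) = Z3 at *
  generalize pp q (c0 * c4) (2 * j + r + 1) = Z4 at *
  generalize tq q (2 * a + (j + r) + 1) = Z5 at *
  generalize tq q (2 * a + r + 1) = Z6 at *
  generalize pp q (c3 * c0 * c4) (2 * N + 2) = Z7 at *
  generalize pp q (c0 * c3) (2 * N + 2) = Z8 at *
  generalize pp q (c0 * c4) (2 * N + 2) = Z9 at *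
  generalize pp q (c1 * c2 * c3) (a + r + 1) = Z10 at *
  generalize pp q (c4 * c2 * c1) (N + 1) = Z11 at *
  generalize pp q (c2 * c4) (N + 1) = Z12 at *
  generalize pp q c1 N = Z13 at *
  generalize pp q 1 N = Z14 at *
  generalize pp q 1 (j + r) = Z15 at *
  generalize pp q 1 (a + r) = Z16 at *
  generalize pp q c4 (j + r) = Z17 at *
  generalize u q (c2 * c4) 1 = Z18 at *
  generalize u q (c0 * c3) 1 = Z19 at *
  generalize u q (c0 * c4) (2 * j + 1) = Z20 at *
  generalize u q (c2 * c1) (2 * a + 1) = Z21 at *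
  generalize pp q 1 j = Z22 at *
  generalize pp q 1 a = Z23 at *
  generalize pp q 1 r = Z24 at *
  generalize pp q c4 j = Z25 at *
  generalize pp q c1 a = Z26 at *
  generalize pp q c3 r = Z27 at *
  generalize pp q (c0 * c4) j = Z28 at *
  generalize pp q (c2 * c1) a = Z29 at *
  generalize pp q c0 j = Z30 at *
  generalize pp q c2 a = Z31 at *
  subst hN
  rw [div_pow]
  simp only [mul_pow]
  field_simp
  try ring


lemma W_ne (q c1 c2 c3 : ℂ) (n s K L : ℕ) (hK : n + s ≤ K) (hL : 2 * (n + s) + 1 ≤ L) (g : Gn q c1 c2 c3 K L) :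
    W q c1 c2 c3 n s ≠ 0 := by
  have := g.h0.pp (show n + s ≤ K by omega)
  have := g.h0.pp (show n ≤ K by omega)
  have := g.h0.pp (show s ≤ K by omega)
  have := g.h2.pp (show n ≤ L by omega)
  have := g.h3.pp (show n ≤ L by omega)
  have := g.h1.pp (show s ≤ L by omega)
  have := g.he.pp (show 2 * n + s + 1 ≤ L by omega)
  have := g.he.pp (show n + s + 1 ≤ L by omega)
  have := g.hb.pp (show 2 * n + s + 1 ≤ L by omega)
  have := g.hb.pp (show n ≤ L by omega)
  have := g.hb (2 * n + 1) (by omega) (by omega)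
  simp only [W]
  positivity

lemma SG_dual (q c0 c1 c2 c3 c4 : ℂ) (N i j : ℕ) (g : G5 q c0 c1 c2 c3 c4 N) (hij : i + j ≤ N) :
    SG q c0 c1 c2 c3 c4 N i j 0 0 = KK q c0 c1 c2 c3 c4 N i j * SG q c0 c1 c2 c4 c3 N 0 0 i j := by
  simp only [SG, Finset.mul_sum, Nat.sub_zero]
  apply Finset.sum_congr rfl
  intro a ha
  rcases lt_or_ge (N - j) a with h | h
  · rw [P_zero q c1 c2 c3 (N - j) i a (Or.inr h), P_zero q c3 c2 c1 (N - j) a i (Or.inl h)]; ring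
  obtain ⟨r, hr⟩ : ∃ r, N = a + j + r := ⟨N - (a + j), by omega⟩
  have g' : Gn q c3 c2 c1 N (2 * N + 5) := g.s13.gn
  rw [P_W q c3 c0 c4 (N - a) j r (by omega), P_W q c4 c2 c1 N a (j + r) (by omega),
    P_n0 q c1 c2 c4 N a (by omega), P_n0 q c4 c0 c3 (N - a) j (by omega), show N - a = j + r by omega]
  have d := dual q c1 c2 c3 (N - j) i a N (2 * N + 5) (by omega) (by omega) g.gn
    (g.nz 0 1 1 0 0 (by decide) _ (by ring)) (by omega) (by omega)
  rw [T_W q c3 c2 c1 (N - j) a r (by omega), T_W q c1 c2 c3 (N - j) i (N - j - i) (by omega)] at d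
  have ds := dscal q c0 c1 c2 c3 c4 N i j a r g hr
  have hW := W_ne q c3 c2 c1 a r N (2 * N + 5) (by omega) (by omega) g'
  apply mul_right_cancel₀ hW
  simp only [mul_pow]
  linear_combination (tq q a * (c1 ^ a * c3 ^ a * (q ^ N) ^ a) * W q c3 c0 c4 j r * W q c4 c2 c1 a (j + r)) * d
    + (tq q a * (c1 ^ a * (q ^ N) ^ a) * P q c3 c2 c1 (N - j) a i) * ds


lemma tq_ne (q : ℂ) (hq : q ≠ 0) (n : ℕ) : tq q n ≠ 0 := by
  rw [tq, Finset.prod_ne_zero_iff]; intro l _; exact neg_ne_zero.mpr (pow_ne_zero _ hq)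

lemma tqr (q c d : ℂ) (hq : q ≠ 0) (N : ℕ) (h : c * d * q ^ (2 * N + 3) = 1) (m m' : ℕ)
    (hm : m + m' = 2 * N + 2) (hc : pp q c (2 * N + 2) ≠ 0) (hd : pp q d (2 * N + 2) ≠ 0) :
    d ^ m * tq q m * c ^ (N + 1) = c ^ m' * tq q m' * d ^ (N + 1) := by
  have h' : d * c * q ^ (2 * N + 3) = 1 := by rw [← h]; ring
  have a1 := refl q c d hq N h m' m (by omega)
  have a2 := refl q d c hq N h' m m' (by omega)
  have a3 := refl q c d hq N h (N + 1) (N + 1) (by omega)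
  have a4 := refl q d c hq N h' (N + 1) (N + 1) (by omega)
  have t := tq_ne q hq (N + 1)
  have hA : d ^ m * tq q m * pp q c (2 * N + 2) = c ^ m' * tq q m' * pp q d (2 * N + 2) := by
    rw [← a1, ← a2]; ring
  have hB : d ^ (N + 1) * tq q (N + 1) * pp q c (2 * N + 2) = c ^ (N + 1) * tq q (N + 1) * pp q d (2 * N + 2) := by
    rw [← a3, ← a4]; ring
  apply mul_right_cancel₀ (mul_ne_zero t (mul_ne_zero hc hd))
  linear_combination c ^ (N + 1) * tq q (N + 1) * pp q d (2 * N + 2) * hA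
    - c ^ m' * tq q m' * pp q d (2 * N + 2) * hB

lemma KK_symm (q c0 c1 c2 c3 c4 : ℂ) (N i j t : ℕ) (g : G5 q c0 c1 c2 c3 c4 N) (hN : N = i + j + t) :
    c1 ^ j * c4 ^ i * KK q c0 c1 c2 c3 c4 N i j = c3 ^ j * c1 ^ i * KK q c2 c1 c0 c4 c3 N j i := by
  have hq := g.hq
  have n0 := g.n0
  have n1 := g.n1
  have n2 := g.n2
  have n3 := g.n3
  have n4 := g.n4
  have bal := g.bal
  have L14 : NZ q (c1 * c0 * c4) (2 * N + 5) := g.nz 1 1 0 0 1 (by decide) _ (by ring)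
  have L124 : NZ q (c4 * c2 * c1) (2 * N + 5) := g.nz 0 1 1 0 1 (by decide) _ (by ring)
  have L013 : NZ q (c3 * c0 * c1) (2 * N + 5) := g.nz 1 1 0 1 0 (by decide) _ (by ring)
  have L03 : NZ q (c0 * c3) (2 * N + 5) := g.nz 1 0 0 1 0 (by decide) _ (by ring)
  have L04 : NZ q (c0 * c4) (2 * N + 5) := g.nz 1 0 0 0 1 (by decide) _ (by ring)
  have L123 : NZ q (c1 * c2 * c3) (2 * N + 5) := g.nz 0 1 1 1 0 (by decide) _ (by ring)
  have L24 : NZ q (c2 * c4) (2 * N + 5) := g.nz 0 0 1 0 1 (by decide) _ (by ring)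
  have L23 : NZ q (c2 * c3) (2 * N + 5) := g.nz 0 0 1 1 0 (by decide) _ (by ring)
  have L1 : NZ q c1 (2 * N + 5) := g.nz 0 1 0 0 0 (by decide) _ (by ring)
  have L3 : NZ q c3 (2 * N + 5) := g.nz 0 0 0 1 0 (by decide) _ (by ring)
  have L4 : NZ q c4 (2 * N + 5) := g.nz 0 0 0 0 1 (by decide) _ (by ring)
  have r1 := refl q (c2 * c3) (c1 * c0 * c4) hq N (by rw [← bal]; ring) (2 * i + t + 1) (2 * j + t + 1) (by omega)
  have r2 := refl q (c0 * c4) (c1 * c2 * c3) hq N (by rw [← bal]; ring) (2 * j + t + 1) (2 * i + t + 1) (by omega)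
  have r3 := refl q (c2 * c4) (c3 * c0 * c1) hq N (by rw [← bal]; ring) (N + 1) (N + 1) (by omega)
  have r4 := refl q (c0 * c3) (c4 * c2 * c1) hq N (by rw [← bal]; ring) (N + 1) (N + 1) (by omega)
  have r5 := tqr q (c0 * c4) (c1 * c2 * c3) hq N (by rw [← bal]; ring) (2 * i + t + 1) (2 * j + t + 1) (by omega)
    (L04.pp (by omega)) (L123.pp (by omega))
  have z1 := L23.pp (show 2 * i + t + 1 ≤ 2 * N + 5 by omega)
  have z2 := L04.pp (show 2 * j + t + 1 ≤ 2 * N + 5 by omega)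
  have z3 := L24.pp (show N + 1 ≤ 2 * N + 5 by omega)
  have z4 := L03.pp (show N + 1 ≤ 2 * N + 5 by omega)
  have z5 := L23.pp (show 2 * N + 2 ≤ 2 * N + 5 by omega)
  have z6 := L04.pp (show 2 * N + 2 ≤ 2 * N + 5 by omega)
  have z7 := L24.pp (show 2 * N + 2 ≤ 2 * N + 5 by omega)
  have z8 := L03.pp (show 2 * N + 2 ≤ 2 * N + 5 by omega)
  have z9 := L123.pp (show i + t + 1 ≤ 2 * N + 5 by omega)
  have z10 := L14.pp (show j + t + 1 ≤ 2 * N + 5 by omega)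
  have z11 := L24 1 (by omega) (by omega)
  have z12 := L03 1 (by omega) (by omega)
  have z13 := L1.pp (show N ≤ 2 * N + 5 by omega)
  have z14 := L4.pp (show j ≤ 2 * N + 5 by omega)
  have z15 := L3.pp (show i ≤ 2 * N + 5 by omega)
  have w1 := g.hK.pp (show N ≤ N by omega)
  have w2 := g.hK.pp (show i + t ≤ N by omega)
  have w3 := g.hK.pp (show j + t ≤ N by omega)
  have w4 := g.hK.pp (show i ≤ N by omega)
  have w5 := g.hK.pp (show j ≤ N by omega)
  have w6 := g.hK.pp (show t ≤ N by omega)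
  have t1 := tq_ne q hq (2 * j + t + 1)
  have t2 := tq_ne q hq (N + 1)
  simp only [KK, W]
  rw [show N - j - i = t by omega, show N - i - j = t by omega, show N - i = j + t by omega,
    show N - j = i + t by omega]
  have s1 : pp q (c1 * c0 * c4) (2 * j + t + 1) = (c1 * c0 * c4) ^ (2 * j + t + 1) * tq q (2 * j + t + 1) *
      pp q (c2 * c3) (2 * N + 2) / pp q (c2 * c3) (2 * i + t + 1) := by
    rw [← r1]; field_simp
  have s2 : pp q (c1 * c2 * c3) (2 * i + t + 1) = (c1 * c2 * c3) ^ (2 * i + t + 1) * tq q (2 * i + t + 1) *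
      pp q (c0 * c4) (2 * N + 2) / pp q (c0 * c4) (2 * j + t + 1) := by
    rw [← r2]; field_simp
  have s3 : pp q (c3 * c0 * c1) (N + 1) = (c3 * c0 * c1) ^ (N + 1) * tq q (N + 1) *
      pp q (c2 * c4) (2 * N + 2) / pp q (c2 * c4) (N + 1) := by
    rw [← r3]; field_simp
  have s4 : pp q (c4 * c2 * c1) (N + 1) = (c4 * c2 * c1) ^ (N + 1) * tq q (N + 1) *
      pp q (c0 * c3) (2 * N + 2) / pp q (c0 * c3) (N + 1) := by
    rw [← r4]; field_simp
  have s5 : tq q (2 * i + t + 1) = (c0 * c4) ^ (2 * j + t + 1) * tq q (2 * j + t + 1) * (c1 * c2 * c3) ^ (N + 1)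
     / ((c1 * c2 * c3) ^ (2 * i + t + 1) * (c0 * c4) ^ (N + 1)) := by
    rw [← r5]; field_simp
  rw [s1, s2, s3, s4, s5]
  clear r1 r2 r3 r4 r5 s1 s2 s3 s4 s5 L14 L124 L013 L03 L04 L123 L24 L23 L1 L3 L4 bal g
  generalize pp q (c2 * c3) (2 * i + t + 1) = Z1 at *
  generalize pp q (c0 * c4) (2 * j + t + 1) = Z2 at *
  generalize pp q (c2 * c4) (N + 1) = Z3 at *
  generalize pp q (c0 * c3) (N + 1) = Z4 at *
  generalize pp q (c2 * c3) (2 * N + 2) = Z5 at *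
  generalize pp q (c0 * c4) (2 * N + 2) = Z6 at *
  generalize pp q (c2 * c4) (2 * N + 2) = Z7 at *
  generalize pp q (c0 * c3) (2 * N + 2) = Z8 at *
  generalize pp q (c1 * c2 * c3) (i + t + 1) = Z9 at *
  generalize pp q (c1 * c0 * c4) (j + t + 1) = Z10 at *
  generalize u q (c2 * c4) 1 = Z11 at *
  generalize u q (c0 * c3) 1 = Z12 at *
  generalize pp q c1 N = Z13 at *
  generalize pp q c4 j = Z14 at *
  generalize pp q c3 i = Z15 at *
  generalize pp q 1 N = Z16 at *
  generalize pp q 1 (i + t) = Z17 at *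
  generalize pp q 1 (j + t) = Z18 at *
  generalize pp q 1 i = Z19 at *
  generalize pp q 1 j = Z20 at *
  generalize pp q 1 t = Z21 at *
  generalize tq q (2 * j + t + 1) = Z22 at *
  generalize tq q (N + 1) = Z23 at *
  generalize pp q c0 j = Z24
  generalize pp q c2 i = Z25
  generalize pp q c1 t = Z26
  generalize u q (c2 * c3) (2 * i + 1) = Z27
  generalize pp q (c2 * c3) i = Z28
  generalize u q (c0 * c4) (2 * j + 1) = Z29
  generalize pp q (c0 * c4) j = Z30
  subst hN
  simp only [mul_pow, div_pow]
  field_simp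
  try ring

lemma stepD (q c0 c1 c2 c3 c4 : ℂ) (N i j : ℕ) (g : G5 q c0 c1 c2 c3 c4 N) (hij : i + j ≤ N)
    (ih : Cl q c0 c1 c2 c4 c3 N 0 0 i j) : Cl q c0 c1 c2 c3 c4 N i j 0 0 := by
  have d1 := SG_dual q c0 c1 c2 c3 c4 N i j g hij
  have d2 := SG_dual q c2 c1 c0 c4 c3 N j i g.s02.s34 (by omega)
  have k := KK_symm q c0 c1 c2 c3 c4 N i j (N - i - j) g (by omega)
  simp only [Cl, tq_zero, pow_zero, mul_one, one_mul, add_zero, zero_add] at ih ⊢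
  rw [d1, d2]
  have n3 := pow_ne_zero j g.n3
  have n4 := pow_ne_zero i g.n4
  apply mul_right_cancel₀ n3
  apply mul_right_cancel₀ n4
  linear_combination (c1 ^ j * c4 ^ i * KK q c0 c1 c2 c3 c4 N i j) * ih
    + (tq q j * q ^ ((N + 1) * i) * c4 ^ i * SG q c2 c1 c0 c3 c4 N 0 0 j i) * k


lemma T1 (q c1 c2 c3 : ℂ) (n s K L : ℕ) (hK : n + s + 1 ≤ K) (hL : 2 * (n + s) + 5 ≤ L) (g : Gn q c1 c2 c3 K L) :
    T q c1 c2 c3 (n + s + 1) (n + 1) 1 = q ^ (s + 1) / (u q 1 1 * u q c3 1) * T q c1 (q * c2) (q * c3) (n + s) n 0 := by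
  rw [T_eq q c1 c2 c3 1 n s _ _ (by ring) (by ring), T_eq q c1 (q * c2) (q * c3) 0 n s _ _ (by ring) (by ring)]
  simp only [T0, B1, B2, B3, BE, BB]
  rw [show q * c2 * (q * c3) = q * (q * (c2 * c3)) by ring,
    show c1 * (q * c2) * (q * c3) = q * (q * (c1 * c2 * c3)) by ring]
  have hb1 := g.hb 1 (by omega) (by omega)
  have hb2 := g.hb 2 (by omega) (by omega)
  have he1 := g.he 1 (by omega) (by omega)
  have he2 := g.he 2 (by omega) (by omega)
  have h21 := g.h2 1 (by omega) (by omega)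
  have h31 := g.h3 1 (by omega) (by omega)
  have h01 := g.h0 1 (by omega) (by omega)
  have i1 : u q (q * (c2 * c3)) 1 ≠ 0 := by rw [u_shift]; exact hb2
  have i2 : u q (q * (c1 * c2 * c3)) 1 ≠ 0 := by rw [u_shift]; exact he2
  simp only [pp_shift q _ _ hb1, pp_shift q _ _ he1, pp_shift q _ _ h21, pp_shift q _ _ h31, pp_shift q _ _ i1,
    pp_shift q _ _ i2, u_shift]
  rw [show 2 * 0 + 2 * n + s + 1 + 1 + 1 = 2 * 1 + 2 * n + s + 1 by ring,
    show 2 * 0 + n + s + 1 + 1 + 1 = 2 * 1 + n + s + 1 by ring,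
    show 2 * 0 + 2 * n + 1 + 1 + 1 = 2 * 1 + 2 * n + 1 by ring,
    show 2 * 0 + n + 1 + 1 = 2 * 1 + n by ring, show 0 + n + 1 = 1 + n by ring,
    show pp q c2 1 = u q c2 1 by rw [pp_succ, pp_zero, one_mul],
    show pp q 1 1 = u q 1 1 by rw [pp_succ, pp_zero, one_mul]]
  simp only [pp_zero, mul_zero, zero_add, pow_zero, mul_one]
  have := g.h0.pp (show n + s ≤ K by omega)
  have := g.h0.pp (show n ≤ K by omega)
  have := g.h0.pp (show s ≤ K by omega)
  have := g.h3.pp (show 1 + n ≤ L by omega)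
  have := g.he.pp (show 2 + n + s + 1 ≤ L by omega)
  have := g.hb.pp (show 2 + 2 * n + s + 1 ≤ L by omega)
  generalize u q (c2 * c3) 1 = X1 at *
  generalize u q (c2 * c3) 2 = X2 at *
  generalize u q (c1 * c2 * c3) 1 = X3 at *
  generalize u q (c1 * c2 * c3) 2 = X4 at *
  generalize u q c2 1 = X5 at *
  generalize u q c3 1 = X6 at *
  generalize u q 1 1 = X7 at *
  field_simp
  try ring

lemma P_diff (q c1 c2 c3 : ℂ) (M n : ℕ) (hq : q ≠ 0) :
    P q c1 c2 c3 (M + 1) n 1 - P q c1 c2 c3 (M + 1) n 0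
      = T q c1 c2 c3 (M + 1) n 1 * ((1 - q⁻¹) * u q (c1 * c2) 2) := by
  rcases n with _ | n
  · rw [P_n0 _ _ _ _ _ _ (by omega), P_n0 _ _ _ _ _ _ (by omega), T_zero _ _ _ _ _ _ _ (Or.inl (by omega))]; ring
  rw [P_eq q c1 c2 c3 (M + 1) (n + 1) 1 (n + 2) (by omega) (by omega),
    P_eq q c1 c2 c3 (M + 1) (n + 1) 0 (n + 2) (by omega) (by omega)]
  have h1 : ∀ k, phi q (c1 * c2) 0 (k + 1) = 0 := fun k => phi_zero_of_lt _ _ hq _ _ (by omega)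
  have h2 : ∀ k, phi q (c1 * c2) 1 (k + 2) = 0 := fun k => phi_zero_of_lt _ _ hq _ _ (by omega)
  simp only [Finset.sum_range_succ', h1, h2, phi_zero, zero_add, mul_zero, Finset.sum_const_zero]
  simp only [phi, poch, u, Finset.prod_range_one]
  simp

/-- `W` at n = 0 under the shift in c1, c2 -/
lemma W_AB (q c1 c2 c3 : ℂ) (s K L : ℕ) (hK : s + 1 ≤ K) (hL : s + 3 ≤ L) (g : Gn q c1 c2 c3 K L)
    (g' : Gn q (q * c1) (q * c2) c3 s (s + 1)) :
    W q c1 c2 c3 0 (s + 1) = W q (q * c1) (q * c2) c3 0 s * (u q c1 1 / u q (c2 * c3) 2) := by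
  rw [W_0 q c1 c2 c3 (s + 1) K L (by omega) (by omega) g, W_0 q (q * c1) (q * c2) c3 s _ _ (le_refl _) (le_refl _) g']
  have h1 := g.hb 1 (by omega) (by omega)
  have h2 := g.hb 2 (by omega) (by omega)
  have h3 := g.h1 1 (by omega) (by omega)
  have h4 := g.hb.pp (show s + 1 + 1 ≤ L by omega)
  rw [mul_assoc q c2 c3, pp_shift q _ _ h1, pp_shift q _ _ h3, u_shift]
  field_simp

lemma Gn.mono {q c1 c2 c3 : ℂ} {K L K' L' : ℕ} (g : Gn q c1 c2 c3 K L) (hK : K' ≤ K) (hL : L' ≤ L) :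
    Gn q c1 c2 c3 K' L' :=
  ⟨g.hq, g.h0.mono hK, g.h1.mono hL, g.h2.mono hL, g.h3.mono hL, g.hb.mono hL, g.he.mono hL⟩

/-- shift along 1 2 -/
lemma G5.shift12 {q c0 c1 c2 c3 c4 : ℂ} {N : ℕ} (g : G5 q c0 c1 c2 c3 c4 (N + 1)) :
    G5 q c0 (q * c1) (q * c2) c3 c4 N := g.s02.s13.shift.s13.s02

lemma stepA (q c0 c1 c2 c3 c4 : ℂ) (N : ℕ) (g : G5 q c0 c1 c2 c3 c4 (N + 1)) :
    SG q c0 c1 c2 c3 c4 (N + 1) 0 0 1 0 - SG q c0 c1 c2 c3 c4 (N + 1) 0 0 0 0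
      = c1 * c3 * q ^ (2 * N + 2) * (u q (c2 * c4) 2 / u q (c2 * c3) 2) * SG q c0 (q * c1) (q * c2) c3 c4 N 0 0 0 0 := by
  have hq := g.hq
  have gt : Gn q c4 c2 c1 (N + 1) (2 * (N + 1) + 5) := g.s34.s13.gn
  simp only [SG, Nat.sub_zero]
  rw [← Finset.sum_sub_distrib, Finset.mul_sum]
  simp only [← mul_sub, P_diff q c4 c2 c1 N _ hq]
  rw [Finset.sum_range_succ']
  rw [T_zero q c4 c2 c1 (N + 1) 0 1 (Or.inl (by omega)), zero_mul, mul_zero, add_zero]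
  apply Finset.sum_congr rfl
  intro b hb
  simp only [Finset.mem_range] at hb
  obtain ⟨s, rfl⟩ : ∃ s, N = b + s := ⟨N - b, by omega⟩
  rw [P_n0 q c1 c2 c3 _ _ (by omega), P_n0 q (q * c1) (q * c2) c3 _ _ (by omega),
    T1 q c4 c2 c1 b s _ _ (le_refl _) (by omega) gt, P_W q c4 (q * c2) (q * c1) (b + s) b s rfl,
    T_W q c4 (q * c2) (q * c1) (b + s) b s rfl,
    W_AB q c1 c2 c3 (b + s) _ _ (le_refl _) (by omega) g.gn (g.shift12.gn.mono (by omega) (by omega)),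
    show b + s + 1 - (b + 1) = b + s - b by omega, tq_succ, mul_comm c4 c2]
  have h1 := g.gn.h1 1 (by omega) (by omega)
  have h2 := g.gn.h0 1 (by omega) (by omega)
  have h3 := g.gn.hb 2 (by omega) (by omega)
  have e : 1 - q⁻¹ = - u q 1 1 / q := by simp only [u]; field_simp; ring
  rw [e]
  field_simp
  ring


lemma sum_shift2 (K : ℕ) (A B F v : ℕ → ℂ) (hF : F K = 0) :
    ∑ b ∈ Finset.range (K + 1), (A b * (F b / v (2 * b + 2)) + B b * (dn b F / v (2 * b)))
      = ∑ b ∈ Finset.range K, F b / v (2 * b + 2) * (A b + B (b + 1)) := by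
  have key : ∀ K, ∑ b ∈ Finset.range (K + 1), (A b * (F b / v (2 * b + 2)) + B b * (dn b F / v (2 * b)))
      = ∑ b ∈ Finset.range K, F b / v (2 * b + 2) * (A b + B (b + 1)) + A K * (F K / v (2 * K + 2)) := by
    intro K
    induction K with
    | zero => simp [dn_zero]
    | succ K ih =>
      rw [Finset.sum_range_succ, ih, Finset.sum_range_succ, dn_succ, show 2 * (K + 1) = 2 * K + 2 by ring]
      ring
  rw [key, hF]; simp

lemma stepB (q c0 c1 c2 c3 c4 : ℂ) (N : ℕ) (g : G5 q c0 c1 c2 c3 c4 (N + 1)) :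
    -(q ^ (N + 1) * c3) * SG q c2 c1 c0 c4 c3 (N + 1) 0 0 0 1 - SG q c2 c1 c0 c4 c3 (N + 1) 0 0 0 0
      = c1 * c3 * q ^ (2 * N + 2) * (u q (c2 * c4) 2 / u q (c2 * c3) 2) * SG q (q * c2) (q * c1) c0 c4 c3 N 0 0 0 0 := by
  have hq := g.hq
  have n0 := g.n0
  have n2 := g.n2
  have n4 := g.n4
  have bal := g.bal
  have gt : Gn q c3 c0 c1 (N + 1) (2 * (N + 1) + 5) := g.s13.s02.gn
  have g423 : Gn q c4 c2 c3 (N + 1) (2 * (N + 1) + 5) := g.s34.s13.s34.gn.mono (le_refl _) (le_refl _)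
  have g423' : Gn q c4 (q * c2) c3 N (2 * N + 5) := g.shift12.s34.s13.s34.s13.s34.s13.s34.s13.s34.gn
  have g104 : Gn q c1 c0 c4 (N + 1) (2 * (N + 1) + 5) := g.s02.s34.gn
  have g104' : Gn q (q * c1) c0 c4 N (2 * N + 5) := g.shift12.s02.s34.gn
  simp only [SG, Nat.sub_zero]
  rw [show N + 1 - 1 = N by omega, Finset.mul_sum, ← Finset.sum_sub_distrib, Finset.mul_sum]
  have hc1 := gt.h3 1 (by omega) (by omega)
  have h23 := g423.hb 2 (by omega) (by omega)
  have h231 := g423.hb 1 (by omega) (by omega)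
  have h04 := g104.hb (N + 2) (by omega) (by omega)
  have hA : W q c1 c0 c4 0 (N + 1) = W q (q * c1) c0 c4 0 N * (u q c1 1 / u q (c0 * c4) (N + 2)) := by
    rw [W_0 q c1 c0 c4 (N + 1) _ _ (le_refl _) (by omega) g104, W_0 q (q * c1) c0 c4 N _ _ (le_refl _) (by omega) g104']
    have := g104.hb.pp (show N + 1 ≤ _ by omega)
    rw [pp_succ q (c0 * c4) (N + 1), pp_shift q c1 N hc1]
    field_simp
  have e1 : ∀ b ∈ Finset.range (N + 1 + 1),
      -(q ^ (N + 1) * c3) * (tq q b * (c1 * c4 * q ^ (N + 1)) ^ b * (P q c1 c0 c4 (N + 1) 0 b * P q c4 c2 c3 (N + 1 - b) 0 1) *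
        P q c3 c0 c1 N b 0) - tq q b * (c1 * c4 * q ^ (N + 1)) ^ b * (P q c1 c0 c4 (N + 1) 0 b * P q c4 c2 c3 (N + 1 - b) 0 0) *
        P q c3 c0 c1 (N + 1) b 0
      = (fun b => -(tq q b * (c1 * c4 * q ^ (N + 1)) ^ b * W q c1 c0 c4 0 (N + 1) * W q c4 c2 c3 0 (N + 1 - b)) * (q ^ b * u q (c3 * c0 * c1) (2 * N + 3) * u q c1 (b + 1) / u q c1 1)) b
         * ((fun b => P q c3 c0 (q * c1) N b 0) b / (u q (c0 * c1)) (2 * b + 2))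
       + (fun b => -(tq q b * (c1 * c4 * q ^ (N + 1)) ^ b * W q c1 c0 c4 0 (N + 1) * W q c4 c2 c3 0 (N + 1 - b)) * (u q (c3 * c0 * c1) (2 * N + 3) * u q c0 b / u q c1 1)) b
         * (dn b (fun b => P q c3 c0 (q * c1) N b 0) / (u q (c0 * c1)) (2 * b)) := by
    intro b hb
    simp only [Finset.mem_range] at hb
    have hx : P q c4 c2 c3 (N + 1 - b) 0 1 * P q c3 c0 c1 N b 0 = W q c4 c2 c3 0 (N + 1 - b) * P q c3 c0 c1 N b 0 := by
      by_cases hb' : b = N + 1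
      · rw [P_zero q c3 c0 c1 N b 0 (by omega)]; ring
      · rw [P_n0 _ _ _ _ _ _ (by omega)]
    have p1 := PCDp q c3 c0 c1 N b 0 (N + 1) (2 * (N + 1) + 5) (by omega) (le_refl _) (by omega) gt
    have p2 := PCDm q c3 c0 c1 N b 0 (N + 1) (2 * (N + 1) + 5) (le_refl _) (by omega) gt
    have hl : -(q ^ (N + 1) * c3) * (tq q b * (c1 * c4 * q ^ (N + 1)) ^ b * (P q c1 c0 c4 (N + 1) 0 b * P q c4 c2 c3 (N + 1 - b) 0 1) *
        P q c3 c0 c1 N b 0) = -(q ^ (N + 1) * c3) * (tq q b * (c1 * c4 * q ^ (N + 1)) ^ b * P q c1 c0 c4 (N + 1) 0 b) *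
         (W q c4 c2 c3 0 (N + 1 - b) * P q c3 c0 c1 N b 0) := by
      rw [← hx]; ring
    rw [hl, P_n0 q c1 c0 c4 _ _ (by omega), P_n0 q c4 c2 c3 (N + 1 - b) 0 (by omega), p1, p2]
    beta_reduce
    generalize P q c3 c0 (q * c1) N b 0 / u q (c0 * c1) (2 * b + 2) = X
    generalize dn b (fun b => P q c3 c0 (q * c1) N b 0) / u q (c0 * c1) (2 * b) = Y
    generalize W q c4 c2 c3 0 (N + 1 - b) = Z
    generalize W q c1 c0 c4 0 (N + 1) = Z'
    simp only [u]
    simp only [u] at hc1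
    field_simp
    ring
  rw [Finset.sum_congr rfl e1, sum_shift2 (N + 1) _ _ (fun b => P q c3 c0 (q * c1) N b 0) _ (P_zero _ _ _ _ _ _ _ (by omega))]
  apply Finset.sum_congr rfl
  intro b hb
  simp only [Finset.mem_range] at hb
  obtain ⟨s, rfl⟩ : ∃ s, N = b + s := ⟨N - b, by omega⟩
  rw [P_n0 q (q * c1) c0 c4 _ _ (by omega), P_n0 q c4 (q * c2) c3 _ _ (by omega)]
  rw [show b + s + 1 - b = s + 1 by omega, show b + s - b = s by omega, show b + s + 1 - (b + 1) = s by omega]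
  have m1 : W q c4 c2 c3 0 s = W q c4 (q * c2) c3 0 s * (u q (c2 * c3) (s + 2) / u q (c2 * c3) 2) := by
    rw [W_0 q c4 c2 c3 s _ _ (by omega) (by omega) g423, W_0 q c4 (q * c2) c3 s _ _ (by omega) (by omega) g423']
    have := g423.hb.pp (show s + 1 ≤ _ by omega)
    have := g423.hb (s + 2) (by omega) (by omega)
    rw [mul_assoc q c2 c3, pp_shift q _ _ h231, u_shift, pp_succ q (c2 * c3) (s + 1)]
    field_simp
  have m2 : W q c4 c2 c3 0 (s + 1) = W q c4 (q * c2) c3 0 s * (u q c4 (s + 1) / u q (c2 * c3) 2) := by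
    rw [W_0 q c4 c2 c3 (s + 1) _ _ (by omega) (by omega) g423, W_0 q c4 (q * c2) c3 s _ _ (by omega) (by omega) g423']
    have := g423.hb.pp (show s + 1 + 1 ≤ _ by omega)
    rw [mul_assoc q c2 c3, pp_shift q _ _ h231, u_shift, pp_succ q c4 s]
    field_simp
  have h01 := gt.hb (2 * b + 2) (by omega) (by omega)
  have key : q ^ b * u q c4 (s + 1) * u q c1 (b + 1) - q ^ (b + 1) * (c1 * c4 * q ^ (b + s + 1)) * u q (c2 * c3) (s + 2) * u q c0 (b + 1)
      = u q (c0 * c4) (b + s + 2) / (c0 * q) * u q (c0 * c1) (2 * b + 2) := by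
    rw [div_mul_eq_mul_div, eq_div_iff (mul_ne_zero n0 hq)]
    simp only [u]
    linear_combination (1 - c0 * q ^ (b + 1)) * bal
  have kap : u q (c3 * c0 * c1) (2 * (b + s) + 3) = - u q (c2 * c4) 2 * (c0 * q) * (c1 * c3 * q ^ (2 * (b + s) + 2)) := by
    simp only [u]
    linear_combination - bal
  rw [hA, m1, m2, tq_succ, kap]
  generalize P q c3 c0 (q * c1) (b + s) b 0 = F
  generalize W q c4 (q * c2) c3 0 s = Z1
  generalize W q (q * c1) c0 c4 0 (b + s) = Z2
  have key2 : q ^ b * u q c4 (s + 1) * u q c1 (b + 1) = q ^ (b + 1) * (c1 * c4 * q ^ (b + s + 1)) * u q (c2 * c3) (s + 2) * u q c0 (b + 1)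
      + u q (c0 * c4) (b + s + 2) / (c0 * q) * u q (c0 * c1) (2 * b + 2) := by rw [← key]; ring
  have : F / u q (c0 * c1) (2 * b + 2) * (-(tq q b * (c1 * c4 * q ^ (b + s + 1)) ^ b * (Z2 * (u q c1 1 / u q (c0 * c4) (b + s + 2))) *
         (Z1 * (u q c4 (s + 1) / u q (c2 * c3) 2))) * (q ^ b * (- u q (c2 * c4) 2 * (c0 * q) * (c1 * c3 * q ^ (2 * (b + s) + 2))) * u q c1 (b + 1) / u q c1 1)
      + -(tq q b * (-q ^ (b + 1)) * (c1 * c4 * q ^ (b + s + 1)) ^ (b + 1) * (Z2 * (u q c1 1 / u q (c0 * c4) (b + s + 2))) *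
         (Z1 * (u q (c2 * c3) (s + 2) / u q (c2 * c3) 2))) * ((- u q (c2 * c4) 2 * (c0 * q) * (c1 * c3 * q ^ (2 * (b + s) + 2))) * u q c0 (b + 1) / u q c1 1))
     = F / u q (c0 * c1) (2 * b + 2) * (tq q b * (c1 * c4 * q ^ (b + s + 1)) ^ b * Z1 * Z2 / u q (c0 * c4) (b + s + 2) / u q (c2 * c3) 2 *
       (u q (c2 * c4) 2 * (c0 * q) * (c1 * c3 * q ^ (2 * (b + s) + 2)))) * (q ^ b * u q c4 (s + 1) * u q c1 (b + 1) - q ^ (b + 1) * (c1 * c4 * q ^ (b + s + 1)) * u q (c2 * c3) (s + 2) * u q c0 (b + 1)) := by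
    field_simp
    ring
  rw [this, key, show q * c1 * c4 * q ^ (b + s) = c1 * c4 * q ^ (b + s + 1) by ring]
  field_simp

lemma step0 (q c0 c1 c2 c3 c4 : ℂ) (N : ℕ) (g : G5 q c0 c1 c2 c3 c4 (N + 1))
    (h1 : Cl q c0 c1 c2 c3 c4 (N + 1) 0 0 1 0) (ih : Cl q c0 (q * c1) (q * c2) c3 c4 N 0 0 0 0) :
    Cl q c0 c1 c2 c3 c4 (N + 1) 0 0 0 0 := by
  have hA := stepA q c0 c1 c2 c3 c4 N g
  have hB := stepB q c0 c1 c2 c3 c4 N g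
  have hq := g.hq
  simp only [Cl, tq_zero, tq_succ, pow_zero, mul_one, one_mul, add_zero, zero_add, mul_zero, pow_one] at h1 ih ⊢
  rw [ih] at hA
  have h1' : SG q c0 c1 c2 c3 c4 (N + 1) 0 0 1 0 = -(q ^ (N + 1) * c3) * SG q c2 c1 c0 c4 c3 (N + 1) 0 0 0 1 := by
    apply mul_left_cancel₀ hq
    linear_combination - h1
  linear_combination h1' - hA + hB

lemma main0 (N : ℕ) : ∀ (q c0 c1 c2 c3 c4 : ℂ) (i j x y : ℕ), G5 q c0 c1 c2 c3 c4 N → x + y ≤ N →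
    Cl q c0 c1 c2 c3 c4 N i j x y := by
  induction N with
  | zero =>
    intro q c0 c1 c2 c3 c4 i j x y g hxy
    obtain rfl : x = 0 := by omega
    obtain rfl : y = 0 := by omega
    by_cases hij : 0 < i + j
    · exact Cl_zero _ _ _ _ _ _ _ _ _ _ _ hij
    obtain rfl : i = 0 := by omega
    obtain rfl : j = 0 := by omega
    have h : ∀ c0 c1 c2 c3 c4 : ℂ, G5 q c0 c1 c2 c3 c4 0 → SG q c0 c1 c2 c3 c4 0 0 0 0 0 = 1 := by
      intro c0 c1 c2 c3 c4 g
      have a1 := W_0 q c1 c2 c3 0 _ _ (by omega) (by omega) g.gn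
      have a2 := W_0 q c3 c0 c4 0 _ _ (by omega) (by omega) g.s02.s13.s34.gn
      have a3 := W_0 q c4 c2 c1 0 _ _ (by omega) (by omega) g.s34.s13.gn
      have b1 := g.nz 0 0 1 1 0 (by decide) (c2 * c3) (by ring) 1 (by omega) (by omega)
      have b2 := g.nz 1 0 0 0 1 (by decide) (c0 * c4) (by ring) 1 (by omega) (by omega)
      have b3 := g.nz 0 1 1 0 0 (by decide) (c2 * c1) (by ring) 1 (by omega) (by omega)
      simp only [pp_succ, pp_zero, one_mul, zero_add, div_self b1, div_self b2, div_self b3] at a1 a2 a3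
      simp [SG, P_n0, a1, a2, a3, tq_zero]
    rw [Cl, h _ _ _ _ _ g, h _ _ _ _ _ g.s02.s34]; simp
  | succ N ih =>
    have hp : ∀ (q c0 c1 c2 c3 c4 : ℂ) (i j x y : ℕ), G5 q c0 c1 c2 c3 c4 (N + 1) → x + y ≤ N + 1 → 1 ≤ x + y →
        Cl q c0 c1 c2 c3 c4 (N + 1) i j x y := by
      intro q c0 c1 c2 c3 c4 i j x y g hxy h1
      rcases y with _ | y
      · rcases x with _ | x
        · omega
        · exact stepX q c0 c1 c2 c3 c4 N i j x 0 g (by omega)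
            (fun i j => ih _ _ _ _ _ _ _ _ _ _ g.s02.s34.shift.s34.s02 (by omega))
      · exact stepY q c0 c1 c2 c3 c4 N i j x y g (by omega)
            (fun i j => ih _ _ _ _ _ _ _ _ _ _ g.shift (by omega))
    intro q c0 c1 c2 c3 c4 i j x y g hxy
    by_cases h1 : 1 ≤ x + y
    · exact hp _ _ _ _ _ _ _ _ _ _ g hxy h1
    obtain rfl : x = 0 := by omega
    obtain rfl : y = 0 := by omega
    by_cases hij : N + 1 < i + j
    · exact Cl_zero _ _ _ _ _ _ _ _ _ _ _ hij
    by_cases h2 : 1 ≤ i + j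
    · exact stepD _ _ _ _ _ _ _ _ _ g (by omega) (hp _ _ _ _ _ _ _ _ _ _ g.s34 (by omega) h2)
    obtain rfl : i = 0 := by omega
    obtain rfl : j = 0 := by omega
    exact step0 _ _ _ _ _ _ _ g (hp _ _ _ _ _ _ _ _ _ _ g (by omega) (by omega))
      (ih _ _ _ _ _ _ _ _ _ _ g.shift12 (by omega))


lemma om_tq (q r : ℂ) (a : ℕ) : qR.om q r (a : ℤ) = tq q a * r ^ a := by
  have h : ((a : ℤ) * ((a : ℤ) + 1) / 2) = ((a * (a + 1) / 2 : ℕ) : ℤ) := by push_cast; rfl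
  have h2 : tq q a = (-1) ^ a * q ^ (a * (a + 1) / 2) := by
    induction a with
    | zero => simp [tq_zero]
    | succ a ih =>
      have : (a + 1) * (a + 1 + 1) / 2 = a * (a + 1) / 2 + (a + 1) := by
        rw [show (a + 1) * (a + 1 + 1) = a * (a + 1) + (a + 1) * 2 by ring, Nat.add_mul_div_right _ _ (by norm_num)]
      rw [tq_succ, ih (by push_cast; rfl), this]; ring
  rw [qR.om, h, zpow_natCast, zpow_natCast, zpow_natCast, h2]; ring

lemma poch_add (q a : ℂ) (m n : ℕ) : poch q a (m + n) = poch q a m * poch q (a * q ^ m) n := by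
  induction n with
  | zero => simp [poch_zero]
  | succ n ih => rw [← add_assoc, poch_succ, ih, poch_succ]; ring

lemma pp_add (q c : ℂ) (m n : ℕ) : pp q c (m + n) = pp q c m * poch q (c * q ^ (m + 1)) n := by
  rw [pp, pp, poch_add]; congr 2; ring

lemma Om_T (q s c1 c2 c3 t2 : ℂ) (M n K L : ℕ) (hK : M ≤ K) (hL : 2 * M + 3 ≤ L) (g : Gn q c1 c2 c3 K L)
    (hn : n ≤ M) :
    qR.Om q s c1 c2 c3 t2 (M : ℤ) (n : ℤ) = ((s * t2) ^ (2 * (n : ℤ) - (M : ℤ)))⁻¹ * T q c1 c2 c3 M n 0 := by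
  obtain ⟨r, rfl⟩ : ∃ r, M = n + r := ⟨M - n, by omega⟩
  rw [T_W q c1 c2 c3 (n + r) n r rfl, qR.Om, qR.binom, if_pos (by omega)]
  rw [show (((n + r : ℕ) : ℤ)).toNat = n + r by omega, show ((n : ℤ)).toNat = n by omega,
    show (((n + r : ℕ) : ℤ) - (n : ℤ)).toNat = r by omega, show (((n + r : ℕ) : ℤ) + 1).toNat = n + r + 1 by omega,
    show (2 * (n : ℤ) + 1) = ((2 * n + 1 : ℕ) : ℤ) by push_cast; ring,
    show (((n + r : ℕ) : ℤ) + 2) = ((n + r + 2 : ℕ) : ℤ) by push_cast; ring,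
    show ((n : ℤ) + 1) = ((n + 1 : ℕ) : ℤ) by push_cast; ring, zpow_natCast, zpow_natCast, zpow_natCast]
  have e1 : pp q (c1 * c2 * c3) (2 * n + r + 1) = pp q (c1 * c2 * c3) (n + r + 1) * poch q (c1 * c2 * c3 * q ^ (n + r + 2)) n := by
    rw [← pp_add]; congr 1; ring
  have e2 : pp q (c2 * c3) (2 * n + r + 1) = pp q (c2 * c3) n * poch q (c2 * c3 * q ^ (n + 1)) (n + r + 1) := by
    rw [← pp_add]; congr 1; ring
  have h1 := g.he.pp (show n + r + 1 ≤ L by omega)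
  have h2 := g.hb.pp (show 2 * n + r + 1 ≤ L by omega)
  rw [e2] at h2
  have h3 := left_ne_zero_of_mul h2
  have h4 := right_ne_zero_of_mul h2
  simp only [W, e1, e2, u]
  simp only [show ∀ k, poch q q k = pp q 1 k from fun k => by rw [pp, mul_one]]
  have h5 := g.h3.pp (show n ≤ L by omega)
  have h6 := g.h0.pp (show n ≤ K by omega)
  have h7 := g.h0.pp (show r ≤ K by omega)
  simp only [show ∀ c k, poch q (q * c) k = pp q c k from fun _ _ => rfl]
  generalize pp q (c1 * c2 * c3) (n + r + 1) = E at h1 ⊢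
  generalize (s * t2) ^ (2 * (n : ℤ) - ((n + r : ℕ) : ℤ)) = Z
  by_cases hZ : Z = 0
  · simp [hZ]
  field_simp

lemma p_P (q s c1 c2 c3 t2 : ℂ) (M n x K L : ℕ) (hK : M ≤ K) (hL : 2 * M + 3 ≤ L) (g : Gn q c1 c2 c3 K L) :
    qR.p q s c1 c2 c3 t2 (M : ℤ) (n : ℤ) (x : ℤ) = ((s * t2) ^ (2 * (n : ℤ) - (M : ℤ)))⁻¹ * P q c1 c2 c3 M n x := by
  by_cases h : M < n ∨ M < x
  · rw [P_zero _ _ _ _ _ _ _ h, qR.p, if_neg (by omega), mul_zero]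
  rw [qR.p, if_pos (by omega), Om_T q s c1 c2 c3 t2 M n K L hK hL g (by omega),
    P_eq q c1 c2 c3 M n x (n + 1) (by omega) (by omega), mul_assoc, Finset.mul_sum]
  congr 1
  rw [show ((n : ℤ)).toNat = n by omega]
  apply Finset.sum_congr rfl
  intro k hkk
  simp only [Finset.mem_range] at hkk
  rw [T_k q c1 c2 c3 M n k K L hK hL g (by omega) (by omega)]
  rw [show ((M : ℤ) + 2) = ((M + 2 : ℕ) : ℤ) by push_cast; ring,
    show ((n : ℤ) + 1) = ((n + 1 : ℕ) : ℤ) by push_cast; ring,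
    show ((x : ℤ) + 1) = ((x + 1 : ℕ) : ℤ) by push_cast; ring, zpow_neg, zpow_neg, zpow_neg]
  simp only [zpow_natCast]
  rw [show poch q q k = pp q 1 k by rw [pp, mul_one]]
  simp only [phi, qRH.hk, pp]
  ring

lemma G_SG (q s c0 c1 c2 c3 c4 t0 t1 t2 t3 t4 : ℂ) (N i j x y : ℕ) (g : G5 q c0 c1 c2 c3 c4 N)
    (hs : s ^ 2 = q) (ht1 : t1 ^ 2 = c1) (ht3 : t3 ^ 2 = c3) (n2 : t2 ≠ 0) (n4 : t4 ≠ 0) (n0 : t0 ≠ 0)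
    (hc0 : c0 = (q ^ (2 * (N : ℤ) + 3) * c1 * c2 * c3 * c4)⁻¹)
    (ht0 : t0 = (s ^ (2 * (N : ℤ) + 3) * t1 * t2 * t3 * t4)⁻¹)
    (hb : s ^ (2 * N + 3) * t1 * t2 * t3 * t4 * t0 = 1)
    (hij : i + j ≤ N) (hy : y ≤ N) :
    qR.G q s c1 c2 c3 c4 t1 t2 t3 t4 (N : ℤ) (i : ℤ) (j : ℤ) (x : ℤ) (y : ℤ)
      = (s * t2) ^ (2 * (N : ℤ) - j - y - 2 * i) * (s * t0) ^ ((N : ℤ) - 2 * j) * SG q c0 c1 c2 c3 c4 N i j x y := by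
  rw [qR.G, if_pos (by omega), ← hc0, ← ht0, SG, Finset.mul_sum]
  have hs0 : s ≠ 0 := by rintro rfl; apply g.hq; rw [← hs]; simp
  have g304 : Gn q c3 c0 c4 N (2 * N + 5) := g.s02.s13.s34.gn
  have g421 : Gn q c4 c2 c1 N (2 * N + 5) := g.s34.s13.gn
  have hmin : (min ((N : ℤ) - j) ((N : ℤ) - y)).toNat = min (N - j) (N - y) := by omega
  have hsub : Finset.range (min (N - j) (N - y) + 1) ⊆ Finset.range (N + 1) := by
    intro a ha; simp at ha ⊢; omega
  rw [hmin]
  rw [← Finset.sum_subset hsub]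
  · apply Finset.sum_congr rfl
    intro a ha
    simp only [Finset.mem_range] at ha
    rw [show (N : ℤ) - (j : ℤ) = ((N - j : ℕ) : ℤ) by omega, show (N : ℤ) - (y : ℤ) = ((N - y : ℕ) : ℤ) by omega,
      show (N : ℤ) - (a : ℤ) = ((N - a : ℕ) : ℤ) by omega, om_tq,
      p_P q s c1 c2 c3 t2 (N - j) i a _ _ (by omega) (by omega) g.gn,
      p_P q s c3 c0 c4 t0 (N - a) j y _ _ (by omega) (by omega) g304,
      p_P q s c4 c2 c1 t2 (N - y) a x _ _ (by omega) (by omega) g421]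
    have h2 : s * t2 ≠ 0 := mul_ne_zero hs0 n2
    have h0 : s * t0 ≠ 0 := mul_ne_zero hs0 n0
    have key : (t1 * t2 * t3 / t4) ^ a * ((s * t2) ^ (2 * (i : ℤ) - ((N - j : ℕ) : ℤ)))⁻¹
         * ((s * t0) ^ (2 * (j : ℤ) - ((N - a : ℕ) : ℤ)))⁻¹ * ((s * t2) ^ (2 * (a : ℤ) - ((N - y : ℕ) : ℤ)))⁻¹
        = (s * t2) ^ (((N - j : ℕ) : ℤ) - y - 2 * i + N) * (s * t0) ^ ((N : ℤ) - 2 * j) * (c1 * c3 * q ^ N) ^ a := by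
      have e1 : c1 * c3 * q ^ N = t1 * t2 * t3 / t4 * ((s * t0)⁻¹ * ((s * t2)⁻¹ * (s * t2)⁻¹)) := by
        have : (t1 * t2 * t3 / t4) * ((s * t0)⁻¹ * ((s * t2)⁻¹ * (s * t2)⁻¹)) = t1 * t3 / (t4 * s ^ 3 * t0 * t2) := by
          field_simp
        rw [this, eq_div_iff (by positivity), ← hs, ← ht1, ← ht3]
        linear_combination (t1 * t3) * hb
      rw [e1, mul_pow _ _ a]
      rw [← zpow_neg, ← zpow_neg, ← zpow_neg]
      have e2 : (s * t2) ^ (-(2 * (i : ℤ) - ((N - j : ℕ) : ℤ))) * (s * t0) ^ (-(2 * (j : ℤ) - ((N - a : ℕ) : ℤ)))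
          * (s * t2) ^ (-(2 * (a : ℤ) - ((N - y : ℕ) : ℤ)))
          = (s * t2) ^ (((N - j : ℕ) : ℤ) - y - 2 * i + N) * (s * t0) ^ ((N : ℤ) - 2 * j) *
            ((s * t0)⁻¹ * ((s * t2)⁻¹ * (s * t2)⁻¹)) ^ a := by
        rw [show -(2 * (a : ℤ) - ((N - y : ℕ) : ℤ)) = ((N - y : ℕ) : ℤ) + (-(a : ℤ) + -(a : ℤ)) by ring,
          show -(2 * (j : ℤ) - ((N - a : ℕ) : ℤ)) = ((N : ℤ) - 2 * j) + -(a : ℤ) by omega,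
          show (((N - j : ℕ) : ℤ) - y - 2 * i + N) = -(2 * (i : ℤ) - ((N - j : ℕ) : ℤ)) + ((N - y : ℕ) : ℤ) by omega,
          zpow_add₀ h2, zpow_add₀ h2, zpow_add₀ h0, zpow_add₀ h2]
        simp only [zpow_neg, zpow_natCast, mul_pow, inv_pow]
        ring
      linear_combination (t1 * t2 * t3 / t4) ^ a * e2
    rw [show 2 * (N : ℤ) - j - y - 2 * i = ((N - j : ℕ) : ℤ) - y - 2 * i + N by omega]
    linear_combination (tq q a * P q c1 c2 c3 (N - j) i a * P q c3 c0 c4 (N - a) j y * P q c4 c2 c1 (N - y) a x) * key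
  · intro a ha hb
    simp at ha hb
    by_cases h : N - j < a
    · rw [P_zero q c1 c2 c3 (N - j) i a (Or.inr h)]; ring
    · rw [P_zero q c4 c2 c1 (N - y) a x (Or.inl (by omega))]; ring


lemma eqi {a b : ℂ} (h : b ≠ 0) : a = b⁻¹ ↔ a * b = 1 := by
  constructor
  · rintro rfl; exact inv_mul_cancel₀ h
  · exact eq_inv_of_mul_eq_one_left

lemma final_scalar (q s t0 t1 t2 t3 t4 A B : ℂ) (N i j x y : ℕ) (hs : s ^ 2 = q)
    (hb : s ^ (2 * N + 3) * t1 * t2 * t3 * t4 * t0 = 1)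
    (h : ∀ (U V : ℂ), U = q ^ ((N + 1) * (j + y)) * (t1 ^ 2) ^ j * (t4 ^ 2) ^ y →
      V = q ^ ((N + 1) * (i + x)) * (t1 ^ 2) ^ i * (t3 ^ 2) ^ x → U * A = V * B) :
    (s * t2) ^ (2 * (N : ℤ) - j - y - 2 * i) * (s * t0) ^ ((N : ℤ) - 2 * j) * A
        * (t2 * t3 * t4 / t1) ^ i * (t4 * t2 * t1 / t3) ^ x * t0 ^ N
      = (s * t0) ^ (2 * (N : ℤ) - i - x - 2 * j) * (s * t2) ^ ((N : ℤ) - 2 * i) * B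
        * (t3 * t0 * t4 / t1) ^ j * (t1 * t0 * t3 / t4) ^ y * t2 ^ N := by
  have hne : s ^ (2 * N + 3) * t1 * t2 * t3 * t4 * t0 ≠ 0 := by rw [hb]; exact one_ne_zero
  have n0 : t0 ≠ 0 := right_ne_zero_of_mul hne
  have n4 : t4 ≠ 0 := right_ne_zero_of_mul (left_ne_zero_of_mul hne)
  have n3 : t3 ≠ 0 := right_ne_zero_of_mul (left_ne_zero_of_mul (left_ne_zero_of_mul hne))
  have n2 : t2 ≠ 0 := right_ne_zero_of_mul (left_ne_zero_of_mul (left_ne_zero_of_mul (left_ne_zero_of_mul hne)))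
  have n1 : t1 ≠ 0 := by rintro rfl; simp at hne
  have ns : s ≠ 0 := by rintro rfl; simp at hne
  have h' := h _ _ rfl rfl
  have h2 : s * t2 ≠ 0 := mul_ne_zero ns n2
  have h0 : s * t0 ≠ 0 := mul_ne_zero ns n0
  have hqN : q ^ (N + 1) = (s ^ (2 * N + 2)) := by rw [← hs, ← pow_mul]; ring_nf
  have ei : (t2 * t3 * t4 / t1) ^ i = ((q ^ (N + 1) * t1 ^ 2) ^ i)⁻¹ * ((s * t0) ^ i)⁻¹ := by
    rw [← mul_inv, ← mul_pow, ← inv_pow]; congr 1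
    rw [qRH.eqi (by rw [hqN]; positivity), ← hb, hqN]; field_simp; ring
  have ex : (t4 * t2 * t1 / t3) ^ x = ((q ^ (N + 1) * t3 ^ 2) ^ x)⁻¹ * ((s * t0) ^ x)⁻¹ := by
    rw [← mul_inv, ← mul_pow, ← inv_pow]; congr 1
    rw [qRH.eqi (by rw [hqN]; positivity), ← hb, hqN]; field_simp; ring
  have ej : (t3 * t0 * t4 / t1) ^ j = ((q ^ (N + 1) * t1 ^ 2) ^ j)⁻¹ * ((s * t2) ^ j)⁻¹ := by
    rw [← mul_inv, ← mul_pow, ← inv_pow]; congr 1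
    rw [qRH.eqi (by rw [hqN]; positivity), ← hb, hqN]; field_simp; ring
  have ey : (t1 * t0 * t3 / t4) ^ y = ((q ^ (N + 1) * t4 ^ 2) ^ y)⁻¹ * ((s * t2) ^ y)⁻¹ := by
    rw [← mul_inv, ← mul_pow, ← inv_pow]; congr 1
    rw [qRH.eqi (by rw [hqN]; positivity), ← hb, hqN]; field_simp; ring
  have hq0 : q ≠ 0 := by rw [← hs]; positivity
  rw [ei, ex, ej, ey,
    show 2 * (N : ℤ) - j - y - 2 * i = ((N : ℤ) - 2 * i) + (N : ℤ) + (-(j : ℤ)) + (-(y : ℤ)) by ring,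
    show 2 * (N : ℤ) - i - x - 2 * j = ((N : ℤ) - 2 * j) + (N : ℤ) + (-(i : ℤ)) + (-(x : ℤ)) by ring,
    zpow_add₀ h2, zpow_add₀ h2, zpow_add₀ h2, zpow_add₀ h0, zpow_add₀ h0, zpow_add₀ h0]
  simp only [zpow_neg, zpow_natCast]
  have k : ((q ^ (N + 1) * t1 ^ 2) ^ i)⁻¹ * ((q ^ (N + 1) * t3 ^ 2) ^ x)⁻¹ * A
      = ((q ^ (N + 1) * t1 ^ 2) ^ j)⁻¹ * ((q ^ (N + 1) * t4 ^ 2) ^ y)⁻¹ * B := by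
    have m1 : (q ^ (N + 1) * t1 ^ 2) ^ i * (q ^ (N + 1) * t3 ^ 2) ^ x ≠ 0 := by positivity
    have m2 : (q ^ (N + 1) * t1 ^ 2) ^ j * (q ^ (N + 1) * t4 ^ 2) ^ y ≠ 0 := by positivity
    rw [← mul_inv, ← mul_inv, inv_mul_eq_iff_eq_mul₀ m1, mul_left_comm, eq_inv_mul_iff_mul_eq₀ m2]
    simp only [mul_pow, ← pow_mul] at h' ⊢
    rw [mul_add, mul_add, pow_add, pow_add] at h'
    linear_combination h'
  generalize (s * t2) ^ ((N : ℤ) - 2 * i) = X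
  generalize (s * t0) ^ ((N : ℤ) - 2 * j) = Y
  linear_combination (X * Y * s ^ N * t2 ^ N * t0 ^ N * ((s * t2) ^ j)⁻¹ * ((s * t2) ^ y)⁻¹ * ((s * t0) ^ i)⁻¹
    * ((s * t0) ^ x)⁻¹) * k

lemma mkG5 (N : ℕ) (q c0 c1 c2 c3 c4 : ℂ) (hq : q ≠ 0) (hc1 : c1 ≠ 0) (hc2 : c2 ≠ 0) (hc3 : c3 ≠ 0) (hc4 : c4 ≠ 0)
    (hc0 : c0 = (q ^ (2 * (N : ℤ) + 3) * c1 * c2 * c3 * c4)⁻¹)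
    (hgen : ∀ e0 e1 e2 e3 e4 : ℕ, e0 ≤ 1 → e1 ≤ 1 → e2 ≤ 1 → e3 ≤ 1 → e4 ≤ 1 →
      1 ≤ e0 + e1 + e2 + e3 + e4 → e0 + e1 + e2 + e3 + e4 ≤ 4 →
      ∀ k : ℤ, 1 ≤ k → k ≤ 2 * (N : ℤ) + 5 →
        c0 ^ e0 * c1 ^ e1 * c2 ^ e2 * c3 ^ e3 * c4 ^ e4 ≠ q ^ (-k))
    (hq1 : ∀ k : ℕ, 1 ≤ k → k ≤ N → q ^ k ≠ 1) : G5 q c0 c1 c2 c3 c4 N := by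
  have e : q ^ (2 * (N : ℤ) + 3) = q ^ (2 * N + 3) := by
    rw [show 2 * (N : ℤ) + 3 = ((2 * N + 3 : ℕ) : ℤ) by push_cast; ring, zpow_natCast]
  rw [e] at hc0
  refine ⟨hq, ?_, ?_, hc1, hc2, hc3, hc4, ?_, ?_⟩
  · intro k h1 h2 h
    rw [u] at h
    exact hq1 k h1 h2 (by linear_combination -h)
  · rw [hc0]; positivity
  · rw [hc0]; field_simp
  · rintro e0 e1 e2 e3 e4 ⟨h0, h1, h2, h3, h4, h5, h6⟩ k hk1 hk2 h
    apply hgen e0 e1 e2 e3 e4 h0 h1 h2 h3 h4 h5 h6 k (by omega) (by omega)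
    rw [u] at h
    rw [zpow_neg, zpow_natCast, qRH.eqi (by positivity)]
    linear_combination -h

end qRH

/-- Symmetry theorem for the Griffiths polynomials of q-Racah type. -/
theorem griffiths_symmetry
    (N : ℕ) (q s c1 c2 c3 c4 c0 t1 t2 t3 t4 t0 : ℂ)
    (hq : q ≠ 0) (hc1 : c1 ≠ 0) (hc2 : c2 ≠ 0) (hc3 : c3 ≠ 0) (hc4 : c4 ≠ 0)
    (hs : s ^ 2 = q) (ht1 : t1 ^ 2 = c1) (ht2 : t2 ^ 2 = c2) (ht3 : t3 ^ 2 = c3)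
    (ht4 : t4 ^ 2 = c4)
    (hc0 : c0 = (q ^ (2 * (N : ℤ) + 3) * c1 * c2 * c3 * c4)⁻¹)
    (ht0 : t0 = (s ^ (2 * (N : ℤ) + 3) * t1 * t2 * t3 * t4)⁻¹)
    (hgen : ∀ e0 e1 e2 e3 e4 : ℕ, e0 ≤ 1 → e1 ≤ 1 → e2 ≤ 1 → e3 ≤ 1 → e4 ≤ 1 →
      1 ≤ e0 + e1 + e2 + e3 + e4 → e0 + e1 + e2 + e3 + e4 ≤ 4 →
      ∀ k : ℤ, 1 ≤ k → k ≤ 2 * (N : ℤ) + 5 →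
        c0 ^ e0 * c1 ^ e1 * c2 ^ e2 * c3 ^ e3 * c4 ^ e4 ≠ q ^ (-k))
    (hq1 : ∀ k : ℕ, 1 ≤ k → k ≤ N → q ^ k ≠ 1)
    (i j x y : ℕ) (hij : i + j ≤ N) (hxy : x + y ≤ N) :
    qR.G q s c1 c2 c3 c4 t1 t2 t3 t4 (N : ℤ) (i : ℤ) (j : ℤ) (x : ℤ) (y : ℤ)
        * qR.om q (t2 * t3 * t4 / t1) (i : ℤ) * qR.om q (t4 * t2 * t1 / t3) (x : ℤ) * t0 ^ N
      = qR.G q s c1 c0 c4 c3 t1 t0 t4 t3 (N : ℤ) (j : ℤ) (i : ℤ) (y : ℤ) (x : ℤ)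
          * qR.om q (t3 * t0 * t4 / t1) (j : ℤ) * qR.om q (t1 * t0 * t3 / t4) (y : ℤ)
          * t2 ^ N := by
  have g := qRH.mkG5 N q c0 c1 c2 c3 c4 hq hc1 hc2 hc3 hc4 hc0 hgen hq1
  have ns : s ≠ 0 := by rintro rfl; apply hq; rw [← hs]; simp
  have n1 : t1 ≠ 0 := by rintro rfl; apply hc1; rw [← ht1]; simp
  have n2 : t2 ≠ 0 := by rintro rfl; apply hc2; rw [← ht2]; simp
  have n3 : t3 ≠ 0 := by rintro rfl; apply hc3; rw [← ht3]; simp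
  have n4 : t4 ≠ 0 := by rintro rfl; apply hc4; rw [← ht4]; simp
  have es : s ^ (2 * (N : ℤ) + 3) = s ^ (2 * N + 3) := by
    rw [show 2 * (N : ℤ) + 3 = ((2 * N + 3 : ℕ) : ℤ) by push_cast; ring, zpow_natCast]
  have eq : q ^ (2 * (N : ℤ) + 3) = q ^ (2 * N + 3) := by
    rw [show 2 * (N : ℤ) + 3 = ((2 * N + 3 : ℕ) : ℤ) by push_cast; ring, zpow_natCast]
  have n0 : t0 ≠ 0 := by rw [ht0, es]; positivity
  have hb : s ^ (2 * N + 3) * t1 * t2 * t3 * t4 * t0 = 1 := by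
    rw [ht0, es]; exact mul_inv_cancel₀ (by positivity)
  have h1 := qRH.G_SG q s c0 c1 c2 c3 c4 t0 t1 t2 t3 t4 N i j x y g hs ht1 ht3 n2 n4 n0 hc0 ht0 hb hij (by omega)
  have h2 := qRH.G_SG q s c2 c1 c0 c4 c3 t2 t1 t0 t4 t3 N j i y x g.s02.s34 hs ht1 ht4 n0 n3 n2
    (by
      have := g.bal
      rw [eq, qRH.eqi]
      · linear_combination this
      · have := g.n0
        positivity)
    (by
      rw [es, qRH.eqi (by positivity)]
      linear_combination hb)
    (by linear_combination hb) (by omega) (by omega)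
  have hC := qRH.main0 N q c0 c1 c2 c3 c4 i j x y g hxy
  rw [h1, h2]
  simp only [qRH.om_tq]
  have := qRH.final_scalar q s t0 t1 t2 t3 t4
    (qRH.tq q i * qRH.tq q x * qRH.SG q c0 c1 c2 c3 c4 N i j x y)
    (qRH.tq q j * qRH.tq q y * qRH.SG q c2 c1 c0 c4 c3 N j i y x) N i j x y hs hb
    (by
      rintro U V rfl rfl
      rw [ht1, ht3, ht4]
      unfold qRH.Cl at hC
      linear_combination hC)
  linear_combination this
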